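/- Let K be a number field of degree n = s + 2 (so t = 1) with s real embeddings, and assume Γ = O_K ⋊ U acts freely and properly discontinuously on ℍ^s × ℂ so that M_K = (ℍ^s × ℂ)/Γ is a compact complex manifold. Then M_K has no non-trivial closed complex subvarieties: every closed complex subvariety of M_K is either a finite set of points or all of M_K. -/

import Mathlib

open NumberField

noncomputable section

/-- The combined embedding (σᵢ real for `i < s`, the chosen complex embedding for `i = s`). -/
def otEmb {K : Type*} [Field K] {s t : ℕ}
    (σr : Fin s → (K →+* ℝ)) (σc : Fin t → (K →+* ℂ)) (i : Fin (s + t)) (x : K) : ℂ :=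
  Fin.addCases (motive := fun _ => ℂ) (fun i₀ => (σr i₀ x : ℂ)) (fun j₀ => σc j₀ x) i

/-- Translation part of the OT action. -/
def otT {K : Type*} [Field K] [NumberField K] {s t : ℕ}
    (σr : Fin s → (K →+* ℝ)) (σc : Fin t → (K →+* ℂ)) (a : 𝓞 K)
    (z : Fin (s + t) → ℂ) : Fin (s + t) → ℂ :=
  fun i => z i + otEmb σr σc i (algebraMap (𝓞 K) K a)

/-- Multiplicative part of the OT action. -/
def otR {K : Type*} [Field K] [NumberField K] {s t : ℕ}
    (σr : Fin s → (K →+* ℝ)) (σc : Fin t → (K →+* ℂ)) (u : (𝓞 K)ˣ)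
    (z : Fin (s + t) → ℂ) : Fin (s + t) → ℂ :=
  fun i => otEmb σr σc i (algebraMap (𝓞 K) K (u : 𝓞 K)) * z i

set_option linter.unusedSectionVars false

section

open Set Filter Topology Metric

/-- `f` is continuous on `V` and holomorphic along every complex line through a point of `V`. -/
def LineHol {E : Type*} [NormedAddCommGroup E] [NormedSpace ℂ E] (f : E → ℂ) (V : Set E) : Prop :=
  ContinuousOn f V ∧ ∀ a ∈ V, ∀ v : E, DifferentiableAt ℂ (fun t : ℂ => f (a + t • v)) 0

namespace LineHol

variable {E E' : Type*} [NormedAddCommGroup E] [NormedSpace ℂ E] [NormedAddCommGroup E']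
  [NormedSpace ℂ E'] {f g : E → ℂ} {V W : Set E}

theorem of_differentiableOn (hV : IsOpen V) (hf : DifferentiableOn ℂ f V) : LineHol f V := by
  refine ⟨hf.continuousOn, fun a ha v => ?_⟩
  have h1 : DifferentiableAt ℂ f (a + (0 : ℂ) • v) := by
    simpa using hf.differentiableAt (hV.mem_nhds ha)
  exact h1.comp (0 : ℂ) (by fun_prop)

theorem mono (hf : LineHol f W) (h : V ⊆ W) : LineHol f V :=
  ⟨hf.1.mono h, fun a ha => hf.2 a (h ha)⟩

theorem congr (hV : IsOpen V) (hf : LineHol f V) (h : EqOn g f V) : LineHol g V := by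
  refine ⟨hf.1.congr h, fun a ha v => (hf.2 a ha v).congr_of_eventuallyEq ?_⟩
  have : Tendsto (fun t : ℂ => a + t • v) (𝓝 0) (𝓝 a) := by
    have : Continuous (fun t : ℂ => a + t • v) := by fun_prop
    simpa using this.tendsto 0
  filter_upwards [this (hV.mem_nhds ha)] with t ht using h ht

theorem const (c : ℂ) : LineHol (fun _ : E => c) V :=
  ⟨continuousOn_const, fun _ _ _ => differentiableAt_const _⟩

theorem add (hf : LineHol f V) (hg : LineHol g V) : LineHol (fun x => f x + g x) V :=
  ⟨hf.1.add hg.1, fun a ha v => (hf.2 a ha v).add (hg.2 a ha v)⟩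

theorem sub (hf : LineHol f V) (hg : LineHol g V) : LineHol (fun x => f x - g x) V :=
  ⟨hf.1.sub hg.1, fun a ha v => (hf.2 a ha v).sub (hg.2 a ha v)⟩

theorem mul (hf : LineHol f V) (hg : LineHol g V) : LineHol (fun x => f x * g x) V :=
  ⟨hf.1.mul hg.1, fun a ha v => (hf.2 a ha v).mul (hg.2 a ha v)⟩

theorem pow (hf : LineHol f V) (n : ℕ) : LineHol (fun x => f x ^ n) V :=
  ⟨hf.1.pow n, fun a ha v => (hf.2 a ha v).pow n⟩

theorem sum {ι : Type*} (s : Finset ι) {F : ι → E → ℂ} (h : ∀ i ∈ s, LineHol (F i) V) :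
    LineHol (fun x => ∑ i ∈ s, F i x) V :=
  ⟨continuousOn_finsetSum _ fun i hi => (h i hi).1,
    fun a ha v => DifferentiableAt.fun_sum fun i hi => (h i hi).2 a ha v⟩

theorem prod {ι : Type*} (s : Finset ι) {F : ι → E → ℂ} (h : ∀ i ∈ s, LineHol (F i) V) :
    LineHol (fun x => ∏ i ∈ s, F i x) V :=
  ⟨continuousOn_finsetProd _ fun i hi => (h i hi).1,
    fun a ha v => DifferentiableAt.fun_finsetProd fun i hi => (h i hi).2 a ha v⟩

theorem det {n : ℕ} {M : E → Matrix (Fin n) (Fin n) ℂ}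
    (h : ∀ i j, LineHol (fun x => M x i j) V) : LineHol (fun x => (M x).det) V := by
  simp only [Matrix.det_apply']
  exact sum _ fun σ _ => (const _).mul (prod _ fun i _ => h _ _)

theorem comp_affine {L : E' → E} (hL : Continuous L) {W : Set E'}
    (hline : ∀ a v : E', ∃ w : E, ∀ t : ℂ, L (a + t • v) = L a + t • w)
    (hf : LineHol f V) (hW : MapsTo L W V) : LineHol (fun x => f (L x)) W := by
  refine ⟨hf.1.comp hL.continuousOn hW, fun a ha v => ?_⟩
  obtain ⟨w, hw⟩ := hline a v
  simp only [hw]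
  exact hf.2 _ (hW ha) w

theorem differentiableOn_line (hf : LineHol f V) (a v : E) :
    DifferentiableOn ℂ (fun t : ℂ => f (a + t • v)) {t | a + t • v ∈ V} := by
  intro t ht
  have h1 := hf.2 _ ht v
  have h2 : DifferentiableAt ℂ (fun t' : ℂ => f (a + t • v + t' • v)) (t - t) := by simpa using h1
  have h3 : DifferentiableAt ℂ (fun t' : ℂ => f (a + t • v + (t' - t) • v)) t :=
    DifferentiableAt.comp (f := fun t' : ℂ => t' - t) t h2 (differentiableAt_id.sub_const t)
  refine (h3.congr_of_eventuallyEq (Eventually.of_forall fun t' => ?_)).differentiableWithinAt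
  simp only [sub_smul]
  congr 1
  abel

theorem isOpen_line (hV : IsOpen V) (a v : E) : IsOpen {t : ℂ | a + t • v ∈ V} :=
  hV.preimage (by fun_prop : Continuous fun t : ℂ => a + t • v)

theorem differentiableOn {f : ℂ → ℂ} {V : Set ℂ} (hf : LineHol f V) : DifferentiableOn ℂ f V := by
  have := hf.differentiableOn_line 0 1
  simpa using this

end LineHol

section ParamIntegral

variable {E : Type*} [NormedAddCommGroup E] [NormedSpace ℂ E]

/-- Differentiation under the integral sign for holomorphic dependence on the parameter. -/
theorem differentiableAt_intervalIntegral {U : Set ℂ} (hU : IsOpen U) {F : ℂ → ℝ → ℂ}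
    (hc : ContinuousOn (Function.uncurry F) (U ×ˢ univ)) {a b : ℝ}
    (hd : ∀ θ, DifferentiableOn ℂ (fun t => F t θ) U) {t₀ : ℂ} (ht₀ : t₀ ∈ U) :
    DifferentiableAt ℂ (fun t => ∫ θ in a..b, F t θ) t₀ := by
  obtain ⟨δ, hδ, hball⟩ := Metric.isOpen_iff.1 hU t₀ ht₀
  have hcθ : ∀ t ∈ U, Continuous (F t) := by
    intro t ht
    rw [← continuousOn_univ]
    exact hc.comp (f := fun θ => (t, θ)) (by fun_prop) (fun θ _ => ⟨ht, mem_univ _⟩)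
  -- a uniform bound on a compact set
  have hK : IsCompact (closedBall t₀ (δ / 2) ×ˢ uIcc a b) :=
    (isCompact_closedBall _ _).prod isCompact_uIcc
  have hsub : closedBall t₀ (δ / 2) ⊆ U :=
    (closedBall_subset_ball (by linarith)).trans hball
  obtain ⟨M, hM⟩ := hK.exists_bound_of_continuousOn
    (hc.mono (prod_mono hsub (subset_univ _)))
  have hderiv : ∀ θ ∈ uIcc a b, ∀ t ∈ ball t₀ (δ / 4), ‖deriv (fun t => F t θ) t‖ ≤ M / (δ / 4) := by
    intro θ hθ t ht
    refine Complex.norm_deriv_le_of_forall_mem_sphere_norm_le (by linarith) ?_ ?_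
    · refine DifferentiableOn.diffContOnCl ((hd θ).mono ?_)
      rw [closure_ball _ (by linarith)]
      intro z hz
      refine hsub ?_
      rw [mem_closedBall] at hz ⊢
      rw [mem_ball] at ht
      linarith [dist_triangle z t t₀]
    · intro z hz
      refine hM (z, θ) ⟨?_, hθ⟩
      rw [mem_sphere] at hz
      rw [mem_ball] at ht
      rw [mem_closedBall]
      linarith [dist_triangle z t t₀]
  have hda : ∀ θ, ∀ t ∈ U, HasDerivAt (fun t => F t θ) (deriv (fun t => F t θ) t) t :=
    fun θ t ht => ((hd θ).differentiableAt (hU.mem_nhds ht)).hasDerivAt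
  have hmeas : MeasureTheory.AEStronglyMeasurable (fun θ => deriv (fun t => F t θ) t₀)
      (MeasureTheory.volume.restrict (uIoc a b)) := by
    set u : ℕ → ℂ := fun n => ((δ / 2 / (n + 1) : ℝ) : ℂ) with hu
    have hun : ∀ n, ‖u n‖ ≤ δ / 2 ∧ u n ≠ 0 := by
      intro n
      have hpos : 0 < δ / 2 / (n + 1) := by positivity
      refine ⟨?_, ?_⟩
      · rw [hu, Complex.norm_real, Real.norm_of_nonneg hpos.le]
        exact div_le_self (by linarith) (by linarith [n.cast_nonneg (α := ℝ)])
      · exact Complex.ofReal_ne_zero.2 hpos.ne'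
    have hu0 : Tendsto u atTop (𝓝[≠] 0) := by
      rw [tendsto_nhdsWithin_iff]
      refine ⟨?_, Eventually.of_forall fun n => (hun n).2⟩
      have h1 : Tendsto (fun n : ℕ => δ / 2 / ((n : ℝ) + 1)) atTop (𝓝 0) := by
        have := (tendsto_one_div_add_atTop_nhds_zero_nat (𝕜 := ℝ)).const_mul (δ / 2)
        simpa [div_eq_mul_inv] using this
      have := (Complex.continuous_ofReal.tendsto 0).comp h1
      simpa [hu, Function.comp_def] using this
    refine aestronglyMeasurable_of_tendsto_ae atTop
      (f := fun n θ => (u n)⁻¹ • (F (t₀ + u n) θ - F t₀ θ)) (fun n => ?_)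
      (Eventually.of_forall fun θ => ?_)
    · have : t₀ + u n ∈ U := hsub (by simpa [mem_closedBall, dist_eq_norm] using (hun n).1)
      exact (((hcθ _ this).sub (hcθ _ ht₀)).const_smul (u n)⁻¹).aestronglyMeasurable
    · have := (hasDerivAt_iff_tendsto_slope_zero.1 (hda θ t₀ ht₀))
      exact this.comp hu0
  have key := intervalIntegral.hasDerivAt_integral_of_dominated_loc_of_deriv_le
    (μ := MeasureTheory.volume) (a := a) (b := b) (F := F)
    (F' := fun t θ => deriv (fun t => F t θ) t) (x₀ := t₀) (s := ball t₀ (δ / 4))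
    (bound := fun _ => M / (δ / 4)) (ball_mem_nhds _ (by linarith)) ?_
    ((hcθ _ ht₀).intervalIntegrable _ _) hmeas ?_ intervalIntegrable_const ?_
  · exact key.2.differentiableAt
  · filter_upwards [hU.mem_nhds ht₀] with t ht using (hcθ _ ht).aestronglyMeasurable
  · exact Eventually.of_forall fun θ hθ t ht => hderiv θ (uIoc_subset_uIcc hθ) t ht
  · exact Eventually.of_forall fun θ hθ t ht =>
      hda θ t (hsub (ball_subset_closedBall.trans (closedBall_subset_closedBall (by linarith)) ht))

theorem LineHol.circleIntegral {P : Set E} (hP : IsOpen P) {G : E → ℂ → ℂ} {c : ℂ} {R : ℝ}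
    (hR : 0 ≤ R) (hc : ContinuousOn (Function.uncurry G) (P ×ˢ sphere c R))
    (hd : ∀ y ∈ sphere c R, ∀ a ∈ P, ∀ v : E, DifferentiableAt ℂ (fun t : ℂ => G (a + t • v) y) 0) :
    LineHol (fun ζ => ∮ y in C(c, R), G ζ y) P := by
  have hc' : ContinuousOn (fun p : E × ℝ => deriv (circleMap c R) p.2 • G p.1 (circleMap c R p.2))
      (P ×ˢ univ) := by
    have h2 : ContinuousOn (fun p : E × ℝ => G p.1 (circleMap c R p.2)) (P ×ˢ univ) :=
      hc.comp (f := fun p : E × ℝ => (p.1, circleMap c R p.2)) (by fun_prop)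
        (fun p hp => ⟨hp.1, circleMap_mem_sphere _ hR _⟩)
    simp only [deriv_circleMap, smul_eq_mul]
    exact ContinuousOn.mul (by fun_prop) h2
  refine ⟨?_, fun a ha v => ?_⟩
  · rw [continuousOn_iff_continuous_domRestrict]
    have : Continuous (Function.uncurry
        (fun (ζ : P) (θ : ℝ) => deriv (circleMap c R) θ • G ζ (circleMap c R θ))) := by
      rw [← continuousOn_univ]
      exact hc'.comp (f := fun p : P × ℝ => ((p.1 : E), p.2)) (by fun_prop)
        (fun p _ => ⟨p.1.2, mem_univ _⟩)
    exact intervalIntegral.continuous_parametric_intervalIntegral_of_continuous' this _ _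
  · have hopen := LineHol.isOpen_line hP a v
    refine differentiableAt_intervalIntegral hopen
      (F := fun t θ => deriv (circleMap c R) θ • G (a + t • v) (circleMap c R θ)) ?_ ?_
      (by simpa using ha)
    · exact hc'.comp (f := fun p : ℂ × ℝ => (a + p.1 • v, p.2)) (by fun_prop)
        (fun p hp => ⟨hp.1, mem_univ _⟩)
    · intro θ t ht
      have h1 := hd (circleMap c R θ) (circleMap_mem_sphere _ hR _) _ ht v
      have h2 : DifferentiableAt ℂ
        (fun t' : ℂ => G (a + t • v + t' • v) (circleMap c R θ)) (t - t) := by simpa using h1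
      have h3 : DifferentiableAt ℂ
        (fun t' : ℂ => G (a + t • v + (t' - t) • v) (circleMap c R θ)) t :=
        DifferentiableAt.comp (f := fun t' : ℂ => t' - t) t h2 (differentiableAt_id.sub_const t)
      refine DifferentiableAt.differentiableWithinAt (DifferentiableAt.fun_const_smul ?_ _)
      refine h3.congr_of_eventuallyEq (Eventually.of_forall fun t' => ?_)
      simp only [sub_smul]
      congr 1
      abel

end ParamIntegral

end

section

open Set Filter Topology Metric

section OneVariable

/-- Splitting off finitely many zeros of a holomorphic function. -/
theorem exists_list_factor {U : Set ℂ} (hU : IsOpen U) {K : Set ℂ} (hK : K ⊆ U) (T : Finset ℂ)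
    {φ : ℂ → ℂ} (hφ : DifferentiableOn ℂ φ U) (hT : ∀ w ∈ K, φ w = 0 → w ∈ T)
    (hTK : ∀ a ∈ T, a ∈ U) (hne : ∀ a ∈ T, ¬ ∀ᶠ w in 𝓝 a, φ w = 0) :
    ∃ (L : List ℂ) (u : ℂ → ℂ), DifferentiableOn ℂ u U ∧ (∀ w ∈ K, u w ≠ 0) ∧
      ∀ w ∈ U, φ w = (L.map (fun a => w - a)).prod * u w := by
  classical
  induction T using Finset.induction_on generalizing φ with
  | empty => exact ⟨[], φ, hφ, fun w hw h => by simpa using hT w hw h, by simp⟩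
  | insert a T haT ih =>
    have haU : a ∈ U := hTK a (Finset.mem_insert_self _ _)
    have han : AnalyticAt ℂ φ a := hφ.analyticAt (hU.mem_nhds haU)
    obtain ⟨n, g, hg, hga, heq⟩ := han.exists_eventuallyEq_pow_smul_nonzero_iff.2
      (hne a (Finset.mem_insert_self _ _))
    set v : ℂ → ℂ := fun w => if w = a then g a else φ w / (w - a) ^ n with hv
    have hvg : v =ᶠ[𝓝 a] g := by
      filter_upwards [heq] with w hw
      by_cases hwa : w = a
      · simp [hv, hwa]
      · have : (w - a) ^ n ≠ 0 := pow_ne_zero _ (sub_ne_zero.2 hwa)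
        simp only [hv, hwa, if_false, hw, smul_eq_mul]
        field_simp
    have hvφ : ∀ w, w ≠ a → v w = φ w / (w - a) ^ n := fun w hw => by simp [hv, hw]
    have hva : v a = g a := by simp [hv]
    have hφv : ∀ w ∈ U, φ w = (w - a) ^ n * v w := by
      intro w hw
      by_cases hwa : w = a
      · rw [hwa, hva]
        have := heq.self_of_nhds
        simpa using this
      · have : (w - a) ^ n ≠ 0 := pow_ne_zero _ (sub_ne_zero.2 hwa)
        rw [hvφ w hwa]
        field_simp
    have hvd : DifferentiableOn ℂ v U := by
      intro w hw
      by_cases hwa : w = a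
      · rw [hwa]
        exact (hg.differentiableAt.congr_of_eventuallyEq hvg).differentiableWithinAt
      · have h1 : DifferentiableAt ℂ φ w := hφ.differentiableAt (hU.mem_nhds hw)
        have h2 : DifferentiableAt ℂ (fun w => φ w / (w - a) ^ n) w :=
          h1.div (by fun_prop) (pow_ne_zero _ (sub_ne_zero.2 hwa))
        refine (h2.congr_of_eventuallyEq ?_).differentiableWithinAt
        filter_upwards [isOpen_ne.mem_nhds hwa] with x hx using hvφ x hx
    obtain ⟨L, u, hu, huK, hL⟩ := ih (φ := v) hvd (fun w hw h0 => by
        have h1 : φ w = 0 := by rw [hφv w (hK hw), h0, mul_zero]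
        rcases Finset.mem_insert.1 (hT w hw h1) with h | h
        · rw [h, hva] at h0
          exact absurd h0 hga
        · exact h) (fun b hb => hTK b (Finset.mem_insert_of_mem hb)) (fun b hb h => by
        refine hne b (Finset.mem_insert_of_mem hb) ?_
        filter_upwards [h, hU.mem_nhds (hTK b (Finset.mem_insert_of_mem hb))] with w hw hwU
        rw [hφv w hwU, hw, mul_zero])
    refine ⟨List.replicate n a ++ L, u, hu, huK, fun w hw => ?_⟩
    rw [hφv w hw, hL w hw]
    simp [mul_assoc]

theorem circleIntegral_mul_logDeriv {U : Set ℂ} (hU : IsOpen U) {c : ℂ} {r : ℝ} (hr : 0 < r)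
    (hK : closedBall c r ⊆ U) {u h : ℂ → ℂ} (hu : DifferentiableOn ℂ u U)
    (hu0 : ∀ w ∈ closedBall c r, u w ≠ 0) (hh : DifferentiableOn ℂ h U) (L : List ℂ)
    (hL : ∀ a ∈ L, a ∈ ball c r) {φ : ℂ → ℂ}
    (hφ : ∀ w ∈ U, φ w = (L.map (fun a => w - a)).prod * u w) :
    (∮ w in C(c, r), h w * (deriv φ w / φ w)) = 2 * Real.pi * Complex.I * (L.map h).sum := by
  have hsU : sphere c r ⊆ U := sphere_subset_closedBall.trans hK
  induction L generalizing φ with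
  | nil =>
    have h1 : ∀ w ∈ sphere c r, h w * (deriv φ w / φ w) = h w * (deriv u w / u w) := by
      intro w hw
      have : φ =ᶠ[𝓝 w] u := by
        filter_upwards [hU.mem_nhds (hsU hw)] with x hx
        simpa using hφ x hx
      rw [this.deriv_eq, this.self_of_nhds]
    rw [circleIntegral.integral_congr hr.le h1]
    simp only [List.map_nil, List.sum_nil, mul_zero]
    refine DiffContOnCl.circleIntegral_eq_zero hr.le ?_
    have hd : DifferentiableOn ℂ (fun w => h w * (deriv u w / u w)) (closedBall c r) :=
      (hh.mono hK).mul (((hu.deriv hU).mono hK).div (hu.mono hK) hu0)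
    refine DifferentiableOn.diffContOnCl ?_
    rwa [closure_ball c hr.ne']
  | cons a L ih =>
    set ψ : ℂ → ℂ := fun w => (L.map (fun a => w - a)).prod * u w with hψ
    have hψU : DifferentiableOn ℂ ψ U := by
      refine DifferentiableOn.mul ?_ hu
      have : ∀ M : List ℂ, Differentiable ℂ (fun w => (M.map (fun a => w - a)).prod) := by
        intro M
        induction M with
        | nil => simp
        | cons b M ihM =>
          simp only [List.map_cons, List.prod_cons]
          exact (differentiable_id.sub_const b).mul ihM
      exact (this L).differentiableOn
    have hsub : ∀ w ∈ sphere c r, ∀ b ∈ ball c r, w - b ≠ 0 := by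
      intro w hw b hb h0
      rw [sub_eq_zero.1 h0] at hw
      rw [mem_sphere] at hw
      rw [mem_ball, hw] at hb
      exact lt_irrefl _ hb
    have hψ0 : ∀ w ∈ sphere c r, ψ w ≠ 0 := by
      intro w hw
      refine mul_ne_zero ?_ (hu0 w (sphere_subset_closedBall hw))
      refine List.prod_ne_zero ?_
      simp only [List.mem_map, not_exists, not_and]
      intro b hb
      exact hsub w hw b (hL b (List.mem_cons_of_mem _ hb))
    have hfac : ∀ w ∈ U, φ w = (w - a) * ψ w := by
      intro w hw
      rw [hφ w hw, hψ]
      simp [mul_assoc]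
    have h1 : ∀ w ∈ sphere c r, h w * (deriv φ w / φ w) =
        (w - a)⁻¹ • h w + h w * (deriv ψ w / ψ w) := by
      intro w hw
      have he : φ =ᶠ[𝓝 w] fun w => (w - a) * ψ w := by
        filter_upwards [hU.mem_nhds (hsU hw)] with x hx using hfac x hx
      have hdψ := (hψU.differentiableAt (hU.mem_nhds (hsU hw))).hasDerivAt
      have hd := (((hasDerivAt_id w).sub_const a).mul hdψ).deriv
      have hd' : deriv (fun w => (w - a) * ψ w) w = 1 * ψ w + (w - a) * deriv ψ w := hd
      rw [he.deriv_eq, he.self_of_nhds, hd']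
      have h2 := hsub w hw a (hL a List.mem_cons_self)
      have h3 := hψ0 w hw
      rw [smul_eq_mul]
      field_simp
    have ha := hL a List.mem_cons_self
    have hI := ih (φ := ψ) (fun b hb => hL b (List.mem_cons_of_mem _ hb)) (fun w _ => rfl)
    rw [circleIntegral.integral_congr hr.le h1, circleIntegral.integral_add, hI,
      (hh.mono hK).circleIntegral_sub_inv_smul ha]
    · simp only [smul_eq_mul, List.map_cons, List.sum_cons]
      ring
    · refine ContinuousOn.circleIntegrable hr.le ?_
      exact (ContinuousOn.inv₀ (by fun_prop) fun w hw => hsub w hw a ha).smul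
        (hh.continuousOn.mono hsU)
    · refine ContinuousOn.circleIntegrable hr.le ?_
      exact (hh.continuousOn.mono hsU).mul
        (((hψU.deriv hU).continuousOn.mono hsU).div (hψU.continuousOn.mono hsU) hψ0)

/-- Zeros with multiplicities in a disc, computed by a contour integral. -/
theorem exists_list_zeros {U : Set ℂ} (hU : IsOpen U) {c : ℂ} {r : ℝ} (hr : 0 < r)
    (hK : closedBall c r ⊆ U) {φ : ℂ → ℂ} (hφ : DifferentiableOn ℂ φ U)
    (h0 : ∀ w ∈ sphere c r, φ w ≠ 0) :
    ∃ L : List ℂ, (∀ a ∈ L, a ∈ ball c r) ∧ (∀ w ∈ ball c r, φ w = 0 ↔ w ∈ L) ∧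
      ∀ h : ℂ → ℂ, DifferentiableOn ℂ h U →
        (∮ w in C(c, r), h w * (deriv φ w / φ w)) = 2 * Real.pi * Complex.I * (L.map h).sum := by
  have han : AnalyticOnNhd ℂ φ (closedBall c r) := fun w hw => hφ.analyticAt (hU.mem_nhds (hK hw))
  have hpre : IsPreconnected (closedBall c r) := (convex_closedBall c r).isPreconnected
  obtain ⟨w₀, hw₀⟩ : (sphere c r).Nonempty := NormedSpace.sphere_nonempty.2 hr.le
  have hfreq : ∀ a ∈ closedBall c r, ¬ ∃ᶠ w in 𝓝[≠] a, φ w = 0 := fun a ha hf =>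
    h0 w₀ hw₀ (han.eqOn_zero_of_preconnected_of_frequently_eq_zero hpre ha hf
      (sphere_subset_closedBall hw₀))
  have hfin : {w ∈ closedBall c r | φ w = 0}.Finite := by
    by_contra hinf
    obtain ⟨a, ha, hacc⟩ := Set.Infinite.exists_accPt_of_subset_isCompact hinf
      (isCompact_closedBall c r) (fun w hw => hw.1)
    refine hfreq a ha ?_
    rw [accPt_iff_frequently_nhdsNE] at hacc
    exact hacc.mono fun w hw => hw.2
  have hev : ∀ a ∈ hfin.toFinset, ¬ ∀ᶠ w in 𝓝 a, φ w = 0 := by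
    intro a ha hev
    exact hfreq a ((hfin.mem_toFinset.1 ha).1) (hev.filter_mono nhdsWithin_le_nhds).frequently
  obtain ⟨L, u, hu, hu0, hL⟩ := exists_list_factor hU hK hfin.toFinset hφ
    (fun w hw h => by simpa using ⟨hw, h⟩)
    (fun a ha => hK ((hfin.mem_toFinset.1 ha).1)) hev
  -- discard the factors without zeros in the disc
  classical
  set L₁ := L.filter (fun a => a ∈ ball c r) with hL₁
  set L₂ := L.filter (fun a => ¬ a ∈ ball c r) with hL₂
  have hprod : ∀ w, (L.map (fun a => w - a)).prod =
      (L₁.map (fun a => w - a)).prod * (L₂.map (fun a => w - a)).prod := by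
    intro w
    rw [hL₁, hL₂]
    clear hL hL₁ hL₂
    induction L with
    | nil => simp
    | cons b L ih =>
      by_cases hb : b ∈ ball c r
      · have h1 := ih
        simp only [hb, List.filter_cons, decide_true, if_true, not_true, decide_false,
          List.map_cons, List.prod_cons, Bool.false_eq_true, if_false] at h1 ⊢
        rw [h1]
        ring
      · have h1 := ih
        simp only [hb, List.filter_cons, decide_true, if_true, not_false_eq_true, decide_false,
          List.map_cons, List.prod_cons, Bool.false_eq_true, if_false] at h1 ⊢
        rw [h1]
        ring
  have hroot : ∀ w ∈ closedBall c r, φ w = 0 ↔ w ∈ L := by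
    intro w hw
    rw [hL w (hK hw), mul_eq_zero, or_iff_left (hu0 w hw), List.prod_eq_zero_iff, List.mem_map]
    constructor
    · rintro ⟨a, ha, h⟩
      rwa [sub_eq_zero.1 h]
    · exact fun h => ⟨w, h, sub_self w⟩
  refine ⟨L₁, fun a ha => by simpa using (List.mem_filter.1 ha).2, fun w hw => ?_, fun h hh => ?_⟩
  · rw [hroot w (ball_subset_closedBall hw), hL₁, List.mem_filter]
    simp only [hw, decide_true, and_true]
  · refine circleIntegral_mul_logDeriv hU hr hK
      (u := fun w => (L₂.map (fun a => w - a)).prod * u w) ?_ ?_ hh L₁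
      (fun a ha => by simpa using (List.mem_filter.1 ha).2) (fun w hw => ?_)
    · refine DifferentiableOn.mul ?_ hu
      have : ∀ M : List ℂ, Differentiable ℂ (fun w => (M.map (fun a => w - a)).prod) := by
        intro M
        induction M with
        | nil => simp
        | cons b M ihM =>
          simp only [List.map_cons, List.prod_cons]
          exact (differentiable_id.sub_const b).mul ihM
      exact (this L₂).differentiableOn
    · intro w hw
      refine mul_ne_zero ?_ (hu0 w hw)
      refine List.prod_ne_zero ?_
      simp only [List.mem_map, not_exists, not_and]
      intro b hb hwb
      obtain ⟨hbL, hbb⟩ := List.mem_filter.1 hb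
      rw [sub_eq_zero] at hwb
      subst hwb
      have hwb : w ∉ ball c r := by simpa using hbb
      have : w ∈ sphere c r := by
        rw [mem_sphere]
        exact le_antisymm hw (not_lt.1 hwb)
      exact h0 w this ((hroot w hw).2 hbL)
    · rw [hL w hw, hprod, mul_assoc]

end OneVariable

end

section

open Set Filter Topology Metric

namespace LineHol

variable {E : Type*} [NormedAddCommGroup E] [NormedSpace ℂ E] {f g : E → ℂ} {V W : Set E}

theorem of_locally (h : ∀ a ∈ V, ∃ W, IsOpen W ∧ a ∈ W ∧ LineHol f W) : LineHol f V := by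
  refine ⟨fun a ha => ?_, fun a ha v => ?_⟩
  · obtain ⟨W, hW, haW, hf⟩ := h a ha
    exact (hf.1.continuousAt (hW.mem_nhds haW)).continuousWithinAt
  · obtain ⟨W, hW, haW, hf⟩ := h a ha
    exact hf.2 a haW v

theorem inv (hf : LineHol f V) (h0 : ∀ x ∈ V, f x ≠ 0) : LineHol (fun x => (f x)⁻¹) V :=
  ⟨hf.1.inv₀ h0, fun a ha v => (hf.2 a ha v).inv (by simpa using h0 a ha)⟩

theorem dirDeriv (hV : IsOpen V) (hf : LineHol f V) (v : E) :
    LineHol (fun a => deriv (fun t : ℂ => f (a + t • v)) 0) V := by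
  refine of_locally fun a ha => ?_
  obtain ⟨δ, hδ, hball⟩ := Metric.isOpen_iff.1 hV a ha
  obtain ⟨ρ, hρ, hρδ⟩ : ∃ ρ > 0, ρ * ‖v‖ < δ / 2 := by
    refine ⟨δ / 2 / (‖v‖ + 1), by positivity, ?_⟩
    rw [div_mul_eq_mul_div, div_lt_iff₀ (by positivity)]
    nlinarith [norm_nonneg v]
  have hmem : ∀ a' ∈ ball a (δ / 2), ∀ t ∈ closedBall (0 : ℂ) ρ, a' + t • v ∈ V := by
    intro a' ha' t ht
    refine hball ?_
    rw [mem_ball, dist_eq_norm] at ha' ⊢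
    have h1 : ‖t • v‖ ≤ ρ * ‖v‖ := by
      rw [norm_smul]
      exact mul_le_mul_of_nonneg_right (by simpa using ht) (norm_nonneg _)
    have h2 : a' + t • v - a = (a' - a) + t • v := by abel
    rw [h2]
    linarith [norm_add_le (a' - a) (t • v)]
  refine ⟨ball a (δ / 2), isOpen_ball, mem_ball_self (by linarith), ?_⟩
  have key : LineHol (fun a' => (2 * Real.pi * Complex.I : ℂ)⁻¹ *
      ∮ t in C(0, ρ), (t ^ 2)⁻¹ * f (a' + t • v)) (ball a (δ / 2)) := by
    refine (const _).mul (LineHol.circleIntegral isOpen_ball hρ.le ?_ ?_)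
    · refine ContinuousOn.mul (ContinuousOn.inv₀ (by fun_prop) ?_) ?_
      · rintro ⟨a', t⟩ ⟨_, ht⟩
        have : t ≠ 0 := ne_of_mem_sphere ht hρ.ne'
        simpa using this
      · refine hf.1.comp (f := fun p : E × ℂ => p.1 + p.2 • v) (by fun_prop) ?_
        rintro ⟨a', t⟩ ⟨ha', ht⟩
        exact hmem a' ha' t (sphere_subset_closedBall ht)
    · intro t ht a' ha' w
      have h1 := hf.2 _ (hmem a' ha' t (sphere_subset_closedBall ht)) w
      refine DifferentiableAt.const_mul ?_ _
      refine h1.congr_of_eventuallyEq (Eventually.of_forall fun x => ?_)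
      change f (a' + x • w + t • v) = f (a' + t • v + x • w)
      congr 1
      abel
  refine key.congr isOpen_ball fun a' ha' => ?_
  have hd : DifferentiableOn ℂ (fun t : ℂ => f (a' + t • v)) (closedBall 0 ρ) :=
    (hf.differentiableOn_line a' v).mono fun t ht => hmem a' ha' t ht
  have := DiffContOnCl.deriv_eq_smul_circleIntegral (c := (0 : ℂ)) (f := fun t : ℂ => f (a' + t • v))
    hρ (DifferentiableOn.diffContOnCl (by rwa [closure_ball _ hρ.ne']))
  change deriv (fun t : ℂ => f (a' + t • v)) 0 = _
  rw [eq_inv_mul_iff_mul_eq₀ (by simp [Real.pi_ne_zero])]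
  simpa [smul_eq_mul, one_div] using this.symm

end LineHol

section Roots

variable {E : Type*} [NormedAddCommGroup E] [NormedSpace ℂ E]

theorem LineHol.slice {V : Set (E × ℂ)} {f : E × ℂ → ℂ} (hf : LineHol f V) (ζ : E) :
    DifferentiableOn ℂ (fun w => f (ζ, w)) {w | (ζ, w) ∈ V} := by
  have := hf.differentiableOn_line (ζ, 0) (0, 1)
  simpa using this

/-- The zeros of `f (ζ, ·)` in a disc, listed with multiplicity: their number is constant and
their symmetric functions depend holomorphically on `ζ`. -/
theorem LineHol.exists_roots {P : Set E} (hP : IsOpen P) (hPc : IsPreconnected P)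
    {V : Set (E × ℂ)} (hV : IsOpen V) {f : E × ℂ → ℂ} (hf : LineHol f V) {c : ℂ} {r : ℝ}
    (hr : 0 < r) (hsub : P ×ˢ closedBall c r ⊆ V)
    (h0 : ∀ ζ ∈ P, ∀ w ∈ sphere c r, f (ζ, w) ≠ 0) :
    ∃ (d : ℕ) (y : E → Fin d → ℂ), ∀ ζ ∈ P, (∀ i, y ζ i ∈ ball c r) ∧
      (∀ w ∈ ball c r, f (ζ, w) = 0 ↔ ∃ i, y ζ i = w) ∧
      ∀ h : E × ℂ → ℂ, LineHol h V → LineHol (fun ζ => ∑ i, h (ζ, y ζ i)) P := by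
  have hopen : ∀ ζ, IsOpen {w : ℂ | (ζ, w) ∈ V} := fun ζ => hV.preimage (by fun_prop)
  have hex : ∀ ζ, ∃ L : List ℂ, ζ ∈ P → (∀ a ∈ L, a ∈ ball c r) ∧
      (∀ w ∈ ball c r, f (ζ, w) = 0 ↔ w ∈ L) ∧
      ∀ h : ℂ → ℂ, DifferentiableOn ℂ h {w | (ζ, w) ∈ V} →
        (∮ w in C(c, r), h w * (deriv (fun w => f (ζ, w)) w / f (ζ, w))) =
          2 * Real.pi * Complex.I * (L.map h).sum := by
    intro ζ
    by_cases hζ : ζ ∈ P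
    · obtain ⟨L, hL⟩ := exists_list_zeros (hopen ζ) hr (fun w hw => hsub ⟨hζ, hw⟩) (hf.slice ζ)
        (h0 ζ hζ)
      exact ⟨L, fun _ => hL⟩
    · exact ⟨[], fun h => absurd h hζ⟩
  choose L hL using hex
  have hsum : ∀ h : E × ℂ → ℂ, LineHol h V →
      LineHol (fun ζ => ((L ζ).map fun w => h (ζ, w)).sum) P := by
    intro h hh
    set V' : Set (E × ℂ) := V ∩ f ⁻¹' {0}ᶜ with hV'
    have hV'o : IsOpen V' := hf.1.isOpen_inter_preimage hV isOpen_compl_singleton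
    set H : E × ℂ → ℂ := fun p => h p * (deriv (fun t : ℂ => f (p + t • ((0 : E), (1 : ℂ)))) 0 *
      (f p)⁻¹) with hH
    have hHV : LineHol H V' := (hh.mono inter_subset_left).mul
      (((hf.dirDeriv hV (0, 1)).mono inter_subset_left).mul
        ((hf.mono inter_subset_left).inv fun x hx => hx.2))
    have hmem : ∀ ζ ∈ P, ∀ w ∈ sphere c r, (ζ, w) ∈ V' := fun ζ hζ w hw =>
      ⟨hsub ⟨hζ, sphere_subset_closedBall hw⟩, h0 ζ hζ w hw⟩
    have key : LineHol (fun ζ => (2 * Real.pi * Complex.I : ℂ)⁻¹ * ∮ w in C(c, r), H (ζ, w)) P := by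
      refine (LineHol.const _).mul (LineHol.circleIntegral hP hr.le
        (G := fun ζ w => H (ζ, w)) ?_ ?_)
      · exact hHV.1.mono fun p hp => hmem p.1 hp.1 p.2 hp.2
      · intro w hw ζ hζ v
        have := hHV.2 (ζ, w) (hmem ζ hζ w hw) (v, 0)
        simpa using this
    refine key.congr hP fun ζ hζ => ?_
    have h2pi : (2 * Real.pi * Complex.I : ℂ) ≠ 0 := by
      simp [Real.pi_ne_zero]
    have h1 := (hL ζ hζ).2.2 (fun w => h (ζ, w)) (hh.slice ζ)
    change ((L ζ).map fun w => h (ζ, w)).sum = _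
    rw [eq_inv_mul_iff_mul_eq₀ h2pi, ← h1]
    refine circleIntegral.integral_congr hr.le fun w _ => ?_
    have hd : deriv (fun t : ℂ => f ((ζ, w) + t • ((0 : E), (1 : ℂ)))) 0 =
        deriv (fun w => f (ζ, w)) w := by
      have := deriv_comp_const_add (fun w => f (ζ, w)) w 0
      simpa using this
    simp only [hH, hd, div_eq_mul_inv]
  rcases P.eq_empty_or_nonempty with rfl | ⟨ζ₀, hζ₀⟩
  · exact ⟨0, fun _ _ => 0, fun ζ hζ => absurd hζ (notMem_empty _)⟩
  have hlen : ∀ ζ ∈ P, (L ζ).length = (L ζ₀).length := by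
    have h1 : ContinuousOn (fun ζ => ((L ζ).length : ℂ)) P := by
      refine (hsum (fun _ => 1) (LineHol.const 1)).1.congr fun ζ _ => ?_
      simp
    have h2 : ContinuousOn (fun ζ => ((L ζ).length : ℝ)) P := by
      have := Complex.continuous_re.comp_continuousOn h1
      simpa [Function.comp_def] using this
    have h3 : ContinuousOn (fun ζ => (L ζ).length) P := by
      have he : IsEmbedding ((↑) : ℕ → ℝ) := Nat.isClosedEmbedding_coe_real.isEmbedding
      rw [he.continuousOn_iff]
      exact h2
    exact fun ζ hζ => hPc.constant h3 hζ hζ₀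
  refine ⟨(L ζ₀).length, fun ζ i => (L ζ).getD i 0, fun ζ hζ => ?_⟩
  have hget : ∀ ζ ∈ P, ∀ i : Fin (L ζ₀).length, ∃ hi : (i : ℕ) < (L ζ).length,
      (L ζ).getD i 0 = (L ζ)[(i : ℕ)] := by
    intro ζ hζ i
    have hi : (i : ℕ) < (L ζ).length := by rw [hlen ζ hζ]; exact i.2
    exact ⟨hi, by simp [hi]⟩
  refine ⟨fun i => ?_, fun w hw => ?_, fun h hh => ?_⟩
  · obtain ⟨hi, he⟩ := hget ζ hζ i
    change (L ζ).getD (i : ℕ) 0 ∈ ball c r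
    rw [he]
    exact (hL ζ hζ).1 _ (List.getElem_mem _)
  · rw [(hL ζ hζ).2.1 w hw, List.mem_iff_getElem]
    constructor
    · rintro ⟨i, hi, rfl⟩
      refine ⟨⟨i, by rw [← hlen ζ hζ]; exact hi⟩, ?_⟩
      simp [hi]
    · rintro ⟨i, rfl⟩
      obtain ⟨hi, he⟩ := hget ζ hζ i
      exact ⟨i, hi, he.symm⟩
  · refine (hsum h hh).congr hP fun ζ hζ => ?_
    change ∑ i : Fin (L ζ₀).length, h (ζ, (L ζ).getD i 0) = _
    have h1 : (L ζ).map (fun w => h (ζ, w)) =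
        List.ofFn fun i : Fin (L ζ₀).length => h (ζ, (L ζ).getD i 0) := by
      refine List.ext_getElem (by simp [hlen ζ hζ]) fun n h1 h2 => ?_
      have h3 : n < (L ζ).length := by simpa using h1
      simp [h3]
    rw [h1, List.sum_ofFn]

end Roots

end

section

open Set Filter Topology Metric

theorem LineHol.prod_of_powerSum {E : Type*} [NormedAddCommGroup E] [NormedSpace ℂ E] {P : Set E}
    (hP : IsOpen P) {d : ℕ} {y : E → Fin d → ℂ}
    (h : ∀ k, LineHol (fun ζ => ∑ i, y ζ i ^ k) P) : LineHol (fun ζ => ∏ i, y ζ i) P := by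
  have key : ∀ k, LineHol
      (fun ζ => MvPolynomial.aeval (y ζ) (MvPolynomial.esymm (Fin d) ℂ k)) P := by
    intro k
    induction k using Nat.strong_induction_on with
    | _ k ih =>
      rcases Nat.eq_zero_or_pos k with rfl | hk
      · simpa using LineHol.const (1 : ℂ)
      have hN := MvPolynomial.mul_esymm_eq_sum (Fin d) ℂ k
      have hk0 : (k : ℂ) ≠ 0 := by exact_mod_cast hk.ne'
      have h2 : LineHol (fun ζ => (k : ℂ)⁻¹ * ((-1) ^ (k + 1) *
          ∑ a ∈ Finset.HasAntidiagonal.antidiagonal k with a.1 < k, ((-1) ^ a.1 *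
            MvPolynomial.aeval (y ζ) (MvPolynomial.esymm (Fin d) ℂ a.1)) *
              ∑ i, y ζ i ^ a.2)) P := by
        refine (LineHol.const _).mul ((LineHol.const _).mul (LineHol.sum _ fun a ha => ?_))
        exact ((LineHol.const _).mul (ih a.1 (Finset.mem_filter.1 ha).2)).mul (h _)
      refine h2.congr hP fun ζ _ => ?_
      have h3 := congrArg (MvPolynomial.aeval (y ζ)) hN
      simp only [map_mul, map_natCast, map_pow, map_neg, map_one, map_sum, MvPolynomial.psum,
        MvPolynomial.aeval_X] at h3
      exact (eq_inv_mul_iff_mul_eq₀ hk0).2 h3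
  refine (key d).congr hP fun ζ _ => ?_
  rw [MvPolynomial.aeval_esymm_eq_multiset_esymm, Multiset.esymm]
  have h4 : Multiset.powersetCard d (Finset.univ.val.map (y ζ)) = {Finset.univ.val.map (y ζ)} := by
    have := Multiset.powersetCard_self (Finset.univ.val.map (y ζ))
    simpa using this
  rw [h4]
  simp [List.prod_ofFn]

section Hankel

variable {d m : ℕ} (y : Fin d → ℂ)

/-- The Hankel matrix of power sums. -/
def hankel (m : ℕ) : Matrix (Fin m) (Fin m) ℂ := fun a b => ∑ i, y i ^ ((a : ℕ) + b)

variable {y}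

theorem card_le_of_det_hankel_ne_zero (h : (hankel y m).det ≠ 0) :
    m ≤ (Finset.univ.image y).card := by
  classical
  by_contra! hlt
  apply h
  rw [← Matrix.exists_vecMul_eq_zero_iff]
  set q : Polynomial ℂ := ∏ r ∈ Finset.univ.image y, (Polynomial.X - Polynomial.C r) with hq
  have hmon : q.Monic := Polynomial.monic_prod_of_monic _ _ fun r _ => Polynomial.monic_X_sub_C r
  have hdeg : q.natDegree = (Finset.univ.image y).card := by
    rw [hq, Polynomial.natDegree_prod_of_monic _ _ fun r _ => Polynomial.monic_X_sub_C r]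
    simp
  have hev : ∀ i, q.eval (y i) = 0 := by
    intro i
    rw [hq, Polynomial.eval_prod]
    exact Finset.prod_eq_zero (Finset.mem_image_of_mem y (Finset.mem_univ i)) (by simp)
  refine ⟨fun a => q.coeff a, fun h0 => ?_, ?_⟩
  · have := congrFun h0 ⟨q.natDegree, hdeg ▸ hlt⟩
    simp [hmon] at this
  · ext b
    simp only [Matrix.vecMul, dotProduct, hankel, Pi.zero_apply, Finset.mul_sum]
    rw [Finset.sum_comm]
    refine Finset.sum_eq_zero fun i _ => ?_
    have h1 := hev i
    rw [Polynomial.eval_eq_sum_range' (n := m) (by omega), ← Fin.sum_univ_eq_sum_range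
      (fun a => q.coeff a * y i ^ a)] at h1
    calc ∑ a : Fin m, q.coeff a * y i ^ ((a : ℕ) + b)
        = (∑ a : Fin m, q.coeff a * y i ^ (a : ℕ)) * y i ^ (b : ℕ) := by
          rw [Finset.sum_mul]
          exact Finset.sum_congr rfl fun a _ => by ring
      _ = 0 := by rw [h1, zero_mul]

theorem det_hankel_ne_zero (h : (Finset.univ.image y).card = m) : (hankel y m).det ≠ 0 := by
  classical
  intro h0
  rw [← Matrix.exists_mulVec_eq_zero_iff] at h0
  obtain ⟨v, hv, hMv⟩ := h0
  set q : Polynomial ℂ := ∑ b : Fin m, Polynomial.C (v b) * Polynomial.X ^ (b : ℕ) with hq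
  have hqe : ∀ x, q.eval x = ∑ b : Fin m, v b * x ^ (b : ℕ) := by
    intro x
    simp [hq, Polynomial.eval_finsetSum]
  have hrow : ∀ a : ℕ, a < m → ∑ i, q.eval (y i) * y i ^ a = 0 := by
    intro a ha
    have := congrFun hMv ⟨a, ha⟩
    simp only [Matrix.mulVec, dotProduct, hankel, Pi.zero_apply, Finset.sum_mul] at this
    rw [Finset.sum_comm] at this
    rw [← this]
    refine Finset.sum_congr rfl fun i _ => ?_
    rw [hqe, Finset.sum_mul]
    exact Finset.sum_congr rfl fun b _ => by ring
  have hpoly : ∀ p : Polynomial ℂ, p.natDegree < m → ∑ i, q.eval (y i) * p.eval (y i) = 0 := by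
    intro p hp
    simp only [Polynomial.eval_eq_sum_range' hp, Finset.mul_sum]
    rw [Finset.sum_comm]
    refine Finset.sum_eq_zero fun a ha => ?_
    have := hrow a (Finset.mem_range.1 ha)
    calc ∑ i, q.eval (y i) * (p.coeff a * y i ^ a)
        = p.coeff a * ∑ i, q.eval (y i) * y i ^ a := by
          rw [Finset.mul_sum]
          exact Finset.sum_congr rfl fun i _ => by ring
      _ = 0 := by rw [this, mul_zero]
  have hroot : ∀ r ∈ Finset.univ.image y, q.eval r = 0 := by
    intro r hr
    set p : Polynomial ℂ := ∏ x ∈ (Finset.univ.image y).erase r,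
      (Polynomial.X - Polynomial.C x) with hp
    have hpd : p.natDegree < m := by
      rw [hp, Polynomial.natDegree_prod_of_monic _ _ fun r _ => Polynomial.monic_X_sub_C r]
      have := Finset.card_pos.2 ⟨r, hr⟩
      simp [Finset.card_erase_of_mem hr]
      omega
    have hpr : p.eval r ≠ 0 := by
      rw [hp, Polynomial.eval_prod, Finset.prod_ne_zero_iff]
      intro x hx
      simpa [sub_eq_zero] using (Finset.ne_of_mem_erase hx).symm
    have hps : ∀ i, y i ≠ r → p.eval (y i) = 0 := by
      intro i hi
      rw [hp, Polynomial.eval_prod]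
      exact Finset.prod_eq_zero
        (Finset.mem_erase.2 ⟨hi, Finset.mem_image_of_mem y (Finset.mem_univ i)⟩) (by simp)
    have h1 := hpoly p hpd
    have h2 : ∀ i, q.eval (y i) * p.eval (y i) =
        if y i = r then q.eval r * p.eval r else 0 := by
      intro i
      split_ifs with hi
      · rw [hi]
      · rw [hps i hi, mul_zero]
    simp only [h2, Finset.sum_ite, Finset.sum_const_zero, add_zero, Finset.sum_const,
      nsmul_eq_mul] at h1
    have h3 : (Finset.univ.filter fun i => y i = r).card ≠ 0 := by
      obtain ⟨i, _, hi⟩ := Finset.mem_image.1 hr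
      exact Finset.card_ne_zero.2 ⟨i, by simp [hi]⟩
    have h4 : ((Finset.univ.filter fun i => y i = r).card : ℂ) ≠ 0 := by exact_mod_cast h3
    simpa [hpr, h4] using h1
  have hq0 : q = 0 := by
    refine Polynomial.eq_zero_of_degree_lt_of_eval_finset_eq_zero (Finset.univ.image y) ?_ hroot
    rw [h]
    refine Polynomial.degree_sum_fin_lt v |>.trans_eq' ?_
    rw [hq]
  apply hv
  ext b
  have h5 := congrArg (fun p => Polynomial.coeff p (b : ℕ)) hq0
  simp only [hq, Polynomial.finsetSum_coeff, Polynomial.coeff_C_mul, Polynomial.coeff_X_pow,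
    Polynomial.coeff_zero] at h5
  rw [Finset.sum_eq_single b] at h5
  · simpa using h5
  · intro b' _ hb
    simp [Fin.val_inj, Ne.symm hb]
  · simp

end Hankel

end

section

open Set Filter Topology Metric

section Eliminant

variable {E : Type*} [NormedAddCommGroup E] [NormedSpace ℂ E]

theorem exists_tube {V : Set (E × ℂ)} (hV : IsOpen V) {f : E × ℂ → ℂ} (hf : ContinuousOn f V)
    {ζ : E} {c : ℂ} {r : ℝ} (h : ∀ w ∈ closedBall c r, (ζ, w) ∈ V)
    (h0 : ∀ w ∈ sphere c r, f (ζ, w) ≠ 0) :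
    ∃ ρ > 0, ball ζ ρ ×ˢ closedBall c r ⊆ V ∧ ∀ ζ' ∈ ball ζ ρ, ∀ w ∈ sphere c r, f (ζ', w) ≠ 0 := by
  have h1 : ∀ᶠ ζ' in 𝓝 ζ, ∀ w ∈ closedBall c r, (ζ', w) ∈ V := by
    refine (isCompact_closedBall c r).eventually_forall_of_forall_eventually fun w hw => ?_
    exact hV.mem_nhds (h w hw)
  have h2 : ∀ᶠ ζ' in 𝓝 ζ, ∀ w ∈ sphere c r, f (ζ', w) ≠ 0 := by
    refine (isCompact_sphere c r).eventually_forall_of_forall_eventually fun w hw => ?_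
    exact (hf.continuousAt (hV.mem_nhds (h w (sphere_subset_closedBall hw)))).eventually_ne
      (h0 w hw)
  obtain ⟨ρ, hρ, hb⟩ := Metric.eventually_nhds_iff_ball.1 (h1.and h2)
  exact ⟨ρ, hρ, fun p hp => (hb p.1 hp.1).1 p.2 hp.2, fun ζ' hζ' => (hb ζ' hζ').2⟩

theorem LineHol.eventually_exists_root {V : Set (E × ℂ)} (hV : IsOpen V) {f : E × ℂ → ℂ}
    (hf : LineHol f V) {ζ : E} {c : ℂ} {r : ℝ} (hr : 0 < r) (h : ∀ w ∈ closedBall c r, (ζ, w) ∈ V)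
    (h0 : ∀ w ∈ sphere c r, f (ζ, w) ≠ 0) (hc : f (ζ, c) = 0) :
    ∀ᶠ ζ' in 𝓝 ζ, ∃ w ∈ ball c r, f (ζ', w) = 0 := by
  obtain ⟨ρ, hρ, hsub, hne⟩ := exists_tube hV hf.1 h h0
  obtain ⟨d, y, hy⟩ := hf.exists_roots isOpen_ball (convex_ball ζ ρ).isPreconnected hV hr hsub hne
  obtain ⟨i, -⟩ := ((hy ζ (mem_ball_self hρ)).2.1 c (mem_ball_self hr)).1 hc
  filter_upwards [ball_mem_nhds ζ hρ] with ζ' hζ'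
  exact ⟨y ζ' i, (hy ζ' hζ').1 i, ((hy ζ' hζ').2.1 _ ((hy ζ' hζ').1 i)).2 ⟨i, rfl⟩⟩

/-- Elimination of the last variable: the resultant. -/
theorem LineHol.exists_eliminant {P : Set E} (hP : IsOpen P) (hPc : IsPreconnected P)
    {V : Set (E × ℂ)} (hV : IsOpen V) {f : E × ℂ → ℂ} (hf : LineHol f V) {c : ℂ} {r : ℝ}
    (hr : 0 < r) (hsub : P ×ˢ closedBall c r ⊆ V)
    (h0 : ∀ ζ ∈ P, ∀ w ∈ sphere c r, f (ζ, w) ≠ 0) :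
    (∀ ζ ∈ P, {w ∈ ball c r | f (ζ, w) = 0}.Finite) ∧
      ∀ h : E × ℂ → ℂ, LineHol h V → ∃ N : E → ℂ, LineHol N P ∧
        ∀ ζ ∈ P, N ζ = 0 ↔ ∃ w ∈ ball c r, f (ζ, w) = 0 ∧ h (ζ, w) = 0 := by
  obtain ⟨d, y, hy⟩ := hf.exists_roots hP hPc hV hr hsub h0
  refine ⟨fun ζ hζ => ?_, fun h hh => ⟨fun ζ => ∏ i, h (ζ, y ζ i), ?_, fun ζ hζ => ?_⟩⟩
  · refine (finite_range (y ζ)).subset fun w hw => ?_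
    exact ((hy ζ hζ).2.1 w hw.1).1 hw.2
  · refine LineHol.prod_of_powerSum hP fun k => ?_
    rcases P.eq_empty_or_nonempty with rfl | ⟨ζ₀, hζ₀⟩
    · exact ⟨continuousOn_empty _, fun a ha => absurd ha (notMem_empty a)⟩
    · exact (hy ζ₀ hζ₀).2.2 (fun p => h p ^ k) (hh.pow k)
  · rw [Finset.prod_eq_zero_iff]
    constructor
    · rintro ⟨i, -, hi⟩
      exact ⟨y ζ i, (hy ζ hζ).1 i, ((hy ζ hζ).2.1 _ ((hy ζ hζ).1 i)).2 ⟨i, rfl⟩, hi⟩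
    · rintro ⟨w, hw, hfw, hhw⟩
      obtain ⟨i, rfl⟩ := ((hy ζ hζ).2.1 w hw).1 hfw
      exact ⟨i, Finset.mem_univ i, hhw⟩

/-- Off the zero set of a nonzero holomorphic function, the zeros of `f (ζ, ·)` are locally
unique. -/
theorem LineHol.exists_discriminant {P : Set E} (hP : IsOpen P) (hPc : IsPreconnected P)
    {V : Set (E × ℂ)} (hV : IsOpen V) {f : E × ℂ → ℂ} (hf : LineHol f V) {c : ℂ} {r : ℝ}
    (hr : 0 < r) (hsub : P ×ˢ closedBall c r ⊆ V)
    (h0 : ∀ ζ ∈ P, ∀ w ∈ sphere c r, f (ζ, w) ≠ 0) (hne : P.Nonempty) :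
    ∃ D : E → ℂ, LineHol D P ∧ (∃ ζ ∈ P, D ζ ≠ 0) ∧ ∀ ζ ∈ P, D ζ ≠ 0 →
      ∀ w ∈ ball c r, f (ζ, w) = 0 → ∃ O ∈ 𝓝 (ζ, w), ∀ p ∈ O, ∀ q ∈ O, p.1 = q.1 →
        f p = 0 → f q = 0 → p = q := by
  classical
  obtain ⟨d, y, hy⟩ := hf.exists_roots hP hPc hV hr hsub h0
  set card : E → ℕ := fun ζ => (Finset.univ.image (y ζ)).card with hcard
  obtain ⟨ζ₀, hζ₀, hmax⟩ : ∃ ζ₀ ∈ P, ∀ ζ ∈ P, card ζ ≤ card ζ₀ := by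
    have hb : BddAbove (card '' P) := by
      refine ⟨d, ?_⟩
      rintro _ ⟨ζ, -, rfl⟩
      exact Finset.card_image_le.trans (by simp)
    obtain ⟨ζ₀, hζ₀, he⟩ := Nat.sSup_mem (hne.image card) hb
    exact ⟨ζ₀, hζ₀, fun ζ hζ => he ▸ le_csSup hb ⟨ζ, hζ, rfl⟩⟩
  refine ⟨fun ζ => (hankel (y ζ) (card ζ₀)).det, ?_, ⟨ζ₀, hζ₀, det_hankel_ne_zero rfl⟩, ?_⟩
  · refine LineHol.det fun a b => ?_
    refine (hy ζ₀ hζ₀).2.2 (fun p => p.2 ^ ((a : ℕ) + b)) (LineHol.pow ?_ _)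
    refine LineHol.of_differentiableOn hV (by fun_prop)
  intro ζ hζ hD w hw hfw
  have hcζ : card ζ = card ζ₀ := le_antisymm (hmax ζ hζ) (card_le_of_det_hankel_ne_zero hD)
  set R := Finset.univ.image (y ζ) with hR
  have hRmem : ∀ x ∈ ball c r, f (ζ, x) = 0 ↔ x ∈ R := by
    intro x hx
    rw [(hy ζ hζ).2.1 x hx]
    simp [hR]
  have hRb : ∀ x ∈ R, x ∈ ball c r := by
    intro x hx
    obtain ⟨i, -, rfl⟩ := Finset.mem_image.1 hx
    exact (hy ζ hζ).1 i
  obtain ⟨ε, hε, hεb, hεd⟩ : ∃ ε > 0, (∀ x ∈ R, closedBall x ε ⊆ ball c r) ∧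
      ∀ x ∈ R, ∀ x' ∈ R, x ≠ x' → 2 * ε < dist x x' := by
    have h1 : ∀ᶠ ε in 𝓝[>] (0 : ℝ), ∀ x ∈ R, closedBall x ε ⊆ ball c r := by
      rw [Filter.eventually_all_finset]
      intro x hx
      have : ∀ᶠ ε in 𝓝 (0 : ℝ), ε < r - dist x c :=
        eventually_lt_nhds (by linarith [mem_ball.1 (hRb x hx)])
      filter_upwards [nhdsWithin_le_nhds this] with ε hε
      exact closedBall_subset_ball' (by linarith)
    have h2 : ∀ᶠ ε in 𝓝[>] (0 : ℝ), ∀ x ∈ R, ∀ x' ∈ R, x ≠ x' → 2 * ε < dist x x' := by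
      rw [Filter.eventually_all_finset]
      intro x hx
      rw [Filter.eventually_all_finset]
      intro x' hx'
      by_cases hxx : x = x'
      · simp [hxx]
      · have : ∀ᶠ ε in 𝓝 (0 : ℝ), ε < dist x x' / 2 :=
          eventually_lt_nhds (by linarith [dist_pos.2 hxx])
        filter_upwards [nhdsWithin_le_nhds this] with ε hε _
        linarith
    obtain ⟨ε, ⟨h3, h4⟩, h5⟩ := ((h1.and h2).and self_mem_nhdsWithin).exists
    exact ⟨ε, h5, h3, h4⟩
  have hev : ∀ᶠ ζ' in 𝓝 ζ, ∀ x ∈ R, ∃ x' ∈ ball x ε, f (ζ', x') = 0 := by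
    rw [Filter.eventually_all_finset]
    intro x hx
    refine hf.eventually_exists_root hV hε (fun w hw =>
      hsub ⟨hζ, ball_subset_closedBall (hεb x hx hw)⟩) (fun w hw hfw => ?_)
      ((hRmem x (hRb x hx)).2 hx)
    have hwR := (hRmem w (hεb x hx (sphere_subset_closedBall hw))).1 hfw
    have hwx : w ≠ x := ne_of_mem_sphere hw hε.ne'
    have := hεd w hwR x hx hwx
    rw [mem_sphere.1 hw] at this
    linarith
  have hwR : w ∈ R := (hRmem w hw).1 hfw
  refine ⟨{ζ' | ζ' ∈ P ∧ ∀ x ∈ R, ∃ x' ∈ ball x ε, f (ζ', x') = 0} ×ˢ ball w ε,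
    prod_mem_nhds (Filter.inter_mem (hP.mem_nhds hζ) hev) (ball_mem_nhds w hε), ?_⟩
  rintro ⟨ζ', w'⟩ ⟨⟨hζ', hroot⟩, hw'⟩ ⟨_, w''⟩ ⟨-, hw''⟩ hpq hfp hfq
  obtain rfl : ζ' = _ := hpq
  refine Prod.ext rfl ?_
  by_contra hww
  simp only at hζ' hroot hw' hw'' hww
  have hroot' : ∀ x : R, ∃ x' ∈ ball x.1 ε, f (ζ', x') = 0 := fun x => hroot x.1 x.2
  choose g hg hfg using hroot'
  have hsep : ∀ x ∈ R, ∀ x' ∈ R, ∀ a, a ∈ ball x ε → a ∈ ball x' ε → x = x' := by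
    intro x hx x' hx' a ha ha'
    by_contra hne
    have := hεd x hx x' hx' hne
    rw [mem_ball] at ha ha'
    linarith [dist_triangle_left x x' a]
  have hginj : Function.Injective g := fun x x' hxx =>
    Subtype.ext (hsep _ x.2 _ x'.2 (g x) (hg x) (hxx ▸ hg x'))
  set T : Finset ℂ := (Finset.univ.filter fun x : R => x.1 ≠ w).image g with hT
  have hTw : ∀ a ∈ ball w ε, a ∉ T := by
    intro a ha haT
    obtain ⟨x, hx, rfl⟩ := Finset.mem_image.1 haT
    exact (Finset.mem_filter.1 hx).2 (hsep _ x.2 w hwR _ (hg x) ha)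
  have hTc : T.card + 1 = R.card := by
    rw [hT, Finset.card_image_of_injective _ hginj]
    have h6 : (Finset.univ.filter fun x : R => x.1 ≠ w) = Finset.univ.erase ⟨w, hwR⟩ := by
      ext x
      simp [Subtype.ext_iff]
    rw [h6, Finset.card_erase_of_mem (Finset.mem_univ _), Finset.card_univ, Fintype.card_coe]
    have := Finset.card_pos.2 ⟨w, hwR⟩
    omega
  have hsubT : insert w' (insert w'' T) ⊆ Finset.univ.image (y ζ') := by
    intro a ha
    have h7 : a ∈ ball c r ∧ f (ζ', a) = 0 := by
      rcases Finset.mem_insert.1 ha with rfl | ha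
      · exact ⟨hεb w hwR (ball_subset_closedBall hw'), hfp⟩
      rcases Finset.mem_insert.1 ha with rfl | ha
      · exact ⟨hεb w hwR (ball_subset_closedBall hw''), hfq⟩
      obtain ⟨x, -, rfl⟩ := Finset.mem_image.1 ha
      exact ⟨hεb x.1 x.2 (ball_subset_closedBall (hg x)), hfg x⟩
    obtain ⟨i, hi⟩ := ((hy ζ' hζ').2.1 a h7.1).1 h7.2
    exact Finset.mem_image.2 ⟨i, Finset.mem_univ i, hi⟩
  have hle := Finset.card_le_card hsubT
  rw [Finset.card_insert_of_notMem, Finset.card_insert_of_notMem (hTw _ hw'')] at hle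
  · have h8 : (Finset.univ.image (y ζ')).card ≤ card ζ₀ := hmax ζ' hζ'
    have h9 : R.card = card ζ₀ := hcζ
    omega
  · rw [Finset.mem_insert, not_or]
    exact ⟨hww, hTw _ hw'⟩

end Eliminant

end

section

open Set Filter Topology Metric

section Coordinates

variable {ι : Type*} [Fintype ι] [DecidableEq ι]

theorem update_eq_add_smul (z : ι → ℂ) (l : ι) (t : ℂ) :
    Function.update z l t = Function.update z l 0 + t • Pi.single l 1 := by
  ext i
  by_cases h : i = l
  · subst h; simp
  · simp [h]

theorem update_mem_ball {z p : ι → ℂ} {ρ : ℝ} (hz : z ∈ ball p ρ) {l : ι} {t : ℂ}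
    (ht : t ∈ ball (p l) ρ) : Function.update z l t ∈ ball p ρ := by
  have hρ : 0 < ρ := dist_nonneg.trans_lt hz
  rw [mem_ball, dist_pi_lt_iff hρ] at hz ⊢
  intro i
  by_cases h : i = l
  · subst h; simpa using ht
  · simpa [h] using hz i

theorem piecewise_mem_ball {q p : ι → ℂ} {ρ : ℝ} (hρ : 0 < ρ) {I : Finset ι}
    (h : ∀ i ∈ I, dist (q i) (p i) < ρ) : I.piecewise q p ∈ ball p ρ := by
  rw [mem_ball, dist_pi_lt_iff hρ]
  intro i
  by_cases hi : i ∈ I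
  · simpa [hi] using h i hi
  · simpa [hi] using hρ

theorem DependsOn.piecewise {f : (ι → ℂ) → ℂ} {I : Finset ι} (hf : DependsOn f (I : Set ι))
    (q p : ι → ℂ) : f (I.piecewise q p) = f q :=
  hf fun i hi => by simp [Finset.mem_coe.1 hi]

theorem LineHol.update {f : (ι → ℂ) → ℂ} {V : Set (ι → ℂ)} (hf : LineHol f V) (z : ι → ℂ) (l : ι) :
    DifferentiableOn ℂ (fun t => f (Function.update z l t)) {t | Function.update z l t ∈ V} := by
  have := hf.differentiableOn_line (Function.update z l 0) (Pi.single l 1)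
  simpa only [← update_eq_add_smul] using this

theorem isOpen_update_mem {V : Set (ι → ℂ)} (hV : IsOpen V) (z : ι → ℂ) (l : ι) :
    IsOpen {t | Function.update z l t ∈ V} :=
  hV.preimage (by fun_prop : Continuous fun t : ℂ => Function.update z l t)

theorem LineHol.update_eventually_ne {f : (ι → ℂ) → ℂ} {V : Set (ι → ℂ)} (hV : IsOpen V)
    (hf : LineHol f V) {p : ι → ℂ} (hp : p ∈ V) {l : ι}
    (h : ∃ᶠ t in 𝓝 (p l), f (Function.update p l t) ≠ 0) :
    ∀ᶠ t in 𝓝[≠] (p l), f (Function.update p l t) ≠ 0 := by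
  have han : AnalyticAt ℂ (fun t => f (Function.update p l t)) (p l) :=
    (hf.update p l).analyticAt ((isOpen_update_mem hV p l).mem_nhds (by simpa using hp))
  exact han.eventually_eq_zero_or_eventually_ne_zero.resolve_left
    fun h0 => h (h0.mono fun _ ht => not_not.2 ht)

theorem LineHol.update_eq_zero {f : (ι → ℂ) → ℂ} {p z : ι → ℂ} {ρ : ℝ} (hf : LineHol f (ball p ρ))
    (hz : z ∈ ball p ρ) {l : ι} {t₀ : ℂ} (ht₀ : t₀ ∈ ball (p l) ρ)
    (h : ∃ᶠ t in 𝓝[≠] t₀, f (Function.update z l t) = 0) :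
    ∀ t ∈ ball (p l) ρ, f (Function.update z l t) = 0 := by
  have h1 : DifferentiableOn ℂ (fun t => f (Function.update z l t)) (ball (p l) ρ) :=
    (hf.update z l).mono fun t ht => update_mem_ball hz ht
  exact (h1.analyticOnNhd isOpen_ball).eqOn_zero_of_preconnected_of_frequently_eq_zero
    (convex_ball _ _).isPreconnected ht₀ h

theorem LineHol.comp_piecewise {f : (ι → ℂ) → ℂ} {V W : Set (ι → ℂ)} (hf : LineHol f V)
    (I : Finset ι) (p : ι → ℂ) (hW : ∀ z ∈ W, I.piecewise z p ∈ V) :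
    LineHol (fun z => f (I.piecewise z p)) W := by
  refine hf.comp_affine (L := fun z => I.piecewise z p) ?_ (fun a v => ⟨I.piecewise v 0, fun t => ?_⟩) hW
  · refine continuous_pi fun i => ?_
    by_cases hi : i ∈ I
    · simpa [hi] using continuous_apply i
    · simpa [hi] using continuous_const
  · ext i
    by_cases hi : i ∈ I <;> simp [hi]

theorem LineHol.comp_update {f : (ι → ℂ) → ℂ} {V W : Set (ι → ℂ)} (hf : LineHol f V)
    (l : ι) (t : ℂ) (hW : ∀ z ∈ W, Function.update z l t ∈ V) :
    LineHol (fun z => f (Function.update z l t)) W := by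
  refine hf.comp_affine (L := fun z => Function.update z l t) (by fun_prop)
    (fun a v => ⟨Function.update v l 0, fun _ => ?_⟩) fun z hz => hW z hz
  ext i
  by_cases hi : i = l
  · subst hi; simp
  · simp [hi]

theorem LineHol.comp_update_prod {f : (ι → ℂ) → ℂ} {V : Set (ι → ℂ)} (hf : LineHol f V)
    (l : ι) {W : Set ((ι → ℂ) × ℂ)} (hW : ∀ z ∈ W, Function.update z.1 l z.2 ∈ V) :
    LineHol (fun z : (ι → ℂ) × ℂ => f (Function.update z.1 l z.2)) W := by
  refine hf.comp_affine (L := fun z : (ι → ℂ) × ℂ => Function.update z.1 l z.2) (by fun_prop)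
    (fun a v => ⟨Function.update v.1 l v.2, fun t => ?_⟩) hW
  ext i
  by_cases hi : i = l
  · subst hi; simp
  · simp [hi]

end Coordinates

/-- Relatively closed subsets of `D` on which the coordinates off `I` are locally integral over
those in `I`, with locally analytic projection to the coordinates in `I`. -/
structure Good {ι : Type*} [Fintype ι] [DecidableEq ι] (D : Set (ι → ℂ)) (I : Finset ι)
    (X : Set (ι → ℂ)) : Prop where
  sub : X ⊆ D
  closed : ∀ z ∈ D, z ∈ closure X → z ∈ X
  int : ∀ p ∈ X, ∀ l ∉ I, ∃ (f : (ι → ℂ) → ℂ) (V : Set (ι → ℂ)), IsOpen V ∧ p ∈ V ∧ LineHol f V ∧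
    DependsOn f (insert l I : Finset ι) ∧ (∀ q ∈ X, q ∈ V → f q = 0) ∧
      ∃ᶠ t in 𝓝 (p l), f (Function.update p l t) ≠ 0
  an : ∀ p ∈ X, ∀ O ∈ 𝓝 p, ∃ O' : Set (ι → ℂ), IsOpen O' ∧ p ∈ O' ∧ O' ⊆ O ∧
    ∃ V : Set (ι → ℂ), IsOpen V ∧ p ∈ V ∧ ∃ S : Set ((ι → ℂ) → ℂ),
      (∀ f ∈ S, LineHol f V ∧ DependsOn f (I : Set ι)) ∧
      ∀ z ∈ V, (∃ q ∈ X, q ∈ O' ∧ ∀ i ∈ I, q i = z i) ↔ ∀ f ∈ S, f z = 0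

/-- The points of `X` at which the fibre of the projection forgetting `z_j` and the coordinates
off `I` is not discrete. -/
def nonIso {ι : Type*} [Fintype ι] [DecidableEq ι] (I : Finset ι) (j : ι) (X : Set (ι → ℂ)) :
    Set (ι → ℂ) :=
  {p | p ∈ X ∧ ∀ O ∈ 𝓝 p, ∃ q ∈ X, q ∈ O ∧ q ≠ p ∧ ∀ i ∈ I, i ≠ j → q i = p i}

section Good

variable {ι : Type*} [Fintype ι] [DecidableEq ι] {D : Set (ι → ℂ)} {I : Finset ι}
  {X : Set (ι → ℂ)}

theorem Good.isolated (h : Good D I X) {p : ι → ℂ} (hp : p ∈ X) :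
    ∀ᶠ q in 𝓝 p, q ∈ X → (∀ i ∈ I, q i = p i) → q = p := by
  have key : ∀ l, ∀ᶠ q in 𝓝 p, q ∈ X → (∀ i ∈ I, q i = p i) → q l = p l := by
    intro l
    by_cases hl : l ∈ I
    · exact Eventually.of_forall fun q _ hq => hq l hl
    obtain ⟨f, V, hV, hpV, hf, hdep, hX, hfr⟩ := h.int p hp l hl
    have h1 := hf.update_eventually_ne hV hpV hfr
    rw [eventually_nhdsWithin_iff] at h1
    have h2 : ∀ᶠ q : ι → ℂ in 𝓝 p, q l ∈ ({p l}ᶜ : Set ℂ) → f (Function.update p l (q l)) ≠ 0 :=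
      (continuous_apply l).continuousAt.eventually h1
    filter_upwards [h2, hV.mem_nhds hpV] with q hq hqV hqX hqI
    by_contra hne
    refine hq hne ?_
    rw [← hX q hqX hqV]
    refine hdep fun i hi => ?_
    by_cases hil : i = l
    · subst hil; simp
    · have : i ∈ I := by simpa [hil] using hi
      simp [hil, hqI i this]
  have := Filter.eventually_all.2 key
  filter_upwards [this] with q hq hqX hqI
  exact funext fun l => hq l hqX hqI

/-- A closed ball in which `X` is proper over a polydisc in the `I`-coordinates, with analytic
image. -/
theorem Good.exists_model (hD : IsOpen D) (h : Good D I X) {p : ι → ℂ} (hp : p ∈ X)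
    {O : Set (ι → ℂ)} (hO : O ∈ 𝓝 p) :
    ∃ r > 0, closedBall p r ⊆ O ∩ D ∧ ∃ ρ > 0, ρ ≤ r ∧
      (∀ q ∈ X, q ∈ closedBall p r → (∀ i ∈ I, q i = p i) → q = p) ∧
      (∀ q ∈ X, q ∈ closedBall p r → (∀ i ∈ I, dist (q i) (p i) < ρ) → q ∈ ball p (r / 2)) ∧
      ∃ S : Set ((ι → ℂ) → ℂ), (∀ f ∈ S, LineHol f (ball p ρ) ∧ DependsOn f (I : Set ι)) ∧
        ∀ z ∈ ball p ρ, (∃ q ∈ X, q ∈ ball p r ∧ ∀ i ∈ I, q i = z i) ↔ ∀ f ∈ S, f z = 0 := by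
  have h1 : ∀ᶠ q in 𝓝 p, q ∈ O ∩ D ∧ (q ∈ X → (∀ i ∈ I, q i = p i) → q = p) :=
    Filter.Eventually.and (Filter.inter_mem hO (hD.mem_nhds (h.sub hp))) (h.isolated hp)
  obtain ⟨r, hr, hrb⟩ := Metric.nhds_basis_closedBall.mem_iff.1 h1
  obtain ⟨O', hO', hpO', hO'r, V, hV, hpV, S, hS, hSV⟩ := h.an p hp (ball p (r / 2))
    (ball_mem_nhds p (by linarith))
  obtain ⟨r₁, hr₁, hr₁b⟩ := Metric.isOpen_iff.1 hO' p hpO'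
  obtain ⟨ρ₁, hρ₁, hρ₁V⟩ := Metric.isOpen_iff.1 hV p hpV
  have hcl : IsClosed (X ∩ closedBall p r) := by
    refine isClosed_of_closure_subset fun z hz => ?_
    have hz2 : z ∈ closedBall p r :=
      closure_minimal inter_subset_right isClosed_closedBall hz
    exact ⟨h.closed z (hrb hz2).1.2 (closure_mono inter_subset_left hz), hz2⟩
  have hcomp : IsCompact ((X ∩ closedBall p r) \ ball p (min r₁ (r / 2))) :=
    ((isCompact_closedBall p r).inter_left hcl |>.of_isClosed_subset (hcl.sdiff isOpen_ball)
      fun z hz => ⟨hz.1, hz.1.2⟩)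
  obtain ⟨ρ₂, hρ₂, hρ₂X⟩ : ∃ ρ₂ > 0, ∀ q ∈ X, q ∈ closedBall p r →
      (∀ i ∈ I, dist (q i) (p i) < ρ₂) → q ∈ ball p (min r₁ (r / 2)) := by
    by_contra! hcon
    have hseq : ∀ n : ℕ, ∃ q ∈ (X ∩ closedBall p r) \ ball p (min r₁ (r / 2)),
        ∀ i ∈ I, dist (q i) (p i) < 1 / ((n : ℝ) + 1) := by
      intro n
      obtain ⟨q, hq1, hq2, hq3, hq4⟩ := hcon (1 / ((n : ℝ) + 1)) (by positivity)
      exact ⟨q, ⟨⟨hq1, hq2⟩, hq4⟩, hq3⟩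
    choose q hq hqd using hseq
    obtain ⟨z, hz, φ, hφ, hlim⟩ := hcomp.tendsto_subseq hq
    have hzI : ∀ i ∈ I, z i = p i := by
      intro i hi
      have h2 : Tendsto (fun n => (q (φ n)) i) atTop (𝓝 (z i)) :=
        ((continuous_apply i).tendsto z).comp hlim
      have h3 : Tendsto (fun n => (q (φ n)) i) atTop (𝓝 (p i)) := by
        rw [tendsto_iff_dist_tendsto_zero]
        refine squeeze_zero (fun _ => dist_nonneg) (fun n => (hqd (φ n) i hi).le) ?_
        exact (tendsto_one_div_add_atTop_nhds_zero_nat (𝕜 := ℝ)).comp hφ.tendsto_atTop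
      exact tendsto_nhds_unique h2 h3
    refine hz.2 ?_
    rw [(hrb hz.1.2).2 hz.1.1 hzI]
    exact mem_ball_self (lt_min hr₁ (by linarith))
  refine ⟨r, hr, fun z hz => (hrb hz).1, min r (min ρ₁ ρ₂), lt_min hr (lt_min hρ₁ hρ₂),
    min_le_left _ _, fun q hq hqr => (hrb hqr).2 hq, fun q hq hqr hqI => ?_, S,
    fun f hf => ⟨(hS f hf).1.mono ((ball_subset_ball ?_).trans hρ₁V), (hS f hf).2⟩, fun z hz => ?_⟩
  · refine ball_subset_ball (min_le_right r₁ _) (hρ₂X q hq hqr fun i hi => ?_)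
    exact (hqI i hi).trans_le ((min_le_right _ _).trans (min_le_right _ _))
  · exact (min_le_right _ _).trans (min_le_left _ _)
  · have hzV : z ∈ V :=
      hρ₁V (ball_subset_ball ((min_le_right _ _).trans (min_le_left _ _)) hz)
    rw [← hSV z hzV]
    constructor
    · rintro ⟨q, hq, hqr, hqz⟩
      refine ⟨q, hq, hr₁b (ball_subset_ball (min_le_left _ _)
        (hρ₂X q hq (ball_subset_closedBall hqr) fun i hi => ?_)), hqz⟩
      rw [hqz i hi]
      refine (dist_le_pi_dist z p i).trans_lt (lt_of_lt_of_le hz ?_)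
      exact (min_le_right _ _).trans (min_le_right _ _)
    · rintro ⟨q, hq, hqO, hqz⟩
      exact ⟨q, hq, ball_subset_ball (by linarith) (hO'r hqO), hqz⟩

end Good

end

section

open Set Filter Topology Metric

section Good

variable {ι : Type*} [Fintype ι] [DecidableEq ι] {D : Set (ι → ℂ)} {I : Finset ι}
  {X : Set (ι → ℂ)}

/-- The locus `nonIso I j X` is locally cut out, over the `I`-coordinates, by the vanishing of the
equations of `X` along whole discs in direction `j`. -/
theorem Good.exists_model_nonIso (hD : IsOpen D) (h : Good D I X) {j : ι} (hj : j ∈ I) {p : ι → ℂ}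
    (hp : p ∈ X) {O : Set (ι → ℂ)} (hO : O ∈ 𝓝 p) :
    ∃ r > 0, closedBall p r ⊆ O ∩ D ∧ ∃ ρ > 0, ρ ≤ r ∧
      (∀ q ∈ X, q ∈ closedBall p r → (∀ i ∈ I, q i = p i) → q = p) ∧
      ∃ S : Set ((ι → ℂ) → ℂ), (∀ f ∈ S, LineHol f (ball p ρ) ∧ DependsOn f (I : Set ι)) ∧
        ∀ z ∈ ball p ρ, (∃ q ∈ nonIso I j X, q ∈ ball p r ∧ ∀ i ∈ I, q i = z i) ↔
          ∀ f ∈ S, ∀ t ∈ ball (p j) ρ, f (Function.update z j t) = 0 := by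
  obtain ⟨r, hr, hrO, ρ, hρ, hρr, hiso, hprop, S, hS, hSX⟩ := h.exists_model hD hp hO
  refine ⟨r, hr, hrO, ρ, hρ, hρr, hiso, S, hS, fun z hz => ⟨?_, fun hz0 => ?_⟩⟩
  · rintro ⟨q, ⟨hqX, hq⟩, hqr, hqz⟩ f hf
    have hzd : ∀ i, dist (z i) (p i) < ρ := fun i => (dist_le_pi_dist z p i).trans_lt hz
    have hzj : z j ∈ ball (p j) ρ := hzd j
    refine (hS f hf).1.update_eq_zero hz hzj ?_
    rw [Filter.frequently_iff]
    intro U hU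
    rw [mem_nhdsWithin_iff_eventually, ← hqz j hj] at hU
    have e1 : ∀ᶠ x : ι → ℂ in 𝓝 q, x j ∈ ({q j}ᶜ : Set ℂ) → x j ∈ U :=
      (continuous_apply j).continuousAt.eventually hU
    have e2 : ∀ᶠ x : ι → ℂ in 𝓝 q, ∀ i ∈ I, dist (x i) (p i) < ρ := by
      rw [Filter.eventually_all_finset]
      intro i hi
      have : Continuous fun x : ι → ℂ => dist (x i) (p i) := by fun_prop
      refine this.continuousAt.eventually_lt_const ?_
      change dist (q i) (p i) < ρ
      rw [hqz i hi]
      exact hzd i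
    obtain ⟨x, hxX, ⟨hx1, hx2, hx3, hx4⟩, hxq, hxI⟩ :=
      hq _ (e1.and (e2.and ((h.isolated hqX).and (isOpen_ball.mem_nhds hqr))))
    have hxj : x j ≠ q j := by
      intro hcon
      refine hxq (hx3 hxX fun i hi => ?_)
      by_cases hij : i = j
      · rw [hij, hcon]
      · exact hxI i hi hij
    refine ⟨x j, hx1 hxj, ?_⟩
    have h0 := (hSX _ (piecewise_mem_ball hρ hx2)).1 ⟨x, hxX, hx4, fun i hi => by simp [hi]⟩ f hf
    rw [← h0]
    refine (hS f hf).2 fun i hi => ?_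
    have hi' : i ∈ I := hi
    by_cases hij : i = j
    · subst hij; simp [hi']
    · simp [hij, hi', hxI i hi' hij, hqz i hi']
  · have hzj : z j ∈ ball (p j) ρ := (dist_le_pi_dist z p j).trans_lt hz
    obtain ⟨t, ht, htρ⟩ := Filter.exists_seq_forall_of_frequently
      (Filter.Eventually.frequently (f := 𝓝[≠] (z j))
        (nhdsWithin_le_nhds (isOpen_ball.mem_nhds hzj)))
    rw [tendsto_nhdsWithin_iff] at ht
    have hex : ∀ n, ∃ q ∈ X, q ∈ ball p r ∧ ∀ i ∈ I, q i = Function.update z j (t n) i :=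
      fun n => (hSX _ (update_mem_ball hz (htρ n))).2 fun f hf => hz0 f hf _ (htρ n)
    choose q hqX hqr hqz using hex
    have hq2 : ∀ n, q n ∈ closedBall p (r / 2) := by
      intro n
      refine ball_subset_closedBall (hprop _ (hqX n) (ball_subset_closedBall (hqr n)) fun i hi => ?_)
      rw [hqz n i hi]
      exact (dist_le_pi_dist _ p i).trans_lt (update_mem_ball hz (htρ n))
    obtain ⟨x, hx, φ, hφ, hlim⟩ := (isCompact_closedBall p (r / 2)).tendsto_subseq hq2
    have hxr : x ∈ ball p r := closedBall_subset_ball (by linarith) hx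
    have hxX : x ∈ X := h.closed x (hrO (ball_subset_closedBall hxr)).2
      (mem_closure_of_tendsto hlim (Eventually.of_forall fun n => hqX _))
    have hxz : ∀ i ∈ I, x i = z i := by
      intro i hi
      have h1 : Tendsto (fun n => q (φ n) i) atTop (𝓝 (x i)) :=
        ((continuous_apply i).tendsto x).comp hlim
      refine tendsto_nhds_unique h1 ?_
      simp only [hqz _ i hi]
      by_cases hij : i = j
      · subst hij
        simpa [Function.comp_def] using ht.1.comp hφ.tendsto_atTop
      · simp [hij]
    refine ⟨x, ⟨hxX, fun O' hO' => ?_⟩, hxr, hxz⟩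
    obtain ⟨n, hn, hn'⟩ := ((hlim.eventually hO').and
      (hφ.tendsto_atTop.eventually ht.2)).exists
    refine ⟨q (φ n), hqX _, hn, fun hcon => hn' ?_, fun i hi hij => ?_⟩
    · have h2 := hqz (φ n) j hj
      rw [hcon, hxz j hj] at h2
      simpa using h2.symm
    · rw [hqz _ i hi, hxz i hi]
      simp [hij]

theorem Good.nonIso_lift (hD : IsOpen D) (h : Good D I X) {j : ι} (hj : j ∈ I) {p : ι → ℂ}
    (hp : p ∈ nonIso I j X) {O : Set (ι → ℂ)} (hO : O ∈ 𝓝 p) :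
    ∃ ε > 0, ∀ t ∈ ball (p j) ε, ∃ q ∈ nonIso I j X, q ∈ O ∧
      ∀ i ∈ I, q i = Function.update p j t i := by
  obtain ⟨r, hr, hrO, ρ, hρ, hρr, -, S, -, hSX⟩ := h.exists_model_nonIso hD hj hp.1 hO
  refine ⟨ρ, hρ, fun t ht => ?_⟩
  have h1 := (hSX p (mem_ball_self hρ)).1 ⟨p, hp, mem_ball_self hr, fun _ _ => rfl⟩
  obtain ⟨q, hq, hqr, hqz⟩ := (hSX _ (update_mem_ball (mem_ball_self hρ) ht)).2
    fun f hf t' ht' => by simpa using h1 f hf t' ht'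
  exact ⟨q, hq, (hrO (ball_subset_closedBall hqr)).1, hqz⟩

theorem Good.nonIso_good (hD : IsOpen D) (h : Good D I X) {j : ι} (hj : j ∈ I) :
    Good D I (nonIso I j X) where
  sub := fun p hp => h.sub hp.1
  closed := by
    intro p hpD hpc
    have hpX : p ∈ X := h.closed p hpD (closure_mono (fun q hq => hq.1) hpc)
    obtain ⟨r, hr, hrO, ρ, hρ, hρr, hiso, S, hS, hSX⟩ := h.exists_model_nonIso hD hj hpX univ_mem
    obtain ⟨q, hq, hqr, hqz⟩ := (hSX p (mem_ball_self hρ)).2 fun f hf t ht => by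
      have hc : ContinuousAt (fun z => f (Function.update z j t)) p := by
        have : LineHol (fun z => f (Function.update z j t)) (ball p ρ) :=
          (hS f hf).1.comp_update j t fun z hz => update_mem_ball hz ht
        exact this.1.continuousAt (ball_mem_nhds p hρ)
      by_contra hne
      obtain ⟨z, ⟨hz1, hz2⟩, hz3⟩ := mem_closure_iff_nhds.1 hpc _
        (Filter.inter_mem (hc.eventually_ne hne) (ball_mem_nhds p hρ))
      exact hz1 ((hSX z hz2).1 ⟨z, hz3, ball_subset_ball hρr hz2, fun _ _ => rfl⟩ f hf t ht)
    rwa [← hiso q hq.1 (ball_subset_closedBall hqr) hqz]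
  int := by
    intro p hp l hl
    obtain ⟨f, V, hV, hpV, hf, hdep, hX, hfr⟩ := h.int p hp.1 l hl
    exact ⟨f, V, hV, hpV, hf, hdep, fun q hq => hX q hq.1, hfr⟩
  an := by
    intro p hp O hO
    obtain ⟨r, hr, hrO, ρ, hρ, hρr, hiso, S, hS, hSX⟩ := h.exists_model_nonIso hD hj hp.1 hO
    refine ⟨ball p r, isOpen_ball, mem_ball_self hr,
      fun z hz => (hrO (ball_subset_closedBall hz)).1, ball p ρ, isOpen_ball, mem_ball_self hρ,
      {g | ∃ f ∈ S, ∃ t ∈ ball (p j) ρ, g = fun z => f (Function.update z j t)}, ?_, ?_⟩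
    · rintro _ ⟨f, hf, t, ht, rfl⟩
      refine ⟨(hS f hf).1.comp_update j t fun z hz => update_mem_ball hz ht, fun x y hxy => ?_⟩
      refine (hS f hf).2 fun i hi => ?_
      by_cases hij : i = j
      · subst hij; simp
      · simpa [hij] using hxy i hi
    · intro z hz
      rw [hSX z hz]
      constructor
      · rintro h1 _ ⟨f, hf, t, ht, rfl⟩
        exact h1 f hf t ht
      · exact fun h1 f hf t ht => h1 _ ⟨f, hf, t, ht, rfl⟩

end Good

end

section

open Set Filter Topology Metric

section Drop

variable {ι : Type*} [Fintype ι] [DecidableEq ι] {D : Set (ι → ℂ)} {I : Finset ι}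
  {X : Set (ι → ℂ)}

theorem LineHol.exists_update_circle {V : Set (ι → ℂ)} (hV : IsOpen V) {r : (ι → ℂ) → ℂ}
    (hr : LineHol r V) {p : ι → ℂ} (hp : p ∈ V) {j : ι}
    (h : ∃ᶠ t in 𝓝 (p j), r (Function.update p j t) ≠ 0) :
    ∃ ρ₁ > 0, ∃ ρ₂ > 0,
      ball p ρ₂ ×ˢ closedBall (p j) ρ₁ ⊆ {z : (ι → ℂ) × ℂ | Function.update z.1 j z.2 ∈ V} ∧
      (∀ z ∈ ball p ρ₂, ∀ w ∈ sphere (p j) ρ₁, r (Function.update z j w) ≠ 0) ∧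
      ∀ w ∈ ball (p j) ρ₁, r (Function.update p j w) = 0 → w = p j := by
  have h1 := hr.update_eventually_ne hV hp h
  rw [eventually_nhdsWithin_iff] at h1
  have h2 : ∀ᶠ t in 𝓝 (p j), Function.update p j t ∈ V :=
    (isOpen_update_mem hV p j).mem_nhds (by simpa using hp)
  obtain ⟨ρ₁, hρ₁, hb⟩ := Metric.nhds_basis_closedBall.mem_iff.1 (h1.and h2)
  have hV2 : IsOpen {z : (ι → ℂ) × ℂ | Function.update z.1 j z.2 ∈ V} :=
    hV.preimage (by fun_prop)
  have hf2 : LineHol (fun z : (ι → ℂ) × ℂ => r (Function.update z.1 j z.2))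
      {z : (ι → ℂ) × ℂ | Function.update z.1 j z.2 ∈ V} :=
    hr.comp_update_prod j fun z hz => hz
  obtain ⟨ρ₂, hρ₂, hsub, hne⟩ := exists_tube hV2 hf2.1 (ζ := p) (c := p j) (r := ρ₁)
    (fun w hw => (hb hw).2)
    (fun w hw => (hb (sphere_subset_closedBall hw)).1 (ne_of_mem_sphere hw hρ₁.ne'))
  refine ⟨ρ₁, hρ₁, ρ₂, hρ₂, hsub, hne, fun w hw h0 => ?_⟩
  by_contra hwp
  exact (hb (ball_subset_closedBall hw)).1 hwp h0

theorem LineHol.exists_update_eliminant {V : Set (ι → ℂ)} (hV : IsOpen V) {r : (ι → ℂ) → ℂ}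
    (hr : LineHol r V) {p : ι → ℂ} (hp : p ∈ V) {j : ι}
    (h : ∃ᶠ t in 𝓝 (p j), r (Function.update p j t) ≠ 0) :
    ∃ ρ₁ > 0, ∃ ρ₂ > 0,
      (∀ z ∈ ball p ρ₂, ∀ w ∈ ball (p j) ρ₁, Function.update z j w ∈ V) ∧
      (∀ w ∈ ball (p j) ρ₁, r (Function.update p j w) = 0 → w = p j) ∧
      (∀ z ∈ ball p ρ₂, {w ∈ ball (p j) ρ₁ | r (Function.update z j w) = 0}.Finite) ∧
      ∀ g, LineHol g V → ∃ N : (ι → ℂ) → ℂ, LineHol N (ball p ρ₂) ∧ ∀ z ∈ ball p ρ₂,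
        N z = 0 ↔ ∃ w ∈ ball (p j) ρ₁, r (Function.update z j w) = 0 ∧
          g (Function.update z j w) = 0 := by
  obtain ⟨ρ₁, hρ₁, ρ₂, hρ₂, hsub, hne, huniq⟩ := hr.exists_update_circle hV hp h
  have hV2 : IsOpen {z : (ι → ℂ) × ℂ | Function.update z.1 j z.2 ∈ V} :=
    hV.preimage (by fun_prop)
  have hf2 : LineHol (fun z : (ι → ℂ) × ℂ => r (Function.update z.1 j z.2))
      {z : (ι → ℂ) × ℂ | Function.update z.1 j z.2 ∈ V} :=
    hr.comp_update_prod j fun z hz => hz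
  obtain ⟨h3, h4⟩ := hf2.exists_eliminant (P := ball p ρ₂) (c := p j) isOpen_ball
    (convex_ball p ρ₂).isPreconnected hV2 hρ₁ hsub hne
  refine ⟨ρ₁, hρ₁, ρ₂, hρ₂, fun z hz w hw => hsub (a := (z, w)) ⟨hz, ball_subset_closedBall hw⟩, huniq, h3,
    fun g hg => ?_⟩
  have hg2 : LineHol (fun z : (ι → ℂ) × ℂ => g (Function.update z.1 j z.2))
      {z : (ι → ℂ) × ℂ | Function.update z.1 j z.2 ∈ V} :=
    hg.comp_update_prod j fun z hz => hz
  exact h4 _ hg2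

theorem Good.exists_regular (h : Good D I X) {j : ι} (hj : j ∈ I) {p : ι → ℂ} (hp : p ∈ X)
    (hpj : p ∉ nonIso I j X) {O : Set (ι → ℂ)} (hO : O ∈ 𝓝 p) :
    ∃ O' : Set (ι → ℂ), IsOpen O' ∧ p ∈ O' ∧ O' ⊆ O ∧
    ∃ V : Set (ι → ℂ), IsOpen V ∧ p ∈ V ∧ ∃ S : Set ((ι → ℂ) → ℂ),
      (∀ f ∈ S, LineHol f V ∧ DependsOn f (I : Set ι)) ∧
      (∀ z ∈ V, (∃ q ∈ X, q ∈ O' ∧ ∀ i ∈ I, q i = z i) ↔ ∀ f ∈ S, f z = 0) ∧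
      ∃ r ∈ S, ∃ᶠ t in 𝓝 (p j), r (Function.update p j t) ≠ 0 := by
  have h1 : ∃ O₀ ∈ 𝓝 p, ∀ q ∈ X, q ∈ O₀ → (∀ i ∈ I, i ≠ j → q i = p i) → q = p := by
    by_contra! hcon
    refine hpj ⟨hp, fun O hO => ?_⟩
    obtain ⟨q, hq1, hq2, hq3, hq4⟩ := hcon O hO
    exact ⟨q, hq1, hq2, hq4, hq3⟩
  obtain ⟨O₀, hO₀, hiso⟩ := h1
  obtain ⟨O', hO', hpO', hO'O, V, hV, hpV, S, hS, hSX⟩ := h.an p hp _ (Filter.inter_mem hO hO₀)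
  refine ⟨O', hO', hpO', fun z hz => (hO'O hz).1, V, hV, hpV, S, hS, hSX, ?_⟩
  by_contra! hcon
  obtain ⟨ρ, hρ, hρV⟩ := Metric.isOpen_iff.1 hV p hpV
  have ht : p j + (ρ / 2 : ℝ) ∈ ball (p j) ρ := by
    rw [mem_ball, dist_eq_norm, add_sub_cancel_left, Complex.norm_real,
      Real.norm_of_nonneg (by linarith)]
    linarith
  obtain ⟨q, hqX, hqO, hqI⟩ := (hSX _ (hρV (update_mem_ball (mem_ball_self hρ) ht))).2
    fun f hf => by
      have hev := hcon f hf
      have hev' : ∀ᶠ t in 𝓝[≠] (p j), f (Function.update p j t) = 0 :=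
        nhdsWithin_le_nhds hev
      exact ((hS f hf).1.mono hρV).update_eq_zero (mem_ball_self hρ) (mem_ball_self hρ)
        hev'.frequently _ ht
  have hqp := hiso q hqX (hO'O hqO).2 fun i hi hij => by simpa [hij] using hqI i hi
  have := hqI j hj
  rw [hqp] at this
  simp [hρ.ne'] at this

/-- If `X` is integral over the coordinates in `I` other than `j`, then the `j`-th coordinate can
be dropped from the parameters. -/
theorem Good.drop (h : Good D I X) {j : ι} (hj : j ∈ I) (hempty : nonIso I j X = ∅) :
    Good D (I.erase j) X where
  sub := h.sub
  closed := h.closed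
  int := by
    intro p hp l hl
    obtain ⟨O', hO', hpO', -, V, hV, hpV, S, hS, hSX, r, hrS, hr⟩ :=
      h.exists_regular hj hp (by simp [hempty]) univ_mem
    have hr0 : ∀ q ∈ X, q ∈ O' → q ∈ V → r q = 0 := fun q hq hqO hqV =>
      (hSX q hqV).1 ⟨q, hq, hqO, fun _ _ => rfl⟩ r hrS
    by_cases hlj : l = j
    · subst hlj
      refine ⟨r, V ∩ O', hV.inter hO', ⟨hpV, hpO'⟩, (hS r hrS).1.mono inter_subset_left, ?_,
        fun q hq hqV => hr0 q hq hqV.2 hqV.1, hr⟩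
      rw [Finset.insert_erase hj]
      exact (hS r hrS).2
    have hlI : l ∉ I := fun hlI => hl (Finset.mem_erase.2 ⟨hlj, hlI⟩)
    obtain ⟨f, Vf, hVf, hpVf, hf, hfd, hf0, hffr⟩ := h.int p hp l hlI
    obtain ⟨ρ₁, hρ₁, ρ₂, hρ₂, hmem, huniq, -, hN⟩ :=
      ((hS r hrS).1.mono (inter_subset_left : V ∩ Vf ⊆ V)).exists_update_eliminant (hV.inter hVf)
        ⟨hpV, hpVf⟩ hr
    obtain ⟨N, hNh, hN0⟩ := hN f (hf.mono inter_subset_right)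
    set J : Finset ι := insert l (I.erase j) with hJ
    have hpw : ∀ q ∈ ball p ρ₂, J.piecewise q p ∈ ball p ρ₂ := fun q hq =>
      piecewise_mem_ball hρ₂ fun i _ => (dist_le_pi_dist q p i).trans_lt hq
    refine ⟨fun z => N (J.piecewise z p),
      ((V ∩ Vf) ∩ O') ∩ (ball p ρ₂ ∩ (fun z : ι → ℂ => z j) ⁻¹' ball (p j) ρ₁),
      ((hV.inter hVf).inter hO').inter (isOpen_ball.inter
        (isOpen_ball.preimage (continuous_apply j))),
      ⟨⟨⟨hpV, hpVf⟩, hpO'⟩, mem_ball_self hρ₂, mem_ball_self hρ₁⟩,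
      (hNh.comp_piecewise J p hpw).mono fun z hz => hz.2.1, fun x y hxy => ?_, fun q hq hqV => ?_,
      ?_⟩
    · change N _ = N _
      congr 1
      refine J.piecewise_congr (fun i hi => hxy i hi) fun _ _ => rfl
    · refine (hN0 _ (hpw q hqV.2.1)).2 ⟨q j, hqV.2.2, ?_, ?_⟩
      · rw [← hr0 q hq hqV.1.2 hqV.1.1.1]
        refine (hS r hrS).2 fun i hi => ?_
        by_cases hij : i = j
        · subst hij; simp
        · have : i ∈ J := by simp [hJ, hij, Finset.mem_coe.1 hi]
          simp [hij, this]
      · rw [← hf0 q hq hqV.1.1.2]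
        refine hfd fun i hi => ?_
        by_cases hij : i = j
        · subst hij; simp
        · have : i ∈ J := by
            rw [hJ, Finset.mem_insert, Finset.mem_erase]
            rw [Finset.mem_coe, Finset.mem_insert] at hi
            tauto
          simp [hij, this]
    · refine (hffr.and_eventually (isOpen_ball.mem_nhds (mem_ball_self hρ₂))).mono ?_
      rintro t ⟨ht0, htρ⟩ hN1
      apply ht0
      have hpt : Function.update p l t ∈ ball p ρ₂ := update_mem_ball (mem_ball_self hρ₂) htρ
      have hJp : J.piecewise (Function.update p l t) p = Function.update p l t := by
        ext i
        by_cases hi : i ∈ J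
        · simp [hi]
        · have : i ≠ l := fun hil => hi (by simp [hJ, hil])
          simp [hi, this]
      simp only [hJp] at hN1
      obtain ⟨w, hw, hrw, hfw⟩ := (hN0 _ hpt).1 hN1
      have hjl : j ≠ l := fun hc => hlj hc.symm
      have hwp : w = p j := by
        refine huniq w hw ?_
        rw [← hrw]
        refine (hS r hrS).2 fun i hi => ?_
        have hil : i ≠ l := fun hc => hlI (hc ▸ hi)
        by_cases hij : i = j
        · subst hij; simp
        · simp [hij, hil]
      rw [← hfw, hwp]
      congr 1
      ext i
      by_cases hij : i = j
      · subst hij; simp [hjl]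
      · simp [hij]
  an := by
    intro p hp O hO
    obtain ⟨O', hO', hpO', hO'O, V, hV, hpV, S, hS, hSX, r, hrS, hr⟩ :=
      h.exists_regular hj hp (by simp [hempty]) hO
    obtain ⟨ρ₁, hρ₁, ρ₂, hρ₂, hmem, -, hfin, hN⟩ :=
      (hS r hrS).1.exists_update_eliminant hV hpV hr
    set J : Finset ι := I.erase j with hJ
    have hpw : ∀ q ∈ ball p ρ₂, J.piecewise q p ∈ ball p ρ₂ := fun q hq =>
      piecewise_mem_ball hρ₂ fun i _ => (dist_le_pi_dist q p i).trans_lt hq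
    have hspan : ∀ g ∈ Submodule.span ℂ S, LineHol g V := by
      intro g hg
      induction hg using Submodule.span_induction with
      | mem x hx => exact (hS x hx).1
      | zero => exact LineHol.const 0
      | add x y _ _ hx hy => exact hx.add hy
      | smul a x _ hx => exact (LineHol.const a).mul hx
    have hspan0 : ∀ z, (∀ f ∈ S, f z = 0) → ∀ g ∈ Submodule.span ℂ S, g z = 0 := by
      intro z hz g hg
      induction hg using Submodule.span_induction with
      | mem x hx => exact hz x hx
      | zero => rfl
      | add x y _ _ hx hy => simp [hx, hy]
      | smul a x _ hx => simp [hx]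
    refine ⟨O' ∩ (fun z : ι → ℂ => z j) ⁻¹' ball (p j) ρ₁,
      hO'.inter (isOpen_ball.preimage (continuous_apply j)), ⟨hpO', mem_ball_self hρ₁⟩,
      fun z hz => hO'O hz.1, ball p ρ₂, isOpen_ball, mem_ball_self hρ₂,
      {G | ∃ g ∈ Submodule.span ℂ S, ∃ N : (ι → ℂ) → ℂ, LineHol N (ball p ρ₂) ∧
        (∀ z ∈ ball p ρ₂, N z = 0 ↔ ∃ w ∈ ball (p j) ρ₁, r (Function.update z j w) = 0 ∧
          g (Function.update z j w) = 0) ∧ G = fun z => N (J.piecewise z p)}, ?_, ?_⟩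
    · rintro _ ⟨g, hg, N, hNh, hN0, rfl⟩
      refine ⟨hNh.comp_piecewise J p hpw, fun x y hxy => ?_⟩
      change N _ = N _
      congr 1
      exact J.piecewise_congr (fun i hi => hxy i hi) fun _ _ => rfl
    · intro z hz
      have hI : ∀ i ∈ I, i ≠ j → i ∈ J := fun i hi hij => Finset.mem_erase.2 ⟨hij, hi⟩
      constructor
      · rintro ⟨q, hq, ⟨hqO, hqj⟩, hqz⟩ _ ⟨g, hg, N, hNh, hN0, rfl⟩
        refine (hN0 _ (hpw z hz)).2 ⟨q j, hqj, ?_⟩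
        have h1 := (hSX _ (hmem _ (hpw z hz) (q j) hqj)).1 ⟨q, hq, hqO, fun i hi => by
          by_cases hij : i = j
          · subst hij; simp
          · simp [hij, hI i hi hij, hqz i (hI i hi hij)]⟩
        exact ⟨h1 r hrS, hspan0 _ h1 g hg⟩
      · intro hG
        set z' := J.piecewise z p with hz'
        have hcov : ∀ g ∈ Submodule.span ℂ S, ∃ w ∈ ball (p j) ρ₁,
            r (Function.update z' j w) = 0 ∧ g (Function.update z' j w) = 0 := by
          intro g hg
          obtain ⟨N, hNh, hN0⟩ := hN g (hspan g hg)
          exact (hN0 _ (hpw z hz)).1 (hG _ ⟨g, hg, N, hNh, hN0, rfl⟩)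
        have := (hfin z' (hpw z hz)).to_subtype
        let sub : {w ∈ ball (p j) ρ₁ | r (Function.update z' j w) = 0} →
            Subspace ℂ (Submodule.span ℂ S) := fun w =>
          LinearMap.ker ((LinearMap.proj (R := ℂ) (φ := fun _ : ι → ℂ => ℂ)
            (Function.update z' j w.1)).comp (Submodule.span ℂ S).subtype)
        have hcov' : ⋃ w, (sub w : Set (Submodule.span ℂ S)) = univ := by
          refine eq_univ_of_forall fun g => ?_
          obtain ⟨w, hw, hrw, hgw⟩ := hcov g.1 g.2
          exact mem_iUnion.2 ⟨⟨w, hw, hrw⟩, hgw⟩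
        obtain ⟨⟨w, hw, hrw⟩, hwtop⟩ := Subspace.exists_eq_top_of_iUnion_eq_univ hcov'
        obtain ⟨q, hq, hqO, hqI⟩ := (hSX _ (hmem _ (hpw z hz) w hw)).2 fun f hf => by
          have : (⟨f, Submodule.subset_span hf⟩ : Submodule.span ℂ S) ∈ sub ⟨w, hw, hrw⟩ := by
            rw [hwtop]; trivial
          exact this
        refine ⟨q, hq, ⟨hqO, ?_⟩, fun i hi => ?_⟩
        · have := hqI j hj
          simp only [Function.update_self] at this
          simpa [this] using hw
        · rw [hqI i (Finset.mem_of_mem_erase hi)]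
          simp [Finset.ne_of_mem_erase hi, hi]

end Drop

end

section

open Set Filter Topology Metric

section Transport

variable {Z Y : Type*} [TopologicalSpace Z] [TopologicalSpace Y]

/-- The points of `G` near which `π` is injective on `G`. -/
def regularPart (π : Z → Y) (G : Set Z) : Set Z :=
  {q | q ∈ G ∧ ∃ O, IsOpen O ∧ q ∈ O ∧ InjOn π (G ∩ O)}

/-- `c` is a lift to the regular part of `G` of the flow line of `φ` through `π (c 0)`. -/
structure IsTransport (π : Z → Y) (φ : ℝ → Y → Y) (G : Set Z) (ε : ℝ) (c : ℝ → Z) : Prop where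
  cont : ContinuousOn c (Icc 0 ε)
  mem : ∀ τ ∈ Icc 0 ε, c τ ∈ regularPart π G
  lift : ∀ τ ∈ Icc 0 ε, π (c τ) = φ τ (π (c 0))

/-- The starting points of transports. -/
def transportable (π : Z → Y) (φ : ℝ → Y → Y) (G : Set Z) (ε : ℝ) : Set Z :=
  {q | ∃ c, IsTransport π φ G ε c ∧ c 0 = q}

open Classical in
/-- The end point of the transport starting at `q`. -/
def transport (π : Z → Y) (φ : ℝ → Y → Y) (G : Set Z) (ε : ℝ) (q : Z) : Z :=
  if h : q ∈ transportable π φ G ε then h.choose ε else q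

theorem regularPart_inter {π : Z → Y} {G : Set Z} :
    ∃ V, IsOpen V ∧ regularPart π G = G ∩ V := by
  refine ⟨⋃₀ {O | IsOpen O ∧ InjOn π (G ∩ O)}, isOpen_sUnion fun O hO => hO.1, ?_⟩
  ext q
  constructor
  · rintro ⟨hq, O, hO, hqO, hinj⟩
    exact ⟨hq, O, ⟨hO, hinj⟩, hqO⟩
  · rintro ⟨hq, O, ⟨hO, hinj⟩, hqO⟩
    exact ⟨hq, O, hO, hqO, hinj⟩

variable {π : Z → Y} {φ : ℝ → Y → Y} {G : Set Z} {ε : ℝ}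

theorem IsTransport.eqOn [T2Space Z] {c c' : ℝ → Z} (hc : IsTransport π φ G ε c)
    (hc' : IsTransport π φ G ε c') (h : π (c 0) = π (c' 0)) {τ : ℝ} (hτ : τ ∈ Icc 0 ε)
    (h' : c τ = c' τ) : EqOn c c' (Icc 0 ε) := by
  have : PreconnectedSpace (Icc 0 ε) := isPreconnected_iff_preconnectedSpace.1 isPreconnected_Icc
  let f : regularPart π G → Y := fun x => π x
  have hsep : IsSeparatedMap f := T2Space.isSeparatedMap f
  have hf : IsLocallyInjective f := by
    rw [isLocallyInjective_iff_nhds]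
    rintro ⟨x, hx, O, hO, hxO, hinj⟩
    refine ⟨Subtype.val ⁻¹' O, (hO.preimage continuous_subtype_val).mem_nhds hxO, ?_⟩
    intro a ha b hb hab
    exact Subtype.ext (hinj ⟨a.2.1, ha⟩ ⟨b.2.1, hb⟩ hab)
  let g : Icc 0 ε → regularPart π G := fun t => ⟨c t, hc.mem t t.2⟩
  let g' : Icc 0 ε → regularPart π G := fun t => ⟨c' t, hc'.mem t t.2⟩
  have hg : Continuous g := Continuous.subtype_mk (continuousOn_iff_continuous_domRestrict.1 hc.cont) _
  have hg' : Continuous g' :=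
    Continuous.subtype_mk (continuousOn_iff_continuous_domRestrict.1 hc'.cont) _
  have := hsep.eq_of_comp_eq hf hg hg' (by
    funext t
    change π (c t) = π (c' t)
    rw [hc.lift t t.2, hc'.lift t t.2, h]) ⟨τ, hτ⟩ (Subtype.ext h')
  intro t ht
  exact congrArg Subtype.val (congrFun this ⟨t, ht⟩)

theorem IsTransport.transport_eq [T2Space Z] (hε : 0 ≤ ε) {c : ℝ → Z}
    (hc : IsTransport π φ G ε c) : transport π φ G ε (c 0) = c ε := by
  have h : c 0 ∈ transportable π φ G ε := ⟨c, hc, rfl⟩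
  rw [transport, dif_pos h]
  exact h.choose_spec.1.eqOn hc (by rw [h.choose_spec.2]) ⟨le_rfl, hε⟩ h.choose_spec.2
    ⟨hε, le_rfl⟩

theorem transport_mem (hε : 0 ≤ ε) [T2Space Z] {q : Z} (hq : q ∈ transportable π φ G ε) :
    transport π φ G ε q ∈ regularPart π G := by
  obtain ⟨c, hc, rfl⟩ := hq
  rw [hc.transport_eq hε]
  exact hc.mem ε ⟨hε, le_rfl⟩

theorem apply_transport (hε : 0 ≤ ε) [T2Space Z] {q : Z} (hq : q ∈ transportable π φ G ε) :
    π (transport π φ G ε q) = φ ε (π q) := by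
  obtain ⟨c, hc, rfl⟩ := hq
  rw [hc.transport_eq hε]
  exact hc.lift ε ⟨hε, le_rfl⟩

theorem transportable_subset (hε : 0 ≤ ε) : transportable π φ G ε ⊆ regularPart π G := by
  rintro _ ⟨c, hc, rfl⟩
  exact hc.mem 0 ⟨le_rfl, hε⟩

theorem injOn_transport (hε : 0 ≤ ε) [T2Space Z] (hφ : Function.Injective (φ ε)) :
    InjOn (transport π φ G ε) (transportable π φ G ε) := by
  rintro _ ⟨c, hc, rfl⟩ _ ⟨c', hc', rfl⟩ h
  rw [hc.transport_eq hε, hc'.transport_eq hε] at h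
  have h1 : π (c 0) = π (c' 0) := by
    apply hφ
    rw [← hc.lift ε ⟨hε, le_rfl⟩, ← hc'.lift ε ⟨hε, le_rfl⟩, h]
  exact hc.eqOn hc' h1 ⟨hε, le_rfl⟩ h ⟨le_rfl, hε⟩

theorem map_mem_regularPart {T : Z ≃ₜ Z} {ψ : Y → Y} (hT : ∀ z, T z ∈ G ↔ z ∈ G)
    (hπ : ∀ z, π (T z) = ψ (π z)) (hψ : Function.Injective ψ) {q : Z}
    (hq : q ∈ regularPart π G) : T q ∈ regularPart π G := by
  obtain ⟨h1, O, hO, h2, h3⟩ := hq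
  refine ⟨(hT _).2 h1, T.symm ⁻¹' O, hO.preimage T.symm.continuous, by simpa using h2, ?_⟩
  rintro a ⟨ha, haO⟩ b ⟨hb, hbO⟩ hab
  have h4 : T.symm a = T.symm b := by
    refine h3 ⟨(hT _).1 (by simpa using ha), haO⟩ ⟨(hT _).1 (by simpa using hb), hbO⟩ (hψ ?_)
    rw [← hπ, ← hπ]
    simpa using hab
  exact T.symm.injective h4

theorem IsTransport.map {T : Z ≃ₜ Z} {ψ : Y → Y} (hT : ∀ z, T z ∈ G ↔ z ∈ G)
    (hπ : ∀ z, π (T z) = ψ (π z)) (hψ : Function.Injective ψ)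
    (hφ : ∀ z ∈ G, ∀ τ, φ τ (ψ (π z)) = ψ (φ τ (π z)))
    {c : ℝ → Z} (hε : 0 ≤ ε) (hc : IsTransport π φ G ε c) :
    IsTransport π φ G ε (fun τ => T (c τ)) where
  cont := T.continuous.comp_continuousOn hc.cont
  mem τ hτ := map_mem_regularPart hT hπ hψ (hc.mem τ hτ)
  lift τ hτ := by
    rw [hπ, hπ, hφ _ (hc.mem 0 ⟨le_rfl, hε⟩).1, hc.lift τ hτ]

end Transport

theorem IsCompact.continuousOn_invFunOn {X Y : Type*} [TopologicalSpace X] [TopologicalSpace Y]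
    [T2Space Y] [Nonempty X] {f : X → Y} {K : Set X} (hK : IsCompact K) (hf : ContinuousOn f K)
    (hinj : InjOn f K) : ContinuousOn (Function.invFunOn f K) (f '' K) := by
  rw [continuousOn_iff_isClosed]
  intro C hC
  refine ⟨f '' (K ∩ C), ((hK.inter_right hC).image_of_continuousOn
    (hf.mono inter_subset_left)).isClosed, ?_⟩
  ext y
  constructor
  · rintro ⟨hy, x, hx, rfl⟩
    refine ⟨⟨x, ⟨hx, ?_⟩, rfl⟩, x, hx, rfl⟩
    rwa [mem_preimage, hinj.leftInvOn_invFunOn hx] at hy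
  · rintro ⟨⟨x, ⟨hx, hxC⟩, rfl⟩, -⟩
    refine ⟨?_, x, hx, rfl⟩
    rwa [mem_preimage, hinj.leftInvOn_invFunOn hx]

section Open

variable {Z Y : Type*} [MetricSpace Z] [ProperSpace Z] [TopologicalSpace Y] [T2Space Y]
  {π : Z → Y} {φ : ℝ → Y → Y} {G D : Set Z} {ε : ℝ}

theorem exists_mem_nhds_forall_Icc_notMem (hφ : Continuous (Function.uncurry φ)) {B : Set Y}
    (hB : IsClosed B) {y : Y} (h : ∀ τ ∈ Icc 0 ε, φ τ y ∉ B) :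
    ∀ᶠ y' in 𝓝 y, ∀ τ ∈ Icc 0 ε, φ τ y' ∉ B := by
  have h1 : ∀ τ ∈ Icc 0 ε, ∀ᶠ p : Y × ℝ in 𝓝 (y, τ), φ p.2 p.1 ∉ B := by
    intro τ hτ
    have h2 : Continuous fun p : Y × ℝ => φ p.2 p.1 := hφ.comp continuous_swap
    exact h2.continuousAt.eventually (hB.isOpen_compl.mem_nhds (show φ (y, τ).2 (y, τ).1 ∈ Bᶜ from
      h τ hτ))
  exact isCompact_Icc.eventually_forall_of_forall_eventually h1

theorem exists_tube_transport (hπ : Continuous π) (hφ : Continuous (Function.uncurry φ))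
    (h0 : ∀ y, φ 0 y = y) (hadd : ∀ s t y, φ (s + t) y = φ s (φ t y))
    (hD : IsOpen D) (hGD : G ⊆ D) (hcl : ∀ z ∈ D, z ∈ closure G → z ∈ G)
    (hinj : ∀ p ∈ G, Function.Injective fun τ => φ τ (π p))
    (hlift : ∀ p ∈ G, ∀ O ∈ 𝓝 p, ∀ᶠ τ in 𝓝 (0 : ℝ), ∃ q ∈ G, q ∈ O ∧ π q = φ τ (π p))
    (hε : 0 ≤ ε) {c : ℝ → Z} (hc : IsTransport π φ G ε c) :
    ∃ O ∈ 𝓝 (c 0), G ∩ O ⊆ transportable π φ G ε ∧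
      ContinuousOn (transport π φ G ε) (G ∩ O) := by
  have : Nonempty Z := ⟨c 0⟩
  set K₀ := c '' Icc 0 ε with hK₀
  have hK₀c : IsCompact K₀ := isCompact_Icc.image_of_continuousOn hc.cont
  have hK₀G : K₀ ⊆ G := by
    rintro _ ⟨τ, hτ, rfl⟩
    exact (hc.mem τ hτ).1
  have h0ε : (0 : ℝ) ∈ Icc 0 ε := ⟨le_rfl, hε⟩
  have hK₀inj : InjOn π K₀ := by
    rintro _ ⟨τ, hτ, rfl⟩ _ ⟨σ, hσ, rfl⟩ h
    rw [hc.lift τ hτ, hc.lift σ hσ] at h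
    rw [hinj _ (hc.mem 0 h0ε).1 h]
  obtain ⟨o, ho, hK₀o, hoinj⟩ : ∃ o : Set Z, IsOpen o ∧ K₀ ⊆ o ∧ InjOn π (G ∩ o) := by
    obtain ⟨t, ht, htinj⟩ := InjOn.exists_mem_nhdsSet (X := G) (f := fun x : G => π x)
      (s := Subtype.val ⁻¹' K₀) (fun a ha b hb hab => Subtype.ext (hK₀inj ha hb hab))
      (by
        rw [Subtype.isCompact_iff, Subtype.image_preimage_coe, inter_eq_right.2 hK₀G]
        exact hK₀c)
      (fun x hx => (hπ.comp continuous_subtype_val).continuousAt) (by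
        rintro ⟨x, hxG⟩ ⟨τ, hτ, rfl⟩
        obtain ⟨-, O, hO, hxO, hinj⟩ := hc.mem τ hτ
        exact ⟨Subtype.val ⁻¹' O, (hO.preimage continuous_subtype_val).mem_nhds hxO,
          fun a ha b hb hab => Subtype.ext (hinj ⟨a.2, ha⟩ ⟨b.2, hb⟩ hab)⟩)
    obtain ⟨o', ho', hKo', ho't⟩ := mem_nhdsSet_iff_exists.1 ht
    obtain ⟨o, ho, rfl⟩ := isOpen_induced_iff.1 ho'
    refine ⟨o, ho, fun x hx => hKo' (show (⟨x, hK₀G hx⟩ : G) ∈ _ from hx), ?_⟩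
    rintro a ⟨ha, hao⟩ b ⟨hb, hbo⟩ hab
    exact congrArg Subtype.val
      (htinj (ho't (show (⟨a, ha⟩ : G) ∈ _ from hao)) (ho't (show (⟨b, hb⟩ : G) ∈ _ from hbo)) hab)
  obtain ⟨δ, hδ, hKδ⟩ := hK₀c.exists_cthickening_subset_open (ho.inter hD)
    (subset_inter hK₀o (hK₀G.trans hGD))
  set K := cthickening δ K₀ with hK
  have hGK : IsCompact (G ∩ K) := by
    have h1 : G ∩ K = closure G ∩ K := by
      refine subset_antisymm (inter_subset_inter_left _ subset_closure) ?_
      rintro x ⟨hx, hxK⟩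
      exact ⟨hcl x (hKδ hxK).2 hx, hxK⟩
    rw [h1, inter_comm]
    exact hK₀c.cthickening.inter_right isClosed_closure
  have hKinj : InjOn π (G ∩ K) := hoinj.mono (inter_subset_inter_right _ fun x hx => (hKδ hx).1)
  have hKnhd : ∀ x ∈ K₀, x ∈ thickening δ K₀ := fun x hx => self_subset_thickening hδ _ hx
  have hBcl : IsClosed (π '' ((G ∩ K) ∩ (thickening δ K₀)ᶜ)) :=
    ((hGK.inter_right isOpen_thickening.isClosed_compl).image hπ).isClosed
  have hBseg : ∀ τ ∈ Icc 0 ε, φ τ (π (c 0)) ∉ π '' ((G ∩ K) ∩ (thickening δ K₀)ᶜ) := by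
    rintro τ hτ ⟨x, ⟨hx, hxt⟩, hxe⟩
    rw [← hc.lift τ hτ] at hxe
    have : x = c τ := hKinj hx
      ⟨(hc.mem τ hτ).1, thickening_subset_cthickening _ _ (hKnhd _ ⟨τ, hτ, rfl⟩)⟩ hxe
    exact hxt (this ▸ hKnhd _ ⟨τ, hτ, rfl⟩)
  have hev : ∀ᶠ q in 𝓝 (c 0), q ∈ thickening δ K₀ ∧
      ∀ τ ∈ Icc 0 ε, φ τ (π q) ∉ π '' ((G ∩ K) ∩ (thickening δ K₀)ᶜ) :=
    Filter.Eventually.and (isOpen_thickening.mem_nhds (hKnhd _ ⟨0, h0ε, rfl⟩))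
      (hπ.continuousAt.eventually (exists_mem_nhds_forall_Icc_notMem hφ hBcl hBseg))
  set g := Function.invFunOn π (G ∩ K) with hg
  have hgc : ContinuousOn g (π '' (G ∩ K)) := hGK.continuousOn_invFunOn hπ.continuousOn hKinj
  have hgl : LeftInvOn g π (G ∩ K) := hKinj.leftInvOn_invFunOn
  have key : ∀ q ∈ G, (q ∈ thickening δ K₀ ∧
      ∀ τ ∈ Icc 0 ε, φ τ (π q) ∉ π '' ((G ∩ K) ∩ (thickening δ K₀)ᶜ)) →
      (∀ τ ∈ Icc 0 ε, φ τ (π q) ∈ π '' (G ∩ K)) ∧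
      IsTransport π φ G ε (fun τ => g (φ τ (π q))) ∧ g (φ 0 (π q)) = q := by
    rintro q hqG ⟨hqt, hqB⟩
    have hqK : q ∈ G ∩ K := ⟨hqG, thickening_subset_cthickening _ _ hqt⟩
    have hcont : Continuous fun τ => φ τ (π q) :=
      hφ.comp (continuous_id.prodMk continuous_const)
    have hall : Icc 0 ε ⊆ {τ | φ τ (π q) ∈ π '' (G ∩ K)} := by
      refine IsClosed.Icc_subset_of_forall_mem_nhdsWithin ?_ ?_ ?_
      · exact ((hGK.image hπ).isClosed.preimage hcont).inter isClosed_Icc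
      · rw [mem_ofPred_eq, h0]
        exact ⟨q, hqK, rfl⟩
      · rintro τ ⟨⟨x, hx, hxe⟩, hτ⟩
        have hxt : x ∈ thickening δ K₀ := by
          by_contra hxt
          exact hqB τ ⟨hτ.1, hτ.2.le⟩ ⟨x, ⟨hx, hxt⟩, hxe⟩
        have h1 := hlift x hx.1 _ (isOpen_thickening.mem_nhds hxt)
        have h2 : Tendsto (fun σ : ℝ => σ - τ) (𝓝 τ) (𝓝 0) := by
          have : Continuous fun σ : ℝ => σ - τ := by fun_prop
          simpa using this.tendsto τ
        refine nhdsWithin_le_nhds ((h2.eventually h1).mono ?_)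
        rintro σ ⟨q', hq', hq't, hq'e⟩
        refine ⟨q', ⟨hq', thickening_subset_cthickening _ _ hq't⟩, ?_⟩
        rw [hq'e, hxe, ← hadd, sub_add_cancel]
    have hgm : ∀ τ ∈ Icc 0 ε, g (φ τ (π q)) ∈ G ∩ K ∧ π (g (φ τ (π q))) = φ τ (π q) :=
      fun τ hτ => ⟨Function.invFunOn_mem (hall hτ), Function.invFunOn_eq (hall hτ)⟩
    have hg0 : g (φ 0 (π q)) = q := by rw [h0, hgl hqK]
    refine ⟨hall, ⟨hgc.comp hcont.continuousOn hall, fun τ hτ => ⟨(hgm τ hτ).1.1,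
      thickening δ K₀, isOpen_thickening, ?_, hKinj.mono
        (inter_subset_inter_right _ (thickening_subset_cthickening _ _))⟩, fun τ hτ => ?_⟩, hg0⟩
    · by_contra hxt
      exact hqB τ hτ ⟨_, ⟨(hgm τ hτ).1, hxt⟩, (hgm τ hτ).2⟩
    · rw [(hgm τ hτ).2]
      simp only [hg0]
  obtain ⟨O, hO, hOP⟩ := hev.exists_mem
  refine ⟨O, hO, fun q hq => ⟨_, (key q hq.1 (hOP q hq.2)).2⟩, ?_⟩
  have h1 : ContinuousOn (fun q => g (φ ε (π q))) (G ∩ O) :=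
    hgc.comp (hφ.comp (continuous_const.prodMk hπ)).continuousOn
      fun q hq => (key q hq.1 (hOP q hq.2)).1 ε ⟨hε, le_rfl⟩
  refine h1.congr fun q hq => ?_
  obtain ⟨-, h2, h3⟩ := key q hq.1 (hOP q hq.2)
  have h4 := h2.transport_eq hε
  simp only [h3] at h4
  exact h4

end Open

end

section

open Set Filter Topology Metric

section FibreMeasure

open MeasureTheory

variable {Z Y : Type*} [TopologicalSpace Z] [PolishSpace Z] [MeasurableSpace Z] [BorelSpace Z]
  [TopologicalSpace Y] [T2Space Y] [SecondCountableTopology Y] [MeasurableSpace Y] [BorelSpace Y]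

theorem exists_measurable_pieces {π : Z → Y} {R : Set Z} (hR : MeasurableSet R)
    (h : ∀ q ∈ R, ∃ O, IsOpen O ∧ q ∈ O ∧ InjOn π (R ∩ O)) :
    ∃ E : ℕ → Set Z, (∀ n, MeasurableSet (E n)) ∧ Pairwise (Function.onFun Disjoint E) ∧
      ⋃ n, E n = R ∧ ∀ n, InjOn π (E n) := by
  choose! O hO hqO hinj using h
  obtain ⟨t, htR, htc, hcov⟩ := TopologicalSpace.countable_cover_nhdsWithin
    (f := O) (s := R) fun x hx => mem_nhdsWithin_of_mem_nhds ((hO x hx).mem_nhds (hqO x hx))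
  rcases R.eq_empty_or_nonempty with rfl | hne
  · exact ⟨fun _ => ∅, fun _ => .empty, fun _ _ _ => by simp [Function.onFun], by simp,
      fun _ => injOn_empty _⟩
  have htne : t.Nonempty := by
    obtain ⟨q, hq⟩ := hne
    obtain ⟨x, hx, -⟩ := mem_iUnion₂.1 (hcov hq)
    exact ⟨x, hx⟩
  obtain ⟨f, rfl⟩ := htc.exists_eq_range htne
  have hf : ∀ n, f n ∈ R := fun n => htR ⟨n, rfl⟩
  refine ⟨disjointed fun n => R ∩ O (f n), fun n => ?_, disjoint_disjointed _, ?_, fun n => ?_⟩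
  · exact MeasurableSet.disjointed (fun n => hR.inter (hO _ (hf n)).measurableSet) n
  · rw [iUnion_disjointed, ← inter_iUnion]
    refine inter_eq_left.2 fun q hq => ?_
    obtain ⟨x, ⟨n, rfl⟩, hx⟩ := mem_iUnion₂.1 (hcov hq)
    exact mem_iUnion.2 ⟨n, hx⟩
  · exact (hinj _ (hf n)).mono (disjointed_subset _ _)

/-- The measure on `R` counting the points of the fibres of `π` with respect to `m`. -/
theorem exists_fibreMeasure {π : Z → Y} (hπ : Continuous π) (m : Measure Y) {E : ℕ → Set Z}
    (hE : ∀ n, MeasurableSet (E n)) (hinj : ∀ n, InjOn π (E n)) :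
    ∃ μ : Measure Z, ∀ A, MeasurableSet A → μ A = ∑' n, m (π '' (A ∩ E n)) := by
  refine ⟨Measure.sum fun n => (m.comap ((E n).domRestrict π)).map Subtype.val, fun A hA => ?_⟩
  rw [Measure.sum_apply _ hA]
  congr 1
  ext n
  have hemb : MeasurableEmbedding ((E n).domRestrict π) :=
    hπ.continuousOn.measurableEmbedding (hE n) (hinj n)
  rw [Measure.map_apply measurable_subtype_coe hA, hemb.comap_apply]
  congr 1
  ext y
  constructor
  · rintro ⟨x, hx, rfl⟩
    exact ⟨x, ⟨hx, x.2⟩, rfl⟩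
  · rintro ⟨x, ⟨hx, hxE⟩, rfl⟩
    exact ⟨⟨x, hxE⟩, hx, rfl⟩

variable {π : Z → Y} {m : Measure Y} {E : ℕ → Set Z} {μ : Measure Z} {R : Set Z}

theorem fibreMeasure_of_subset (hdisj : Pairwise (Function.onFun Disjoint E))
    (hμ : ∀ A, MeasurableSet A → μ A = ∑' n, m (π '' (A ∩ E n))) {A : Set Z}
    (hA : MeasurableSet A) {n : ℕ} (hAn : A ⊆ E n) : μ A = m (π '' A) := by
  rw [hμ A hA, tsum_eq_single n, inter_eq_left.2 hAn]
  intro k hk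
  have : A ∩ E k = ∅ := (disjoint_iff_inter_eq_empty.1 ((hdisj hk).symm.mono_left hAn))
  simp [this]

theorem fibreMeasure_image (hπ : Continuous π) (hE : ∀ n, MeasurableSet (E n))
    (hdisj : Pairwise (Function.onFun Disjoint E)) (hER : ⋃ n, E n = R)
    (hinj : ∀ n, InjOn π (E n)) (hμ : ∀ A, MeasurableSet A → μ A = ∑' n, m (π '' (A ∩ E n)))
    {A : Set Z} (hA : MeasurableSet A) (hAR : A ⊆ R) {T : Z → Z} (hT : ContinuousOn T A)
    (hTinj : InjOn T A) (hTR : MapsTo T A R) {ψ : Y → Y} (hψ : ∀ z ∈ A, π (T z) = ψ (π z))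
    {c : ENNReal} (hc : ∀ B, MeasurableSet B → m (ψ '' B) = c * m B) :
    MeasurableSet (T '' A) ∧ μ (T '' A) = c * μ A := by
  have hpre : ∀ B, MeasurableSet B → MeasurableSet (A ∩ T ⁻¹' B) := by
    intro B hB
    have h1 : Measurable (A.domRestrict T) :=
      (continuousOn_iff_continuous_domRestrict.1 hT).measurable
    have h2 := hA.subtype_image (h1 hB)
    convert h2 using 1
    ext x
    constructor
    · rintro ⟨hx, hxB⟩
      exact ⟨⟨x, hx⟩, hxB, rfl⟩
    · rintro ⟨⟨x, hx⟩, hxB, rfl⟩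
      exact ⟨hx, hxB⟩
  set P : ℕ × ℕ → Set Z := fun p => (A ∩ T ⁻¹' E p.2) ∩ E p.1 with hP
  have hPm : ∀ p, MeasurableSet (P p) := fun p => (hpre _ (hE _)).inter (hE _)
  have hPA : ∀ p, P p ⊆ A := fun p x hx => hx.1.1
  have hPd : Pairwise (Function.onFun Disjoint P) := by
    intro p q hpq
    refine disjoint_left.2 fun x hx hx' => hpq ?_
    refine Prod.ext ?_ ?_
    · by_contra hne
      exact disjoint_left.1 (hdisj hne) hx.2 hx'.2
    · by_contra hne
      exact disjoint_left.1 (hdisj hne) hx.1.2 hx'.1.2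
  have hPU : ⋃ p, P p = A := by
    refine subset_antisymm (iUnion_subset hPA) fun x hx => ?_
    obtain ⟨n, hn⟩ := mem_iUnion.1 (hER.symm ▸ hAR hx : x ∈ ⋃ n, E n)
    obtain ⟨k, hk⟩ := mem_iUnion.1 (hER.symm ▸ hTR hx : T x ∈ ⋃ n, E n)
    exact mem_iUnion.2 ⟨(n, k), ⟨hx, hk⟩, hn⟩
  have hTm : ∀ B ⊆ A, MeasurableSet B → MeasurableSet (T '' B) := fun B hB hBm =>
    hBm.image_of_continuousOn_injOn (hT.mono hB) (hTinj.mono hB)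
  refine ⟨hTm A subset_rfl hA, ?_⟩
  have h1 : μ A = ∑' p, μ (P p) := by
    rw [← measure_iUnion hPd hPm, hPU]
  have h2 : μ (T '' A) = ∑' p, μ (T '' P p) := by
    rw [← measure_iUnion (fun p q hpq => ?_) fun p => hTm _ (hPA p) (hPm p), ← image_iUnion, hPU]
    refine disjoint_left.2 ?_
    rintro _ ⟨x, hx, rfl⟩ ⟨x', hx', hxx⟩
    rw [hTinj (hPA q hx') (hPA p hx) hxx] at hx'
    exact disjoint_left.1 (hPd hpq) hx hx'
  rw [h1, h2, ← ENNReal.tsum_mul_left]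
  congr 1
  ext p
  rw [fibreMeasure_of_subset hdisj hμ (hTm _ (hPA p) (hPm p)) (n := p.2)
      (by rintro _ ⟨x, hx, rfl⟩; exact hx.1.2),
    fibreMeasure_of_subset hdisj hμ (hPm p) (n := p.1) inter_subset_right,
    ← hc _ ((hPm p).image_of_continuousOn_injOn hπ.continuousOn
      ((hinj p.1).mono inter_subset_right)), image_image, image_image]
  congr 1
  exact image_congr fun x hx => hψ x (hPA p hx)

theorem fibreMeasure_le (hπ : Continuous π) (hE : ∀ n, MeasurableSet (E n))
    (hdisj : Pairwise (Function.onFun Disjoint E))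
    (hinj : ∀ n, InjOn π (E n)) (hμ : ∀ A, MeasurableSet A → μ A = ∑' n, m (π '' (A ∩ E n)))
    {A : Set Z} (hA : MeasurableSet A) {S : Set Y} (hS : MeasurableSet S) (hAS : MapsTo π A S)
    {k : ℕ} (hk : ∀ y, ∀ s : Finset Z, (∀ x ∈ s, x ∈ A ∧ π x = y) → s.card ≤ k) :
    μ A ≤ k * m S := by
  have hm : ∀ n, MeasurableSet (π '' (A ∩ E n)) := fun n =>
    (hA.inter (hE n)).image_of_continuousOn_injOn hπ.continuousOn ((hinj n).mono inter_subset_right)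
  rw [hμ A hA]
  calc ∑' n, m (π '' (A ∩ E n)) = ∑' n, ∫⁻ y, (π '' (A ∩ E n)).indicator 1 y ∂m := by
        congr 1; ext n; rw [lintegral_indicator_one (hm n)]
    _ = ∫⁻ y, ∑' n, (π '' (A ∩ E n)).indicator 1 y ∂m :=
        (lintegral_tsum fun n => (measurable_one.indicator (hm n)).aemeasurable).symm
    _ ≤ ∫⁻ y, S.indicator (fun _ => (k : ENNReal)) y ∂m := by
        refine lintegral_mono fun y => ?_
        by_cases hy : y ∈ S
        · rw [indicator_of_mem hy, ENNReal.tsum_eq_iSup_sum]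
          refine iSup_le fun t => ?_
          classical
          have h1 : ∀ n ∈ t.filter fun n => y ∈ π '' (A ∩ E n), ∃ x, x ∈ A ∩ E n ∧ π x = y :=
            fun n hn => (Finset.mem_filter.1 hn).2
          have : Nonempty Z ∨ (t.filter fun n => y ∈ π '' (A ∩ E n)) = ∅ := by
            rcases (t.filter fun n => y ∈ π '' (A ∩ E n)).eq_empty_or_nonempty with h | ⟨n, hn⟩
            · exact Or.inr h
            · exact Or.inl ⟨(h1 n hn).choose⟩
          rcases this with hZ | hempty
          swap
          · simp only [indicator_apply, Pi.one_apply]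
            rw [Finset.sum_ite, hempty]
            simp
          choose! x hx hxy using h1
          have h2 : ((t.filter fun n => y ∈ π '' (A ∩ E n)).image x).card ≤ k := by
            refine hk y _ fun z hz => ?_
            obtain ⟨n, hn, rfl⟩ := Finset.mem_image.1 hz
            exact ⟨(hx n hn).1, hxy n hn⟩
          rw [Finset.card_image_of_injOn] at h2
          · simp only [indicator_apply, Pi.one_apply]
            rw [Finset.sum_ite, Finset.sum_const_zero, add_zero, Finset.sum_const, nsmul_eq_mul,
              mul_one]
            exact_mod_cast h2
          · intro n hn n' hn' hnn
            by_contra hne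
            refine disjoint_left.1 (hdisj hne) (hx n hn).2 ?_
            rw [hnn]
            exact (hx n' hn').2
        · rw [indicator_of_notMem hy]
          refine (ENNReal.tsum_eq_zero.2 fun n => indicator_of_notMem ?_ _).le
          rintro ⟨x, hx, rfl⟩
          exact hy (hAS hx.1)
    _ = k * m S := by rw [lintegral_indicator_const hS]

end FibreMeasure

end

section

open Set Filter Topology Metric

section Packing

open MeasureTheory

theorem exists_fundamentalDomain {Z Γ : Type*} [MetricSpace Z] [ProperSpace Z] [MeasurableSpace Z]
    [BorelSpace Z] [Group Γ] [Countable Γ] [MulAction Γ Z] [ContinuousConstSMul Γ Z] {D : Set Z}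
    (hD : IsOpen D) (hfree : ∀ γ : Γ, ∀ z ∈ D, γ • z = z → γ = 1)
    (hdisc : ∀ C ⊆ D, IsCompact C → {γ : Γ | ∃ z ∈ C, γ • z ∈ C}.Finite)
    {C : Set Z} (hC : IsCompact C) (hCD : C ⊆ D) (hcov : ∀ z ∈ D, ∃ γ : Γ, γ • z ∈ C)
    {N : Z → Set Z} (hN : ∀ z ∈ D, N z ∈ 𝓝 z) :
    ∃ F, MeasurableSet F ∧ F ⊆ D ∧ (∃ t : Finset Z, (∀ z ∈ t, z ∈ D) ∧ F ⊆ ⋃ z ∈ t, N z) ∧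
      (∀ x ∈ F, ∀ γ : Γ, γ • x ∈ F → γ = 1) ∧ ∀ z ∈ D, ∃ γ : Γ, γ • z ∈ F := by
  classical
  have h1 : ∀ p ∈ D, ∃ O : Set Z, IsOpen O ∧ p ∈ O ∧ O ⊆ N p ∩ D ∧
      ∀ x ∈ O, ∀ γ : Γ, γ • x ∈ O → γ = 1 := by
    intro p hp
    obtain ⟨r, hr, hrD⟩ := Metric.nhds_basis_closedBall.mem_iff.1 (hD.mem_nhds hp)
    have hfin := hdisc _ hrD (isCompact_closedBall p r)
    have h2 : ∀ γ : Γ, γ ≠ 1 → ∀ᶠ x in 𝓝 p ×ˢ 𝓝 p, γ • x.1 ≠ x.2 := by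
      intro γ hγ
      rw [← nhds_prod_eq]
      have hne : γ • p ≠ p := fun h => hγ (hfree γ p hp h)
      have hc : Continuous fun x : Z × Z => (γ • x.1, x.2) := by fun_prop
      exact hc.continuousAt.eventually (isClosed_diagonal.isOpen_compl.mem_nhds
        (show (γ • (p, p).1, (p, p).2) ∈ (diagonal Z)ᶜ from hne))
    have h3 : ∀ᶠ x in 𝓝 p ×ˢ 𝓝 p, ∀ γ ∈ {γ : Γ | ∃ z ∈ closedBall p r, γ • z ∈ closedBall p r},
        γ ≠ 1 → γ • x.1 ≠ x.2 := by
      rw [hfin.eventually_all]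
      intro γ _
      by_cases hγ : γ = 1
      · exact Eventually.of_forall fun x h => absurd hγ h
      · exact (h2 γ hγ).mono fun x hx _ => hx
    obtain ⟨O, hO, hOP⟩ := (Filter.eventually_prod_self_iff (r := fun a b => ∀ γ ∈
      {γ : Γ | ∃ z ∈ closedBall p r, γ • z ∈ closedBall p r}, γ ≠ 1 → γ • a ≠ b)).1 h3
    obtain ⟨O', hO'sub, hO', hpO'⟩ := _root_.mem_nhds_iff.1
      (Filter.inter_mem hO (Filter.inter_mem (hN p hp) (closedBall_mem_nhds p hr)))
    refine ⟨O', hO', hpO', fun x hx => ⟨(hO'sub hx).2.1, hrD (hO'sub hx).2.2⟩, ?_⟩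
    intro x hx γ hγx
    by_contra hγ
    exact hOP x (hO'sub hx).1 _ (hO'sub hγx).1 γ ⟨x, (hO'sub hx).2.2, (hO'sub hγx).2.2⟩ hγ rfl
  choose! O hO hpO hOsub hOfree using h1
  have h4 : ∀ t : Finset Z, (∀ z ∈ t, z ∈ D) → ∃ F, MeasurableSet F ∧ F ⊆ ⋃ z ∈ t, O z ∧
      (∀ x ∈ F, ∀ γ : Γ, γ • x ∈ F → γ = 1) ∧ ∀ p ∈ t, ∀ z ∈ O p, ∃ γ : Γ, γ • z ∈ F := by
    intro t
    induction t using Finset.induction_on with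
    | empty => exact fun _ => ⟨∅, .empty, empty_subset _, by simp, by simp⟩
    | insert p t hpt ih =>
      intro ht
      obtain ⟨F, hF, hFsub, hFfree, hFcov⟩ := ih fun z hz => ht z (Finset.mem_insert_of_mem hz)
      have hp := ht p (Finset.mem_insert_self _ _)
      have hS : MeasurableSet {z | ∃ γ : Γ, γ • z ∈ F} := by
        have : {z | ∃ γ : Γ, γ • z ∈ F} = ⋃ γ : Γ, (fun z => γ • z) ⁻¹' F := by
          ext z; simp
        rw [this]
        exact MeasurableSet.iUnion fun γ => (continuous_const_smul γ).measurable hF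
      refine ⟨F ∪ (O p \ {z | ∃ γ : Γ, γ • z ∈ F}), hF.union ((hO p hp).measurableSet.diff hS),
        ?_, ?_, ?_⟩
      · rintro x (hx | hx)
        · obtain ⟨z, hz, hxz⟩ := mem_iUnion₂.1 (hFsub hx)
          exact mem_iUnion₂.2 ⟨z, Finset.mem_insert_of_mem hz, hxz⟩
        · exact mem_iUnion₂.2 ⟨p, Finset.mem_insert_self _ _, hx.1⟩
      · rintro x (hx | hx) γ (hγ | hγ)
        · exact hFfree x hx γ hγ
        · exact absurd ⟨γ⁻¹, by simpa using hx⟩ hγ.2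
        · exact absurd ⟨γ, hγ⟩ hx.2
        · exact hOfree p hp x hx.1 γ hγ.1
      · intro p' hp' z hz
        rcases Finset.mem_insert.1 hp' with rfl | hp'
        · by_cases hzS : ∃ γ : Γ, γ • z ∈ F
          · obtain ⟨γ, hγ⟩ := hzS
            exact ⟨γ, Or.inl hγ⟩
          · exact ⟨1, Or.inr ⟨by simpa using hz, by simpa using hzS⟩⟩
        · obtain ⟨γ, hγ⟩ := hFcov p' hp' z hz
          exact ⟨γ, Or.inl hγ⟩
  obtain ⟨t, htC, htcov⟩ := hC.elim_nhds_subcover O fun x hx => (hO x (hCD hx)).mem_nhds (hpO x (hCD hx))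
  obtain ⟨F, hF, hFsub, hFfree, hFcov⟩ := h4 t fun z hz => hCD (htC z hz)
  refine ⟨F, hF, fun x hx => ?_, ⟨t, fun z hz => hCD (htC z hz), fun x hx => ?_⟩, hFfree,
    fun z hz => ?_⟩
  · obtain ⟨z, hz, hxz⟩ := mem_iUnion₂.1 (hFsub hx)
    exact (hOsub z (hCD (htC z hz)) hxz).2
  · obtain ⟨z, hz, hxz⟩ := mem_iUnion₂.1 (hFsub hx)
    exact mem_iUnion₂.2 ⟨z, hz, (hOsub z (hCD (htC z hz)) hxz).1⟩
  · obtain ⟨γ, hγ⟩ := hcov z hz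
    obtain ⟨p, hp, hγp⟩ := mem_iUnion₂.1 (htcov hγ)
    obtain ⟨γ', hγ'⟩ := hFcov p hp _ hγp
    exact ⟨γ' * γ, by rwa [mul_smul]⟩

variable {Z Y Γ : Type*} [MetricSpace Z] [ProperSpace Z] [MeasurableSpace Z] [BorelSpace Z]
  [TopologicalSpace Y] [T2Space Y] [SecondCountableTopology Y] [MeasurableSpace Y] [BorelSpace Y]
  [Group Γ] [Countable Γ] [MulAction Γ Z] [ContinuousConstSMul Γ Z]
  {π : Z → Y} {φ : ℝ → Y → Y} {G D : Set Z} {ε : ℝ} {m : Measure Y} {ψ : Γ → Y → Y}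

/-- An equivariant flow along a cocompact family of local sections cannot expand the measure. -/
theorem false_of_expanding_flow (hπ : Continuous π) (hφ : Continuous (Function.uncurry φ))
    (h0 : ∀ y, φ 0 y = y) (hadd : ∀ s t y, φ (s + t) y = φ s (φ t y))
    (hD : IsOpen D) (hGD : G ⊆ D) (hcl : ∀ z ∈ D, z ∈ closure G → z ∈ G)
    (hinj : ∀ p ∈ G, Function.Injective fun τ => φ τ (π p))
    (hlift : ∀ p ∈ G, ∀ O ∈ 𝓝 p, ∀ᶠ τ in 𝓝 (0 : ℝ), ∃ q ∈ G, q ∈ O ∧ π q = φ τ (π p))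
    (hε : 0 ≤ ε) (hΓG : ∀ γ : Γ, ∀ z ∈ G, γ • z ∈ G)
    (hfree : ∀ γ : Γ, ∀ z ∈ D, γ • z = z → γ = 1)
    (hdisc : ∀ C ⊆ D, IsCompact C → {γ : Γ | ∃ z ∈ C, γ • z ∈ C}.Finite)
    {C : Set Z} (hC : IsCompact C) (hCD : C ⊆ D) (hcov : ∀ z ∈ D, ∃ γ : Γ, γ • z ∈ C)
    (hψ : ∀ γ : Γ, ∀ z, π (γ • z) = ψ γ (π z)) (hψinj : ∀ γ : Γ, Function.Injective (ψ γ))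
    (hψφ : ∀ γ : Γ, ∀ z ∈ G, ∀ τ, φ τ (ψ γ (π z)) = ψ γ (φ τ (π z)))
    (hm : ∀ γ : Γ, ∀ B, MeasurableSet B → m (ψ γ '' B) = m B)
    {c : ENNReal} (hc : 1 < c) (hmφ : ∀ B, MeasurableSet B → m (φ ε '' B) = c * m B)
    (hnull : m (π '' (G \ transportable π φ G ε)) = 0) (hpos : m (π '' G) ≠ 0)
    (hfin : ∀ p ∈ D, ∃ O ∈ 𝓝 p, MeasurableSet O ∧ (∃ k : ℕ, ∀ y, ∀ s : Finset Z,
      (∀ x ∈ s, x ∈ G ∩ O ∧ π x = y) → s.card ≤ k) ∧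
      ∃ S, MeasurableSet S ∧ m S < ⊤ ∧ MapsTo π O S) : False := by
  have hΓG' : ∀ γ : Γ, ∀ z, γ • z ∈ G ↔ z ∈ G := fun γ z =>
    ⟨fun h => by simpa using hΓG γ⁻¹ _ h, hΓG γ z⟩
  have hGm : MeasurableSet G := by
    have : G = D ∩ closure G :=
      subset_antisymm (fun x hx => ⟨hGD hx, subset_closure hx⟩) fun x hx => hcl x hx.1 hx.2
    rw [this]
    exact hD.measurableSet.inter isClosed_closure.measurableSet
  set R := regularPart π G with hR
  set W := transportable π φ G ε with hW
  set L := transport π φ G ε with hL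
  have hRG : R ⊆ G := fun x hx => hx.1
  have hWR : W ⊆ R := transportable_subset hε
  have hRm : MeasurableSet R := by
    obtain ⟨V, hV, hRV⟩ := regularPart_inter (π := π) (G := G)
    rw [hR, hRV]
    exact hGm.inter hV.measurableSet
  have htube : ∀ q ∈ W, ∃ O, IsOpen O ∧ q ∈ O ∧ G ∩ O ⊆ W ∧ ContinuousOn L (G ∩ O) := by
    rintro _ ⟨c', hc', rfl⟩
    obtain ⟨O, hO, h1, h2⟩ := exists_tube_transport hπ hφ h0 hadd hD hGD hcl hinj hlift hε hc'
    obtain ⟨O', hO'O, hO', hmem⟩ := _root_.mem_nhds_iff.1 hO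
    exact ⟨O', hO', hmem, (inter_subset_inter_right _ hO'O).trans h1,
      h2.mono (inter_subset_inter_right _ hO'O)⟩
  have hWm : MeasurableSet W := by
    have : W = G ∩ ⋃₀ {O | IsOpen O ∧ G ∩ O ⊆ W} := by
      ext q
      constructor
      · intro hq
        obtain ⟨O, hO, hqO, hOW, -⟩ := htube q hq
        exact ⟨hRG (hWR hq), O, ⟨hO, hOW⟩, hqO⟩
      · rintro ⟨hq, O, ⟨hO, hOW⟩, hqO⟩
        exact hOW ⟨hq, hqO⟩
    rw [this]
    exact hGm.inter (isOpen_sUnion fun O hO => hO.1).measurableSet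
  have hLc : ContinuousOn L W := by
    intro q hq
    obtain ⟨O, hO, hqO, -, hOc⟩ := htube q hq
    have h1 := (hOc q ⟨hRG (hWR hq), hqO⟩)
    refine (h1.mono_of_mem_nhdsWithin ?_)
    exact mem_nhdsWithin.2 ⟨O, hO, hqO, fun x hx => ⟨hRG (hWR hx.2), hx.1⟩⟩
  have hφinj : Function.Injective (φ ε) := fun y y' h => by
    have : φ (-ε) (φ ε y) = φ (-ε) (φ ε y') := by rw [h]
    rwa [← hadd, ← hadd, neg_add_cancel, h0, h0] at this
  have hLinj : InjOn L W := injOn_transport hε hφinj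
  have hLR : MapsTo L W R := fun q hq => transport_mem hε hq
  have hLπ : ∀ q ∈ W, π (L q) = φ ε (π q) := fun q hq => apply_transport hε hq
  have hΓR : ∀ γ : Γ, MapsTo (fun z => γ • z) R R := fun γ q hq =>
    map_mem_regularPart (T := Homeomorph.smul γ) (hΓG' γ) (hψ γ) (hψinj γ) hq
  have hΓL : ∀ γ : Γ, ∀ q ∈ W, γ • q ∈ W ∧ L (γ • q) = γ • L q := by
    rintro γ _ ⟨c', hc', rfl⟩
    have h1 := hc'.map (T := Homeomorph.smul γ) (hΓG' γ) (hψ γ) (hψinj γ) (hψφ γ) hε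
    refine ⟨⟨_, h1, rfl⟩, ?_⟩
    have h2 := h1.transport_eq hε
    simp only [Homeomorph.smul_apply] at h2
    rw [hL, h2, hc'.transport_eq hε]
  obtain ⟨E, hE, hEd, hER, hEinj⟩ := exists_measurable_pieces (π := π) hRm (by
    rintro q ⟨hq, O, hO, hqO, hinj⟩
    exact ⟨O, hO, hqO, hinj.mono (inter_subset_inter_left _ hRG)⟩)
  obtain ⟨μ, hμ⟩ := exists_fibreMeasure hπ m hE hEinj
  have hμΓ : ∀ γ : Γ, ∀ A ⊆ R, MeasurableSet A →
      MeasurableSet ((fun z => γ • z) '' A) ∧ μ ((fun z => γ • z) '' A) = μ A := by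
    intro γ A hAR hA
    have := fibreMeasure_image hπ hE hEd hER hEinj hμ hA hAR (T := fun z => γ • z)
      (continuous_const_smul γ).continuousOn (MulAction.injective γ).injOn
      ((hΓR γ).mono_left hAR) (ψ := ψ γ) (fun z _ => hψ γ z) (c := 1)
      (fun B hB => by rw [one_mul, hm γ B hB])
    simpa using this
  choose! N hNn hNm hNk hNS using hfin
  obtain ⟨F, hF, hFD, ⟨t, htD, hFt⟩, hFfree, hFcov⟩ :=
    exists_fundamentalDomain hD hfree hdisc hC hCD hcov hNn
  have hFRW : μ (F ∩ R) = μ (F ∩ W) := by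
    have h1 : F ∩ R ⊆ (F ∩ W) ∪ (R \ W) := fun x hx => by
      by_cases hxW : x ∈ W
      · exact Or.inl ⟨hx.1, hxW⟩
      · exact Or.inr ⟨hx.2, hxW⟩
    have h2 : μ (R \ W) = 0 := by
      rw [hμ _ (hRm.diff hWm), ENNReal.tsum_eq_zero]
      intro n
      refine measure_mono_null (image_mono ?_) hnull
      rintro x ⟨⟨hx, hxW⟩, -⟩
      exact ⟨hRG hx, hxW⟩
    refine le_antisymm ?_ (measure_mono (inter_subset_inter_right _ hWR))
    calc μ (F ∩ R) ≤ μ ((F ∩ W) ∪ (R \ W)) := measure_mono h1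
      _ ≤ μ (F ∩ W) + μ (R \ W) := measure_union_le _ _
      _ = μ (F ∩ W) := by rw [h2, add_zero]
  have hpos' : μ (F ∩ W) ≠ 0 := by
    intro hzero
    apply hpos
    have hRcov : R ⊆ ⋃ γ : Γ, (fun z => γ • z) '' (F ∩ R) := by
      intro x hx
      obtain ⟨γ, hγ⟩ := hFcov x (hGD (hRG hx))
      exact mem_iUnion.2 ⟨γ⁻¹, γ • x, ⟨hγ, hΓR γ hx⟩, by simp⟩
    have hR0 : μ R = 0 := by
      refine measure_mono_null hRcov (measure_iUnion_null fun γ => ?_)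
      rw [(hμΓ γ _ inter_subset_right (hF.inter hRm)).2, hFRW, hzero]
    have hR1 : m (π '' R) = 0 := by
      rw [hμ R hRm, ENNReal.tsum_eq_zero] at hR0
      have : π '' R ⊆ ⋃ n, π '' (R ∩ E n) := by
        rintro _ ⟨x, hx, rfl⟩
        obtain ⟨n, hn⟩ := mem_iUnion.1 (hER.symm ▸ hx : x ∈ ⋃ n, E n)
        exact mem_iUnion.2 ⟨n, x, ⟨hx, hn⟩, rfl⟩
      exact measure_mono_null this (measure_iUnion_null hR0)
    have : π '' G ⊆ π '' R ∪ π '' (G \ W) := by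
      rintro _ ⟨x, hx, rfl⟩
      by_cases hxR : x ∈ R
      · exact Or.inl ⟨x, hxR, rfl⟩
      · exact Or.inr ⟨x, ⟨hx, fun h => hxR (hWR h)⟩, rfl⟩
    exact measure_mono_null this (measure_union_null hR1 hnull)
  have hfin' : μ (F ∩ W) < ⊤ := by
    have h1 : F ∩ W ⊆ ⋃ z ∈ t, (N z ∩ R) := by
      rintro x ⟨hx, hxW⟩
      obtain ⟨z, hz, hxz⟩ := mem_iUnion₂.1 (hFt hx)
      exact mem_iUnion₂.2 ⟨z, hz, hxz, hWR hxW⟩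
    refine (measure_mono h1).trans_lt ?_
    refine (measure_biUnion_finset_le t _).trans_lt (ENNReal.sum_lt_top.2 fun z hz => ?_)
    obtain ⟨k, hk⟩ := hNk z (htD z hz)
    obtain ⟨S, hS, hSfin, hSm⟩ := hNS z (htD z hz)
    refine (fibreMeasure_le hπ hE hEd hEinj hμ ((hNm z (htD z hz)).inter hRm) hS
      (hSm.mono_left inter_subset_left) (k := k) fun y s hs => hk y s fun x hx =>
        ⟨⟨hRG (hs x hx).1.2, (hs x hx).1.1⟩, (hs x hx).2⟩).trans_lt ?_
    exact ENNReal.mul_lt_top (ENNReal.natCast_lt_top k) hSfin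
  have hLF : μ (L '' (F ∩ W)) = c * μ (F ∩ W) :=
    (fibreMeasure_image hπ hE hEd hER hEinj hμ (hF.inter hWm) (inter_subset_right.trans hWR)
      (hLc.mono inter_subset_right) (hLinj.mono inter_subset_right)
      (hLR.mono_left inter_subset_right) (fun z hz => hLπ z hz.2) hmφ).2
  have hpack : μ (L '' (F ∩ W)) ≤ μ (F ∩ R) := by
    have hLm : MeasurableSet (L '' (F ∩ W)) :=
      (hF.inter hWm).image_of_continuousOn_injOn (hLc.mono inter_subset_right)
        (hLinj.mono inter_subset_right)
    set P : Γ → Set Z := fun γ => L '' (F ∩ W) ∩ (fun z => γ • z) ⁻¹' F with hP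
    have hPm : ∀ γ, MeasurableSet (P γ) := fun γ =>
      hLm.inter ((continuous_const_smul γ).measurable hF)
    have hPR : ∀ γ, P γ ⊆ R := by
      rintro γ _ ⟨⟨x, hx, rfl⟩, -⟩
      exact hLR hx.2
    have hPU : L '' (F ∩ W) ⊆ ⋃ γ, P γ := by
      rintro _ ⟨x, hx, rfl⟩
      obtain ⟨γ, hγ⟩ := hFcov (L x) (hGD (hRG (hLR hx.2)))
      exact mem_iUnion.2 ⟨γ, ⟨x, hx, rfl⟩, hγ⟩
    have hQd : Pairwise (Function.onFun Disjoint fun γ : Γ => (fun z => γ • z) '' P γ) := by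
      intro γ γ' hne
      refine disjoint_left.2 ?_
      rintro _ ⟨_, ⟨⟨x, hx, rfl⟩, hxF⟩, rfl⟩ ⟨_, ⟨⟨x', hx', rfl⟩, hxF'⟩, he⟩
      apply hne
      have h1 : L (γ' • x') = L (γ • x) := by
        rw [(hΓL γ' x' hx'.2).2, (hΓL γ x hx.2).2]
        exact he
      have h2 := hLinj (hΓL γ' x' hx'.2).1 (hΓL γ x hx.2).1 h1
      have h3 : (γ'⁻¹ * γ) • x = x' := by rw [mul_smul, ← h2, inv_smul_smul]
      have h4 := hFfree x hx.1 (γ'⁻¹ * γ) (h3 ▸ hx'.1)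
      exact (inv_mul_eq_one.1 h4).symm
    calc μ (L '' (F ∩ W)) ≤ μ (⋃ γ, P γ) := measure_mono hPU
      _ ≤ ∑' γ, μ (P γ) := measure_iUnion_le _
      _ = ∑' γ, μ ((fun z => γ • z) '' P γ) := by
          congr 1
          ext γ
          exact (hμΓ γ _ (hPR γ) (hPm γ)).2.symm
      _ = μ (⋃ γ, (fun z => γ • z) '' P γ) :=
          (measure_iUnion hQd fun γ => (hμΓ γ _ (hPR γ) (hPm γ)).1).symm
      _ ≤ μ (F ∩ R) := by
          refine measure_mono (iUnion_subset fun γ => ?_)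
          rintro _ ⟨x, hx, rfl⟩
          exact ⟨hx.2, hΓR γ (hPR γ hx)⟩
  rw [hLF, hFRW] at hpack
  have h5 : 1 * μ (F ∩ W) < c * μ (F ∩ W) := ENNReal.mul_lt_mul_left hpos' hfin'.ne hc
  rw [one_mul] at h5
  exact absurd hpack (not_le.2 h5)

end Packing

end

section

open Set Filter Topology Metric MeasureTheory

section NullSets

theorem LineHol.isOpen_ne {E : Type*} [NormedAddCommGroup E] [NormedSpace ℂ E] {d : E → ℂ}
    {P : Set E} (hP : IsOpen P) (hd : LineHol d P) : IsOpen {ζ | ζ ∈ P ∧ d ζ ≠ 0} :=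
  hd.1.isOpen_inter_preimage hP isOpen_compl_singleton

theorem LineHol.countable_zeros {E : Type*} [NormedAddCommGroup E] [NormedSpace ℂ E] {d : E → ℂ}
    {P : Set E} (hP : IsOpen P) (hPc : Convex ℝ P) (hd : LineHol d P) (a v : E)
    (hne : ∃ t : ℂ, a + t • v ∈ P ∧ d (a + t • v) ≠ 0) :
    {t : ℂ | a + t • v ∈ P ∧ d (a + t • v) = 0}.Countable := by
  have hW : IsOpen {t : ℂ | a + t • v ∈ P} := LineHol.isOpen_line hP a v
  have hWc : Convex ℝ {t : ℂ | a + t • v ∈ P} := by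
    intro x hx y hy α β hα hβ hαβ
    have : a + (α • x + β • y) • v = α • (a + x • v) + β • (a + y • v) := by
      have h1 : a = α • a + β • a := by rw [← add_smul, hαβ, one_smul]
      conv_lhs => rw [h1]
      simp only [add_smul, smul_add, smul_assoc]
      abel
    show a + (α • x + β • y) • v ∈ P
    rw [this]
    exact hPc hx hy hα hβ hαβ
  have han := (hd.differentiableOn_line a v).analyticOnNhd hW
  obtain ⟨t₀, ht₀, hne⟩ := hne
  obtain ⟨t, hts, htc, hcov⟩ := TopologicalSpace.countable_cover_nhdsWithin (f := fun x => {x})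
    (s := {t : ℂ | a + t • v ∈ P ∧ d (a + t • v) = 0}) (by
      rintro x ⟨hx, hx0⟩
      have h1 : ∀ᶠ t in 𝓝[≠] x, d (a + t • v) ≠ 0 := by
        refine (han x hx).eventually_eq_zero_or_eventually_ne_zero.resolve_left fun h => ?_
        exact hne (han.eqOn_zero_of_preconnected_of_eventuallyEq_zero hWc.isPreconnected hx h ht₀)
      rw [eventually_nhdsWithin_iff] at h1
      rw [mem_nhdsWithin_iff_eventually]
      filter_upwards [h1] with y hy hys
      by_contra hyx
      exact hy hyx hys.2)
  exact htc.mono (hcov.trans (by simp))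

variable {κ : Type*} [Fintype κ]

theorem volume_eq_zero_of_countable_lines {s : Set (κ → ℂ)} (hs : MeasurableSet s) (v : κ → ℂ)
    (h : ∀ y, {t : ℝ | y + t • v ∈ s}.Countable) : volume s = 0 := by
  have := ae_mem_of_ae_add_linearMap_mem (LinearMap.toSpanSingleton ℝ (κ → ℂ) v)
    (volume : Measure ℝ) (volume : Measure (κ → ℂ)) hs.compl (fun y => by
      rw [ae_iff]
      refine Set.Countable.measure_zero ?_ _
      simpa using h y)
  rw [ae_iff] at this
  simpa using this

theorem LineHol.volume_zeros {d : (κ → ℂ) → ℂ} {P : Set (κ → ℂ)} (hP : IsOpen P)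
    (hPc : Convex ℝ P) (hd : LineHol d P) (hne : ∃ ζ ∈ P, d ζ ≠ 0) :
    volume {ζ | ζ ∈ P ∧ d ζ = 0} = 0 := by
  have hO := hd.isOpen_ne hP
  have hZm : MeasurableSet {ζ | ζ ∈ P ∧ d ζ = 0} := by
    have : {ζ | ζ ∈ P ∧ d ζ = 0} = P \ {ζ | ζ ∈ P ∧ d ζ ≠ 0} := by
      ext ζ; simp only [Set.mem_ofPred_eq, Set.mem_sdiff]; tauto
    rw [this]
    exact hP.measurableSet.diff hO.measurableSet
  obtain ⟨S, hSc, hSd⟩ := TopologicalSpace.exists_countable_dense (κ → ℂ)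
  refine measure_mono_null (t := ⋃ v ∈ S, {ζ | ζ ∈ P ∧ d ζ = 0} ∩
    (fun ζ => ζ + v) ⁻¹' {ζ | ζ ∈ P ∧ d ζ ≠ 0}) ?_ ?_
  · rintro ζ hζ
    have hO' : IsOpen ((fun v => ζ + v) ⁻¹' {ζ | ζ ∈ P ∧ d ζ ≠ 0}) :=
      hO.preimage (by fun_prop)
    obtain ⟨ζ₁, h1, h2⟩ := hne
    obtain ⟨v, hv, hvS⟩ := hSd.inter_open_nonempty _ hO' ⟨ζ₁ - ζ, by simpa using ⟨h1, h2⟩⟩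
    exact mem_biUnion hvS ⟨hζ, hv⟩
  · rw [measure_biUnion_null_iff hSc]
    intro v hv
    refine volume_eq_zero_of_countable_lines (hZm.inter (hO.measurableSet.preimage
      (by fun_prop))) v fun y => ?_
    rcases Set.eq_empty_or_nonempty {t : ℝ | y + t • v ∈ {ζ | ζ ∈ P ∧ d ζ = 0} ∩
      (fun ζ => ζ + v) ⁻¹' {ζ | ζ ∈ P ∧ d ζ ≠ 0}} with h | ⟨t₀, -, ht₀⟩
    · rw [h]; exact countable_empty
    refine ((hd.countable_zeros hP hPc y v ⟨(t₀ + 1 : ℝ), ?_⟩).preimage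
      Complex.ofReal_injective).mono ?_
    · have : y + ((t₀ + 1 : ℝ) : ℂ) • v = y + t₀ • v + v := by
        rw [Complex.coe_smul, add_smul, one_smul, add_assoc]
      rw [this]
      exact ht₀
    · rintro t ⟨h1, -⟩
      simpa using h1

variable [DecidableEq κ]

/-- The flow contracting the imaginary part of the `j`-th coordinate. -/
def vflow (j : κ) (τ : ℝ) (ζ : κ → ℂ) : κ → ℂ :=
  Function.update ζ j ⟨(ζ j).re, Real.exp (-τ) * (ζ j).im⟩

theorem continuous_mk {X : Type*} [TopologicalSpace X] {f g : X → ℝ} (hf : Continuous f)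
    (hg : Continuous g) : Continuous fun x => (⟨f x, g x⟩ : ℂ) := by
  have : (fun x => (⟨f x, g x⟩ : ℂ)) = fun x => (f x : ℂ) + (g x : ℂ) * Complex.I := by
    ext x
    simp [Complex.ext_iff]
  rw [this]
  fun_prop

theorem continuous_vflow (j : κ) : Continuous (Function.uncurry (vflow j)) := by
  refine continuous_snd.update j (continuous_mk ?_ ?_)
  · exact Complex.continuous_re.comp ((continuous_apply j).comp continuous_snd)
  · exact (Real.continuous_exp.comp continuous_fst.neg).mul
      (Complex.continuous_im.comp ((continuous_apply j).comp continuous_snd))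

theorem vflow_zero (j : κ) (ζ : κ → ℂ) : vflow j 0 ζ = ζ := by
  simp [vflow]

theorem vflow_add (j : κ) (s t : ℝ) (ζ : κ → ℂ) : vflow j (s + t) ζ = vflow j s (vflow j t ζ) := by
  simp [vflow, Real.exp_add, mul_comm, mul_left_comm]

theorem vflow_injective (j : κ) {ζ : κ → ℂ} (h : (ζ j).im ≠ 0) :
    Function.Injective fun τ => vflow j τ ζ := by
  intro s t hst
  have := congrArg Complex.im (congrFun hst j)
  simpa [vflow, h] using this

theorem LineHol.volume_shadow {d : (κ → ℂ) → ℂ} {P : Set (κ → ℂ)} (hP : IsOpen P)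
    (hPc : Convex ℝ P) (hd : LineHol d P) (hne : ∃ ζ ∈ P, d ζ ≠ 0) (j : κ) {ε : ℝ} (hε : 0 ≤ ε) :
    volume {ζ | (∀ τ ∈ Icc 0 ε, vflow j τ ζ ∈ P) ∧ ∃ τ ∈ Icc 0 ε, d (vflow j τ ζ) = 0} = 0 := by
  have hO := hd.isOpen_ne hP
  have hopen : ∀ B : Set (κ → ℂ), IsOpen B → IsOpen {ζ | ∀ τ ∈ Icc 0 ε, vflow j τ ζ ∈ B} := by
    intro B hB
    rw [isOpen_iff_mem_nhds]
    intro ζ hζ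
    have := exists_mem_nhds_forall_Icc_notMem (continuous_vflow j) hB.isClosed_compl
      (y := ζ) (ε := ε) (by simpa using hζ)
    filter_upwards [this] with y hy τ hτ
    exact not_not.1 (hy τ hτ)
  set Sh := {ζ | (∀ τ ∈ Icc 0 ε, vflow j τ ζ ∈ P) ∧ ∃ τ ∈ Icc 0 ε, d (vflow j τ ζ) = 0} with hSh
  set N := {ζ | ζ ∈ P ∧ ∃ t, Function.update ζ j t ∈ {ζ | ζ ∈ P ∧ d ζ ≠ 0}} with hN
  have hNo : IsOpen N := by
    have : N = P ∩ ⋃ t, (fun ζ => Function.update ζ j t) ⁻¹' {ζ | ζ ∈ P ∧ d ζ ≠ 0} := by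
      ext ζ; simp [hN]
    rw [this]
    exact hP.inter (isOpen_iUnion fun t => hO.preimage (by fun_prop))
  have hShm : MeasurableSet Sh := by
    have : Sh = {ζ | ∀ τ ∈ Icc 0 ε, vflow j τ ζ ∈ P} \
        {ζ | ∀ τ ∈ Icc 0 ε, vflow j τ ζ ∈ {ζ | ζ ∈ P ∧ d ζ ≠ 0}} := by
      ext ζ
      simp only [hSh, Set.mem_ofPred_eq, Set.mem_sdiff]
      refine and_congr_right fun h => ?_
      push Not
      exact exists_congr fun τ => and_congr_right fun hτ => by simp [h τ hτ]
    rw [this]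
    exact (hopen P hP).measurableSet.diff (hopen _ hO).measurableSet
  have hShP : Sh ⊆ P := fun ζ hζ => by
    simpa [vflow_zero] using hζ.1 0 ⟨le_rfl, hε⟩
  refine measure_mono_null (t := {ζ | ζ ∈ P ∧ d ζ = 0} ∪ Sh ∩ N) ?_
    (measure_union_null (hd.volume_zeros hP hPc hne) ?_)
  · intro ζ hζ
    by_cases hζN : ζ ∈ N
    · exact Or.inr ⟨hζ, hζN⟩
    · refine Or.inl ⟨hShP hζ, ?_⟩
      by_contra h
      exact hζN ⟨hShP hζ, ζ j, by simpa using ⟨hShP hζ, h⟩⟩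
  · refine volume_eq_zero_of_countable_lines (hShm.inter hNo.measurableSet) (Pi.single j 1)
      fun y => ?_
    rcases Set.eq_empty_or_nonempty {t : ℝ | y + t • (Pi.single j 1 : κ → ℂ) ∈ Sh ∩ N} with
      h | ⟨t₀, -, -, t₁, ht₁⟩
    · rw [h]; exact countable_empty
    have hupd : ∀ (t : ℝ) (w : ℂ), Function.update (y + t • (Pi.single j 1 : κ → ℂ)) j w =
        Function.update y j 0 + w • Pi.single j 1 := by
      intro t w
      rw [← update_eq_add_smul]
      ext i
      by_cases hi : i = j
      · subst hi; simp
      · simp [hi]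
    rw [hupd] at ht₁
    refine (((hd.countable_zeros hP hPc (Function.update y j 0) (Pi.single j 1)
      ⟨t₁, ht₁⟩).image Complex.re).preimage (add_right_injective (y j).re)).mono ?_
    rintro t ⟨⟨h1, τ, hτ, h2⟩, -⟩
    have h3 := h1 τ hτ
    rw [vflow, hupd] at h2 h3
    exact ⟨_, ⟨h3, h2⟩, by simp⟩

end NullSets

end

section

open Set Filter Topology Metric MeasureTheory

section LocalStructure

variable {ι : Type*} [Fintype ι] [DecidableEq ι] {D : Set (ι → ℂ)} {I : Finset ι}
  {G : Set (ι → ℂ)}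

/-- Extension of a point of `I → ℂ` by the coordinates of `p`. -/
def extendBy (I : Finset ι) (p : ι → ℂ) (ζ : I → ℂ) : ι → ℂ :=
  fun i => if h : i ∈ I then ζ ⟨i, h⟩ else p i

theorem extendBy_restrict (I : Finset ι) (p q : ι → ℂ) (i : ι) :
    extendBy I p (I.restrict q) i = if i ∈ I then q i else p i := by
  by_cases h : i ∈ I <;> simp [extendBy, h]

theorem update_extendBy_continuous (I : Finset ι) (p : ι → ℂ) (l : ι) :
    Continuous fun z : (I → ℂ) × ℂ => Function.update (extendBy I p z.1) l z.2 := by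
  refine Continuous.update (continuous_pi fun i => ?_) l continuous_snd
  by_cases h : i ∈ I
  · simp only [extendBy, h, dif_pos]
    fun_prop
  · simpa only [extendBy, h, dif_neg, not_false_eq_true] using continuous_const

theorem LineHol.comp_extendBy {f : (ι → ℂ) → ℂ} {V : Set (ι → ℂ)} (hf : LineHol f V)
    (I : Finset ι) (p : ι → ℂ) (l : ι) :
    LineHol (fun z : (I → ℂ) × ℂ => f (Function.update (extendBy I p z.1) l z.2))
      {z | Function.update (extendBy I p z.1) l z.2 ∈ V} := by
  refine hf.comp_affine (L := fun z : (I → ℂ) × ℂ => Function.update (extendBy I p z.1) l z.2)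
    (update_extendBy_continuous I p l)
    (fun a v => ⟨Function.update (extendBy I 0 v.1) l v.2, fun t => ?_⟩) fun z hz => hz
  ext i
  by_cases hi : i = l
  · subst hi; simp
  · by_cases h : i ∈ I <;> simp [hi, extendBy, h]

theorem DependsOn.update_extendBy {f : (ι → ℂ) → ℂ} {l : ι}
    (hf : DependsOn f (insert l I : Finset ι)) (p q : ι → ℂ) :
    f (Function.update (extendBy I p (I.restrict q)) l (q l)) = f q := by
  refine hf fun i hi => ?_
  by_cases hil : i = l
  · subst hil; simp
  · have : i ∈ I := by simpa [hil] using hi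
    simp [hil, extendBy_restrict, this]

theorem Good.exists_regular_nhds (hD : IsOpen D) (h : Good D I G) {p : ι → ℂ} (hp : p ∈ G) :
    ∃ r > 0, closedBall p r ⊆ D ∧ ∃ ρ > 0,
      (∀ q ∈ G, q ∈ closedBall p r → I.restrict q ∈ ball (I.restrict p) ρ → q ∈ ball p r) ∧
      (∃ k : ℕ, ∀ y ∈ ball (I.restrict p) ρ, ∀ s : Finset (ι → ℂ),
        (∀ x ∈ s, x ∈ G ∧ x ∈ ball p r ∧ I.restrict x = y) → s.card ≤ k) ∧
      ∃ d : ι → (I → ℂ) → ℂ,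
        (∀ l, LineHol (d l) (ball (I.restrict p) ρ) ∧ ∃ ζ ∈ ball (I.restrict p) ρ, d l ζ ≠ 0) ∧
        ∀ x ∈ G, x ∈ ball p r → I.restrict x ∈ ball (I.restrict p) ρ →
          (∀ l, d l (I.restrict x) ≠ 0) → x ∈ regularPart I.restrict G := by
  choose f V hV hpV hf hdep hX hfr using h.int p hp
  have hO : ∀ᶠ q in 𝓝 p, ∀ l, ∀ hl : l ∉ I, q ∈ V l hl ∧
      (q l ≠ p l → f l hl (Function.update p l (q l)) ≠ 0) := by
    rw [Filter.eventually_all]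
    intro l
    by_cases hl : l ∈ I
    · exact Eventually.of_forall fun q hl' => absurd hl hl'
    · have h1 := (hf l hl).update_eventually_ne (hV l hl) (hpV l hl) (hfr l hl)
      rw [eventually_nhdsWithin_iff] at h1
      filter_upwards [(continuous_apply l).continuousAt.eventually h1, (hV l hl).mem_nhds (hpV l hl)]
        with q h2 h3 _
      exact ⟨h3, h2⟩
  obtain ⟨r, hr, hrO, ρ₀, hρ₀, -, -, hprop, -⟩ := h.exists_model hD hp hO
  have hupd : ∀ l, ∀ w ∈ closedBall (p l) r, Function.update p l w ∈ closedBall p r := by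
    intro l w hw
    rw [mem_closedBall, dist_pi_le_iff hr.le]
    intro i
    by_cases hi : i = l
    · subst hi; simpa using hw
    · simpa [hi] using hr.le
  have hext : ∀ l w, Function.update (extendBy I p (I.restrict p)) l w = Function.update p l w := by
    intro l w
    congr 1
    ext i
    simp [extendBy_restrict]
  have htube : ∀ l, ∃ ρ > 0, ∀ hl : l ∉ I, ball (I.restrict p) ρ ×ˢ closedBall (p l) r ⊆
      {z | Function.update (extendBy I p z.1) l z.2 ∈ V l hl} ∧
      ∀ ζ' ∈ ball (I.restrict p) ρ, ∀ w ∈ sphere (p l) r,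
        f l hl (Function.update (extendBy I p ζ') l w) ≠ 0 := by
    intro l
    by_cases hl : l ∈ I
    · exact ⟨1, one_pos, fun hl' => absurd hl hl'⟩
    obtain ⟨ρ, hρ, h1, h2⟩ := exists_tube
      ((hV l hl).preimage (update_extendBy_continuous I p l)) ((hf l hl).comp_extendBy I p l).1
      (ζ := I.restrict p) (c := p l) (r := r) (by
        intro w hw
        show Function.update (extendBy I p (I.restrict p)) l w ∈ V l hl
        rw [hext]
        exact ((hrO (hupd l w hw)).1 l hl).1) (by
        intro w hw
        show f l hl (Function.update (extendBy I p (I.restrict p)) l w) ≠ 0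
        rw [hext]
        have h3 := ((hrO (hupd l w (sphere_subset_closedBall hw))).1 l hl).2
        rw [Function.update_self] at h3
        exact h3 (ne_of_mem_sphere hw hr.ne'))
    exact ⟨ρ, hρ, fun _ => ⟨h1, h2⟩⟩
  choose ρ₁ hρ₁ htube using htube
  obtain ⟨ρ, hρ, hρle⟩ : ∃ ρ > 0, ρ ≤ ρ₀ ∧ ∀ l, ρ ≤ ρ₁ l := by
    have : ∀ᶠ ρ in 𝓝[>] (0 : ℝ), ρ ≤ ρ₀ ∧ ∀ l, ρ ≤ ρ₁ l := by
      refine Filter.Eventually.and ?_ (Filter.eventually_all.2 fun l => ?_)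
      · exact mem_nhdsWithin_of_mem_nhds (Iic_mem_nhds hρ₀)
      · exact mem_nhdsWithin_of_mem_nhds (Iic_mem_nhds (hρ₁ l))
    obtain ⟨ρ, h1, h2⟩ := (this.and self_mem_nhdsWithin).exists
    exact ⟨ρ, h2, h1⟩
  have hsub : ∀ l, ∀ hl : l ∉ I, ball (I.restrict p) ρ ×ˢ closedBall (p l) r ⊆
      {z | Function.update (extendBy I p z.1) l z.2 ∈ V l hl} := fun l hl =>
    (Set.prod_mono (ball_subset_ball (hρle.2 l)) le_rfl).trans (htube l hl).1
  have hne : ∀ l, ∀ hl : l ∉ I, ∀ ζ' ∈ ball (I.restrict p) ρ, ∀ w ∈ sphere (p l) r,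
        f l hl (Function.update (extendBy I p ζ') l w) ≠ 0 := fun l hl ζ' hζ' =>
    (htube l hl).2 ζ' (ball_subset_ball (hρle.2 l) hζ')
  have hroots : ∀ l, ∃ (n : ℕ) (y : (I → ℂ) → Fin n → ℂ), ∀ x ∈ G, x ∈ ball p r →
      I.restrict x ∈ ball (I.restrict p) ρ → l ∉ I → ∃ i, y (I.restrict x) i = x l := by
    intro l
    by_cases hl : l ∈ I
    · exact ⟨0, fun _ _ => 0, fun x _ _ _ hl' => absurd hl hl'⟩
    obtain ⟨n, y, hy⟩ := ((hf l hl).comp_extendBy I p l).exists_roots isOpen_ball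
      (convex_ball _ _).isPreconnected ((hV l hl).preimage (update_extendBy_continuous I p l)) hr
      (hsub l hl) (hne l hl)
    refine ⟨n, y, fun x hx hxr hxρ _ => ((hy _ hxρ).2.1 (x l) ?_).1 ?_⟩
    · exact (dist_le_pi_dist x p l).trans_lt hxr
    · show f l hl _ = 0
      rw [(hdep l hl).update_extendBy]
      exact hX l hl x hx ((hrO (ball_subset_closedBall hxr)).1 l hl).1
  choose n y hy using hroots
  have hdisc : ∀ l, ∃ d : (I → ℂ) → ℂ, (LineHol d (ball (I.restrict p) ρ) ∧
      ∃ ζ ∈ ball (I.restrict p) ρ, d ζ ≠ 0) ∧ ∀ x ∈ G, x ∈ ball p r →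
        I.restrict x ∈ ball (I.restrict p) ρ → d (I.restrict x) ≠ 0 → l ∉ I →
        ∃ O ∈ 𝓝 x, ∀ a ∈ G, a ∈ O → ∀ b ∈ G, b ∈ O → I.restrict a = I.restrict b → a l = b l := by
    intro l
    by_cases hl : l ∈ I
    · exact ⟨fun _ => 1, ⟨LineHol.const 1, _, mem_ball_self hρ, one_ne_zero⟩,
        fun x _ _ _ _ hl' => absurd hl hl'⟩
    obtain ⟨d, hd, hd0, hdu⟩ := ((hf l hl).comp_extendBy I p l).exists_discriminant isOpen_ball
      (convex_ball _ _).isPreconnected ((hV l hl).preimage (update_extendBy_continuous I p l)) hr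
      (hsub l hl) (hne l hl) ⟨_, mem_ball_self hρ⟩
    refine ⟨d, ⟨hd, hd0⟩, fun x hx hxr hxρ hdx _ => ?_⟩
    have hzero : ∀ a ∈ G, a ∈ V l hl →
        f l hl (Function.update (extendBy I p (I.restrict a)) l (a l)) = 0 := by
      intro a ha haV
      rw [(hdep l hl).update_extendBy]
      exact hX l hl a ha haV
    obtain ⟨O, hO, hOu⟩ := hdu _ hxρ hdx (x l) ((dist_le_pi_dist x p l).trans_lt hxr)
      (hzero x hx ((hrO (ball_subset_closedBall hxr)).1 l hl).1)
    have hcont : Continuous fun a : ι → ℂ => (I.restrict a, a l) :=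
      (Finset.continuous_restrict I).prodMk (continuous_apply l)
    refine ⟨(fun a : ι → ℂ => (I.restrict a, a l)) ⁻¹' O ∩ V l hl,
      Filter.inter_mem (hcont.continuousAt hO)
        ((hV l hl).mem_nhds ((hrO (ball_subset_closedBall hxr)).1 l hl).1), ?_⟩
    rintro a ha ⟨haO, haV⟩ b hb ⟨hbO, hbV⟩ hab
    exact congrArg Prod.snd (hOu _ haO _ hbO hab (hzero a ha haV) (hzero b hb hbV))
  choose d hd hdu using hdisc
  refine ⟨r, hr, fun x hx => (hrO hx).2, ρ, hρ, ?_, ?_, d, hd, ?_⟩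
  · intro q hq hqr hqρ
    refine ball_subset_ball (by linarith) (hprop q hq hqr fun i hi => ?_)
    exact ((dist_le_pi_dist (I.restrict q) (I.restrict p) ⟨i, hi⟩).trans_lt hqρ).trans_le hρle.1
  · refine ⟨Fintype.card (∀ l : {l // l ∉ I}, Fin (n l)), fun y₀ hy₀ s hs => ?_⟩
    have hi : ∀ (x : s) (l : {l // l ∉ I}), ∃ i, y l y₀ i = (x : ι → ℂ) l := by
      intro x l
      obtain ⟨h1, h2, h3⟩ := hs x x.2
      subst h3
      exact hy l x h1 h2 hy₀ l.2
    choose i hi using hi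
    rw [← Fintype.card_coe]
    refine Fintype.card_le_of_injective i fun a b hab => ?_
    ext l
    by_cases hl : l ∈ I
    · exact congrFun ((hs a a.2).2.2.trans (hs b b.2).2.2.symm) ⟨l, hl⟩
    · rw [← hi a ⟨l, hl⟩, ← hi b ⟨l, hl⟩, hab]
  · intro x hx hxr hxρ hdx
    choose O hO hOu using fun l : {l // l ∉ I} => hdu l x hx hxr hxρ (hdx l) l.2
    have h1 : (⋂ l, O l) ∈ 𝓝 x := Filter.iInter_mem.2 hO
    obtain ⟨O', hO'sub, hO', hxO'⟩ := _root_.mem_nhds_iff.1 h1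
    refine ⟨hx, O', hO', hxO', ?_⟩
    rintro a ⟨ha, haO⟩ b ⟨hb, hbO⟩ hab
    ext l
    by_cases hl : l ∈ I
    · exact congrFun hab ⟨l, hl⟩
    · exact hOu ⟨l, hl⟩ a ha (mem_iInter.1 (hO'sub haO) _) b hb (mem_iInter.1 (hO'sub hbO) _) hab

end LocalStructure

end

section

open Set Filter Topology Metric MeasureTheory

section PathLifting

variable {Z Y : Type*} [MetricSpace Z] [TopologicalSpace Y] [T2Space Y]
  {π : Z → Y} {φ : ℝ → Y → Y} {G B B' : Set Z} {ε : ℝ}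

theorem mem_transportable_of_proper (hπ : Continuous π) (hφ : Continuous (Function.uncurry φ))
    (h0 : ∀ y, φ 0 y = y) (hadd : ∀ s t y, φ (s + t) y = φ s (φ t y))
    (hlift : ∀ p ∈ G, ∀ O ∈ 𝓝 p, ∀ᶠ τ in 𝓝 (0 : ℝ), ∃ q ∈ G, q ∈ O ∧ π q = φ τ (π p))
    (hε : 0 < ε) (hB : IsCompact (G ∩ B)) (hB' : IsOpen B') (hB'B : B' ⊆ B) {q : Z} (hq : q ∈ G)
    (hqB : q ∈ B)
    (hprop : ∀ τ ∈ Icc 0 ε, ∀ x ∈ G, x ∈ B → π x = φ τ (π q) → x ∈ B' ∧ x ∈ regularPart π G) :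
    q ∈ transportable π φ G ε := by
  set K : Set (Icc (0 : ℝ) ε × Z) := {e | e.2 ∈ G ∩ B ∧ π e.2 = φ e.1 (π q)} with hK
  have hKc : IsCompact K := by
    have h1 : K = ((univ : Set (Icc (0 : ℝ) ε)) ×ˢ (G ∩ B)) ∩ {e | π e.2 = φ e.1 (π q)} := by
      ext e; simp [hK]
    rw [h1]
    refine (isCompact_univ.prod hB).inter_right (isClosed_eq (by fun_prop) ?_)
    exact hφ.comp ((continuous_subtype_val.comp continuous_fst).prodMk continuous_const)
  have : CompactSpace K := isCompact_iff_compactSpace.1 hKc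
  set t : K → Icc (0 : ℝ) ε := fun e => e.1.1 with ht
  have htc : Continuous t := by fun_prop
  have hopen : IsOpenMap t := by
    rw [isOpenMap_iff_nhds_le]
    rintro ⟨⟨τ, x⟩, ⟨hxG, hxB⟩, hx⟩
    intro N hN
    rw [Filter.mem_map, mem_nhds_subtype] at hN
    obtain ⟨u, hu, huN⟩ := hN
    rw [nhds_prod_eq, mem_prod_iff] at hu
    obtain ⟨T, hT, O, hO, hTO⟩ := hu
    have hxB' := (hprop τ τ.2 x hxG hxB hx).1
    have h1 := hlift x hxG (O ∩ B') (Filter.inter_mem hO (hB'.mem_nhds hxB'))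
    have h2 : Tendsto (fun σ : Icc (0 : ℝ) ε => (σ : ℝ) - τ) (𝓝 τ) (𝓝 0) := by
      have : Continuous fun σ : Icc (0 : ℝ) ε => (σ : ℝ) - τ := by fun_prop
      simpa using this.tendsto τ
    show N ∈ 𝓝 τ
    filter_upwards [h2.eventually h1, hT] with σ ⟨x', hx'G, ⟨hx'O, hx'B⟩, hx'⟩ hσ
    have h3 : π x' = φ σ (π q) := by
      simp only at hx
      rw [hx', hx, ← hadd, sub_add_cancel]
    exact huN (show (⟨(σ, x'), ⟨hx'G, hB'B hx'B⟩, h3⟩ : K) ∈ _ from hTO ⟨hσ, hx'O⟩)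
  have hloc : IsLocalHomeomorph t := by
    rw [isLocalHomeomorph_iff_isOpenEmbedding_restrict]
    rintro ⟨⟨τ, x⟩, ⟨hxG, hxB⟩, hx⟩
    obtain ⟨-, O, hO, hxO, hinj⟩ := (hprop τ τ.2 x hxG hxB hx).2
    have hU : IsOpen {e : K | e.1.2 ∈ O} := hO.preimage (by fun_prop)
    refine ⟨{e : K | e.1.2 ∈ O}, hU.mem_nhds hxO, ?_⟩
    refine IsOpenEmbedding.of_continuous_injective_isOpenMap (htc.comp continuous_subtype_val) ?_
      (hopen.domRestrict hU)
    rintro ⟨⟨⟨σ, a⟩, ⟨haG, haB⟩, ha⟩, haO⟩ ⟨⟨⟨σ', b⟩, ⟨hbG, hbB⟩, hb⟩, hbO⟩ hab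
    have h1 : σ = σ' := hab
    subst h1
    have h2 : a = b := hinj ⟨haG, haO⟩ ⟨hbG, hbO⟩ (ha.trans hb.symm)
    subst h2
    rfl
  have hcov : IsCoveringMap t := isLocalHomeomorph_iff_isCoveringMap.1 hloc
  obtain ⟨c, hc, hc0⟩ := hcov.exists_path_lifts
    ⟨fun s : unitInterval => (⟨ε * s, mul_nonneg hε.le s.2.1,
      mul_le_of_le_one_right hε.le s.2.2⟩ : Icc (0 : ℝ) ε), by fun_prop⟩
    ⟨(⟨0, le_rfl, hε.le⟩, q), ⟨hq, hqB⟩, by simp [h0]⟩ (by simp [ht])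
  have hct : ∀ s : unitInterval, ((c s).1.1 : ℝ) = ε * s := fun s =>
    congrArg Subtype.val (congrFun hc s)
  set c' : ℝ → Z := fun τ => (c (projIcc 0 1 zero_le_one (τ / ε))).1.2 with hc'
  have hc'0 : c' 0 = q := by
    have h1 : projIcc (0 : ℝ) 1 zero_le_one 0 = 0 := by
      rw [projIcc_left]; rfl
    rw [hc']
    simp only [zero_div, h1, hc0]
  have hc't : ∀ τ ∈ Icc 0 ε, c' τ ∈ G ∩ B ∧ π (c' τ) = φ τ (π q) := by
    intro τ hτ
    have h1 := (c (projIcc 0 1 zero_le_one (τ / ε))).2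
    have h2 := hct (projIcc 0 1 zero_le_one (τ / ε))
    rw [projIcc_of_mem zero_le_one (show τ / ε ∈ Icc (0 : ℝ) 1 from
      ⟨div_nonneg hτ.1 hε.le, div_le_one_of_le₀ hτ.2 hε.le⟩)] at h2
    rw [mul_div_cancel₀ _ hε.ne'] at h2
    refine ⟨h1.1, ?_⟩
    have h3 := h1.2
    rw [projIcc_of_mem zero_le_one (show τ / ε ∈ Icc (0 : ℝ) 1 from
      ⟨div_nonneg hτ.1 hε.le, div_le_one_of_le₀ hτ.2 hε.le⟩), h2] at h3
    rw [hc']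
    simp only
    rwa [projIcc_of_mem zero_le_one (show τ / ε ∈ Icc (0 : ℝ) 1 from
      ⟨div_nonneg hτ.1 hε.le, div_le_one_of_le₀ hτ.2 hε.le⟩)]
  refine ⟨c', ⟨?_, fun τ hτ => ?_, fun τ hτ => ?_⟩, hc'0⟩
  · exact Continuous.continuousOn (by fun_prop)
  · exact (hprop τ hτ _ (hc't τ hτ).1.1 (hc't τ hτ).1.2 (hc't τ hτ).2).2
  · rw [hc'0]; exact (hc't τ hτ).2

end PathLifting

section Null

variable {ι : Type*} [Fintype ι] [DecidableEq ι] {D : Set (ι → ℂ)} {I : Finset ι}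
  {G : Set (ι → ℂ)}

theorem Good.isCompact_inter (h : Good D I G) {K : Set (ι → ℂ)} (hK : IsCompact K) (hKD : K ⊆ D) :
    IsCompact (G ∩ K) := by
  have h1 : G ∩ K = K ∩ closure G :=
    subset_antisymm (fun x hx => ⟨hx.2, subset_closure hx.1⟩)
      fun x hx => ⟨h.closed x (hKD hx.1) hx.2, hx.1⟩
  rw [h1]
  exact hK.inter_right isClosed_closure

theorem Good.exists_nhds_null (hD : IsOpen D) (h : Good D I G) (j : I)
    (hlift : ∀ p ∈ G, ∀ O ∈ 𝓝 p, ∀ᶠ τ in 𝓝 (0 : ℝ), ∃ q ∈ G, q ∈ O ∧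
      I.restrict q = vflow j τ (I.restrict p)) {p : ι → ℂ} (hp : p ∈ G) :
    ∃ O ∈ 𝓝 p, ∃ ε₀ > 0, ∀ ε, 0 < ε → ε ≤ ε₀ →
      volume (I.restrict '' ((G ∩ O) \ transportable I.restrict (vflow j) G ε)) = 0 := by
  obtain ⟨r, hr, hrD, ρ, hρ, hprop, -, d, hd, hreg⟩ := h.exists_regular_nhds hD hp
  have hres : Continuous (I.restrict : (ι → ℂ) → I → ℂ) := Finset.continuous_restrict I
  have h1 : ∀ᶠ z : ℝ × (ι → ℂ) in 𝓝 (0, p), vflow j z.1 (I.restrict z.2) ∈ ball (I.restrict p) ρ := by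
    have hc : Continuous fun z : ℝ × (ι → ℂ) => vflow j z.1 (I.restrict z.2) :=
      (continuous_vflow j).comp (continuous_fst.prodMk (hres.comp continuous_snd))
    refine hc.continuousAt.eventually (isOpen_ball.mem_nhds ?_)
    show vflow j 0 (I.restrict p) ∈ _
    rw [vflow_zero]
    exact mem_ball_self hρ
  rw [nhds_prod_eq, eventually_prod_iff] at h1
  obtain ⟨pa, hpa, pb, hpb, hab⟩ := h1
  obtain ⟨ε₀, hε₀, hball⟩ := Metric.eventually_nhds_iff_ball.1 hpa
  refine ⟨{q | pb q} ∩ ball p r, Filter.inter_mem hpb (ball_mem_nhds p hr), ε₀ / 2, half_pos hε₀,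
    fun ε hε hεε => ?_⟩
  refine measure_mono_null (t := ⋃ l, {ζ | (∀ τ ∈ Icc 0 ε, vflow j τ ζ ∈ ball (I.restrict p) ρ) ∧
    ∃ τ ∈ Icc 0 ε, d l (vflow j τ ζ) = 0}) ?_ (measure_iUnion_null fun l =>
      (hd l).1.volume_shadow isOpen_ball (convex_ball _ _) (hd l).2 j hε.le)
  rintro _ ⟨q, ⟨⟨hqG, hqp, hqr⟩, hqW⟩, rfl⟩
  have hin : ∀ τ ∈ Icc 0 ε, vflow j τ (I.restrict q) ∈ ball (I.restrict p) ρ := by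
    intro τ hτ
    refine hab (hball τ ?_) hqp
    rw [mem_ball, dist_zero_right, Real.norm_of_nonneg hτ.1]
    linarith [hτ.2]
  by_contra hnot
  simp only [mem_iUnion, Set.mem_ofPred_eq, not_exists, not_and] at hnot
  refine hqW (mem_transportable_of_proper hres (continuous_vflow j) (vflow_zero j) (vflow_add j)
    hlift hε (h.isCompact_inter (isCompact_closedBall p r) hrD) isOpen_ball ball_subset_closedBall
    hqG (ball_subset_closedBall hqr) fun τ hτ x hxG hxB hx => ?_)
  have hxρ : I.restrict x ∈ ball (I.restrict p) ρ := hx ▸ hin τ hτ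
  have hxb := hprop x hxG hxB hxρ
  refine ⟨hxb, hreg x hxG hxb hxρ fun l => ?_⟩
  rw [hx]
  exact hnot l hin τ hτ

theorem Good.exists_null {Γ : Type*} [Group Γ] [Countable Γ] [MulAction Γ (ι → ℂ)]
    [ContinuousConstSMul Γ (ι → ℂ)] (hD : IsOpen D) (h : Good D I G) (j : I)
    (hlift : ∀ p ∈ G, ∀ O ∈ 𝓝 p, ∀ᶠ τ in 𝓝 (0 : ℝ), ∃ q ∈ G, q ∈ O ∧
      I.restrict q = vflow j τ (I.restrict p))
    (hΓG : ∀ γ : Γ, ∀ z ∈ G, γ • z ∈ G)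
    {C : Set (ι → ℂ)} (hC : IsCompact C) (hCD : C ⊆ D) (hcov : ∀ z ∈ D, ∃ γ : Γ, γ • z ∈ C)
    {ψ : Γ → (I → ℂ) → (I → ℂ)} (hψ : ∀ (γ : Γ) (z : ι → ℂ), I.restrict (γ • z : ι → ℂ) = ψ γ (I.restrict z))
    (hψinj : ∀ γ : Γ, Function.Injective (ψ γ))
    (hψφ : ∀ γ : Γ, ∀ z τ, vflow j τ (ψ γ z) = ψ γ (vflow j τ z))
    {m : Measure (I → ℂ)} (hmv : m ≪ volume)
    (hm : ∀ γ : Γ, ∀ B, MeasurableSet B → m (ψ γ '' B) = m B) :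
    ∃ ε > 0, m (I.restrict '' (G \ transportable I.restrict (vflow j) G ε)) = 0 := by
  have hres : Continuous (I.restrict : (ι → ℂ) → I → ℂ) := Finset.continuous_restrict I
  choose! O hO ε₀ hε₀ hnull using fun p (hp : p ∈ G) => h.exists_nhds_null hD j hlift hp
  obtain ⟨t, ht, htcov⟩ := (h.isCompact_inter hC hCD).elim_nhds_subcover O
    fun p hp => hO p hp.1
  obtain ⟨ε, hε, hεle⟩ : ∃ ε > 0, ∀ p ∈ t, ε ≤ ε₀ p := by
    have : ∀ᶠ ε in 𝓝[>] (0 : ℝ), ∀ p ∈ t, ε ≤ ε₀ p := by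
      refine (Filter.eventually_all_finset t).2 fun p hp => ?_
      exact mem_nhdsWithin_of_mem_nhds (Iic_mem_nhds (hε₀ p (ht p hp).1))
    obtain ⟨ε, h1, h2⟩ := (this.and self_mem_nhdsWithin).exists
    exact ⟨ε, h2, h1⟩
  refine ⟨ε, hε, ?_⟩
  set W := transportable I.restrict (vflow j) G ε with hW
  have hN : m (I.restrict '' ((G ∩ C) \ W)) = 0 := by
    refine hmv (measure_mono_null (t := ⋃ p ∈ t, I.restrict '' ((G ∩ O p) \ W)) ?_ ?_)
    · rintro _ ⟨q, ⟨⟨hqG, hqC⟩, hqW⟩, rfl⟩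
      obtain ⟨p, hp, hqp⟩ := mem_iUnion₂.1 (htcov ⟨hqG, hqC⟩)
      exact mem_biUnion hp ⟨q, ⟨⟨hqG, hqp⟩, hqW⟩, rfl⟩
    · refine (measure_biUnion_null_iff t.countable_toSet).2 ?_
      exact fun p hp => hnull p (ht p hp).1 ε hε (hεle p hp)
  refine measure_mono_null (t := ⋃ γ : Γ, ψ γ '' (toMeasurable m (I.restrict '' ((G ∩ C) \ W))))
    ?_ (measure_iUnion_null fun γ => ?_)
  · rintro _ ⟨q, ⟨hqG, hqW⟩, rfl⟩
    obtain ⟨γ, hγ⟩ := hcov q (h.sub hqG)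
    refine mem_iUnion.2 ⟨γ⁻¹, I.restrict (γ • q : ι → ℂ), subset_toMeasurable _ _
      ⟨γ • q, ⟨⟨hΓG γ q hqG, hγ⟩, fun hγW => hqW ?_⟩, rfl⟩, ?_⟩
    · obtain ⟨c, hc, hc0⟩ := hγW
      refine ⟨_, hc.map (T := Homeomorph.smul γ⁻¹) (ψ := ψ γ⁻¹) (fun z => ⟨fun hz => ?_,
        hΓG γ⁻¹ z⟩) (hψ γ⁻¹) (hψinj _) (fun z _ τ => hψφ _ _ τ) hε.le, ?_⟩
      · simpa using hΓG γ _ hz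
      · simp [hc0]
    · rw [← hψ, inv_smul_smul]
  · rw [hm γ _ (measurableSet_toMeasurable _ _), measure_toMeasurable, hN]

end Null

end

section

open Set Filter Topology Metric MeasureTheory

section HyperbolicMeasure

variable {κ : Type*} [Fintype κ]

/-- The real-linear endomorphism of `ℂ` scaling real and imaginary parts. -/
def scaleReIm (a d : ℝ) : ℂ →ₗ[ℝ] ℂ :=
  Matrix.toLin Complex.basisOneI Complex.basisOneI (Matrix.diagonal ![a, d])

theorem scaleReIm_apply (a d : ℝ) (z : ℂ) : scaleReIm a d z = ⟨a * z.re, d * z.im⟩ := by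
  rw [scaleReIm, Matrix.toLin_apply]
  apply Complex.ext <;> simp [Matrix.mulVec_diagonal, mul_comm]

theorem det_scaleReIm (a d : ℝ) : LinearMap.det (scaleReIm a d) = a * d := by
  rw [scaleReIm, LinearMap.det_toLin, Matrix.det_diagonal]
  simp

/-- Coordinatewise scaling of real and imaginary parts followed by a translation. -/
def scaleMap (a d : κ → ℝ) (b : κ → ℂ) (ζ : κ → ℂ) : κ → ℂ :=
  fun i => scaleReIm (a i) (d i) (ζ i) + b i

theorem continuous_scaleMap (a d : κ → ℝ) (b : κ → ℂ) : Continuous (scaleMap a d b) := by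
  refine continuous_pi fun i => ((scaleReIm (a i) (d i)).continuous_of_finiteDimensional.comp
    (continuous_apply i)).add continuous_const

theorem scaleMap_injective {a d : κ → ℝ} (ha : ∀ i, 0 < a i) (hd : ∀ i, 0 < d i) (b : κ → ℂ) :
    Function.Injective (scaleMap a d b) := by
  intro ζ ξ h
  ext i
  have := congrFun h i
  simp only [scaleMap, scaleReIm_apply, add_left_inj, Complex.mk.injEq,
    mul_right_inj' (ha i).ne', mul_right_inj' (hd i).ne'] at this
  exact Complex.ext this.1 this.2

theorem map_scaleMap {a d : κ → ℝ} (ha : ∀ i, 0 < a i) (hd : ∀ i, 0 < d i) (b : κ → ℂ) :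
    Measure.map (scaleMap a d b) volume =
      ENNReal.ofReal (∏ i, a i * d i)⁻¹ • (volume : Measure (κ → ℂ)) := by
  have hpos : 0 < ∏ i, a i * d i := Finset.prod_pos fun i _ => mul_pos (ha i) (hd i)
  set L : (κ → ℂ) →ₗ[ℝ] (κ → ℂ) :=
    LinearMap.pi fun i => (scaleReIm (a i) (d i)).comp (LinearMap.proj i) with hL
  have hdet : LinearMap.det L = ∏ i, a i * d i := by
    rw [hL, LinearMap.det_pi]
    simp [det_scaleReIm]
  have h1 : scaleMap a d b = (fun ζ => ζ + b) ∘ L := rfl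
  have hLm : Measurable L := L.continuous_of_finiteDimensional.measurable
  rw [h1, ← Measure.map_map (by fun_prop) hLm,
    Measure.map_linearMap_addHaar_eq_smul_addHaar volume (by rw [hdet]; exact hpos.ne'),
    Measure.map_smul, map_add_right_eq_self, hdet, abs_of_pos (inv_pos.2 hpos)]

/-- The density of the hyperbolic measure. -/
def hypDensity (ζ : κ → ℂ) : ENNReal := ∏ i, ENNReal.ofReal (((ζ i).im ^ 2)⁻¹)

theorem measurable_hypDensity : Measurable (hypDensity : (κ → ℂ) → ENNReal) := by
  refine Finset.measurable_prod _ fun i _ => ENNReal.measurable_ofReal.comp ?_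
  exact ((Complex.measurable_im.comp (measurable_pi_apply i)).pow_const 2).inv

/-- The hyperbolic measure on a product of half planes. -/
def hypMeasure (κ : Type*) [Fintype κ] : Measure (κ → ℂ) := volume.withDensity hypDensity

theorem hypMeasure_image_scaleMap {a d : κ → ℝ} (ha : ∀ i, 0 < a i) (hd : ∀ i, 0 < d i) {b : κ → ℂ}
    (hb : ∀ i, (b i).im = 0) {B : Set (κ → ℂ)} (hB : MeasurableSet B) :
    hypMeasure κ (scaleMap a d b '' B) = ENNReal.ofReal (∏ i, a i / d i) * hypMeasure κ B := by
  have hpos : 0 < ∏ i, a i * d i := Finset.prod_pos fun i _ => mul_pos (ha i) (hd i)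
  have hinj := scaleMap_injective ha hd b
  have hT := continuous_scaleMap a d b
  have hTB : MeasurableSet (scaleMap a d b '' B) :=
    hB.image_of_continuousOn_injOn hT.continuousOn hinj.injOn
  have hvol : (volume : Measure (κ → ℂ)) =
      ENNReal.ofReal (∏ i, a i * d i) • Measure.map (scaleMap a d b) volume := by
    rw [map_scaleMap ha hd, smul_smul, ← ENNReal.ofReal_mul hpos.le, mul_inv_cancel₀ hpos.ne']
    simp
  have hdens : ∀ ζ, hypDensity (scaleMap a d b ζ) =
      ENNReal.ofReal (∏ i, (d i ^ 2)⁻¹) * hypDensity ζ := by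
    intro ζ
    rw [ENNReal.ofReal_prod_of_nonneg fun i _ => by positivity, hypDensity, hypDensity,
      ← Finset.prod_mul_distrib]
    refine Finset.prod_congr rfl fun i _ => ?_
    rw [← ENNReal.ofReal_mul (by positivity)]
    simp [scaleMap, scaleReIm_apply, hb, mul_pow, mul_comm]
  rw [hypMeasure, withDensity_apply _ hTB, withDensity_apply _ hB]
  conv_lhs => rw [hvol]
  rw [Measure.restrict_smul, lintegral_smul_measure, setLIntegral_map hTB measurable_hypDensity
    hT.measurable, hinj.preimage_image]
  simp_rw [hdens]
  rw [lintegral_const_mul _ measurable_hypDensity, smul_eq_mul, ← mul_assoc,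
    ← ENNReal.ofReal_mul hpos.le, ← Finset.prod_mul_distrib]
  congr 2
  refine Finset.prod_congr rfl fun i _ => ?_
  have := (hd i).ne'
  field_simp

theorem hypMeasure_absolutelyContinuous : hypMeasure κ ≪ volume :=
  withDensity_absolutelyContinuous _ _

theorem hypMeasure_lt_top {K : Set (κ → ℂ)} (hK : IsCompact K)
    (hKim : ∀ ζ ∈ K, ∀ i, 0 < (ζ i).im) : hypMeasure κ K < ⊤ := by
  rw [hypMeasure, withDensity_apply _ hK.measurableSet]
  have hc : ContinuousOn (fun ζ : κ → ℂ => ∏ i, ((ζ i).im ^ 2)⁻¹) K := by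
    refine continuousOn_finsetProd _ fun i _ => ContinuousOn.inv₀ (by fun_prop) fun ζ hζ => ?_
    exact (pow_pos (hKim ζ hζ i) 2).ne'
  obtain ⟨M, hM⟩ := (hK.image_of_continuousOn hc).bddAbove
  refine setLIntegral_lt_top_of_le_nnreal hK.measure_lt_top.ne ⟨M.toNNReal, fun ζ hζ => ?_⟩
  rw [hypDensity, ← ENNReal.ofReal_prod_of_nonneg fun i _ => by positivity]
  exact ENNReal.ofReal_le_ofReal (hM ⟨ζ, hζ, rfl⟩)

theorem hypMeasure_pos {O : Set (κ → ℂ)} (hO : IsOpen O) (hne : O.Nonempty)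
    (him : ∀ ζ ∈ O, ∀ i, 0 < (ζ i).im) : hypMeasure κ O ≠ 0 := by
  intro h
  rw [hypMeasure, withDensity_apply _ hO.measurableSet, setLIntegral_eq_zero_iff hO.measurableSet
    measurable_hypDensity] at h
  refine hO.measure_ne_zero volume hne ?_
  rw [← nonpos_iff_eq_zero]
  refine (measure_mono fun ζ hζ => ?_).trans (ae_iff.1 h).le
  simp only [Set.mem_ofPred_eq, Classical.not_imp]
  refine ⟨hζ, Finset.prod_ne_zero_iff.2 fun i _ => ?_⟩
  have := him ζ hζ i
  rw [Ne, ENNReal.ofReal_eq_zero, not_le]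
  positivity

end HyperbolicMeasure

end

section

open Set Filter Topology Metric MeasureTheory

section Contradiction

variable {ι : Type*} [Fintype ι] [DecidableEq ι] {D : Set (ι → ℂ)} {I : Finset ι}
  {G : Set (ι → ℂ)}

theorem Good.exists_finite_fibre_nhds (hD : IsOpen D) (hDim : ∀ z ∈ D, ∀ i ∈ I, 0 < (z i).im)
    (h : Good D I G) {p : ι → ℂ} (hp : p ∈ D) :
    ∃ O ∈ 𝓝 p, MeasurableSet O ∧ (∃ k : ℕ, ∀ y, ∀ s : Finset (ι → ℂ),
      (∀ x ∈ s, x ∈ G ∩ O ∧ I.restrict x = y) → s.card ≤ k) ∧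
      ∃ S, MeasurableSet S ∧ hypMeasure I S < ⊤ ∧ MapsTo I.restrict O S := by
  have hres : Continuous (I.restrict : (ι → ℂ) → I → ℂ) := Finset.continuous_restrict I
  have hS : ∀ r, closedBall p r ⊆ D → MeasurableSet (I.restrict '' closedBall p r) ∧
      hypMeasure I (I.restrict '' closedBall p r) < ⊤ := by
    intro r hr
    have hc := (isCompact_closedBall p r).image hres
    refine ⟨hc.measurableSet, hypMeasure_lt_top hc ?_⟩
    rintro _ ⟨x, hx, rfl⟩ i
    exact hDim x (hr hx) i i.2
  by_cases hpG : p ∈ G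
  · obtain ⟨r, hr, hrD, ρ, hρ, -, ⟨k, hk⟩, -⟩ := h.exists_regular_nhds hD hpG
    have hO : IsOpen (ball p r ∩ I.restrict ⁻¹' ball (I.restrict p) ρ) :=
      isOpen_ball.inter (isOpen_ball.preimage hres)
    refine ⟨_, hO.mem_nhds ⟨mem_ball_self hr, mem_ball_self hρ⟩, hO.measurableSet,
      ⟨k, fun y s hs => ?_⟩, _, (hS r hrD).1, (hS r hrD).2,
      fun x hx => ⟨x, ball_subset_closedBall hx.1, rfl⟩⟩
    rcases s.eq_empty_or_nonempty with rfl | ⟨x, hx⟩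
    · simp
    · refine hk y ?_ s fun x hx => ⟨(hs x hx).1.1, (hs x hx).1.2.1, (hs x hx).2⟩
      rw [← (hs x hx).2]
      exact (hs x hx).1.2.2
  · obtain ⟨r, hr, hrD⟩ := Metric.nhds_basis_closedBall.mem_iff.1 (hD.mem_nhds hp)
    have hO : IsOpen (ball p r ∩ (closure G)ᶜ) := isOpen_ball.inter isClosed_closure.isOpen_compl
    refine ⟨_, hO.mem_nhds ⟨mem_ball_self hr, fun hc => hpG (h.closed p hp hc)⟩, hO.measurableSet,
      ⟨0, fun y s hs => ?_⟩, _, (hS r hrD).1, (hS r hrD).2,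
      fun x hx => ⟨x, ball_subset_closedBall hx.1, rfl⟩⟩
    rw [Nat.le_zero, Finset.card_eq_zero, Finset.eq_empty_iff_forall_notMem]
    exact fun x hx => (hs x hx).1.2.2 (subset_closure (hs x hx).1.1)

theorem vflow_eq_scaleMap {κ : Type*} [Fintype κ] [DecidableEq κ] (j : κ) (ε : ℝ) :
    vflow j ε = scaleMap (fun _ => 1) (Function.update (fun _ => 1) j (Real.exp (-ε))) 0 := by
  ext ζ i
  by_cases hi : i = j
  · subst hi; simp [vflow, scaleMap, scaleReIm_apply]
  · simp [vflow, scaleMap, scaleReIm_apply, hi]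

/-- There is no nonempty invariant family of local sections stable in a coordinate direction. -/
theorem Good.false_of_lift {Γ : Type*} [Group Γ] [Countable Γ] [MulAction Γ (ι → ℂ)]
    [ContinuousConstSMul Γ (ι → ℂ)] (hD : IsOpen D) (hDim : ∀ z ∈ D, ∀ i ∈ I, 0 < (z i).im)
    (h : Good D I G) (j : I)
    (hlift : ∀ p ∈ G, ∀ O ∈ 𝓝 p, ∃ ε > 0, ∀ t ∈ ball (p j) ε, ∃ q ∈ G, q ∈ O ∧
      ∀ i ∈ I, q i = Function.update p j t i)
    (hΓG : ∀ γ : Γ, ∀ z ∈ G, γ • z ∈ G)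
    (hfree : ∀ γ : Γ, ∀ z ∈ D, γ • z = z → γ = 1)
    (hdisc : ∀ C ⊆ D, IsCompact C → {γ : Γ | ∃ z ∈ C, γ • z ∈ C}.Finite)
    {C : Set (ι → ℂ)} (hC : IsCompact C) (hCD : C ⊆ D) (hcov : ∀ z ∈ D, ∃ γ : Γ, γ • z ∈ C)
    {a b : Γ → ι → ℝ} (ha : ∀ γ, ∀ i ∈ I, 0 < a γ i)
    (hact : ∀ (γ : Γ) (z : ι → ℂ), ∀ i ∈ I, (γ • z : ι → ℂ) i = a γ i * z i + b γ i)
    {O : Set (I → ℂ)} (hO : IsOpen O) (hOne : O.Nonempty) (hOG : O ⊆ I.restrict '' G) : False := by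
  have hres : Continuous (I.restrict : (ι → ℂ) → I → ℂ) := Finset.continuous_restrict I
  have hlift' : ∀ p ∈ G, ∀ O ∈ 𝓝 p, ∀ᶠ τ in 𝓝 (0 : ℝ), ∃ q ∈ G, q ∈ O ∧
      I.restrict q = vflow j τ (I.restrict p) := by
    intro p hp O hO
    obtain ⟨ε, hε, hq⟩ := hlift p hp O hO
    have hc : Continuous fun τ => vflow j τ (I.restrict p) j :=
      (continuous_apply j).comp ((continuous_vflow j).comp (continuous_id.prodMk continuous_const))
    have h1 : ∀ᶠ τ in 𝓝 (0 : ℝ), vflow j τ (I.restrict p) j ∈ ball (p j) ε := by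
      refine hc.continuousAt.eventually (isOpen_ball.mem_nhds ?_)
      simpa [vflow_zero] using hε
    filter_upwards [h1] with τ hτ
    obtain ⟨q, hqG, hqO, hqI⟩ := hq _ hτ
    refine ⟨q, hqG, hqO, ?_⟩
    ext i
    rw [Finset.restrict, hqI i i.2]
    by_cases hi : i = j
    · subst hi; simp
    · simp [vflow, hi]
  set ψ : Γ → (I → ℂ) → (I → ℂ) := fun γ => scaleMap (fun i : I => a γ i)
    (fun i : I => a γ i) (fun i : I => (b γ i : ℂ)) with hψdef
  have hψ : ∀ (γ : Γ) (z : ι → ℂ), I.restrict (γ • z : ι → ℂ) = ψ γ (I.restrict z) := by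
    intro γ z
    ext i
    rw [Finset.restrict, hact γ z i i.2]
    apply Complex.ext <;> simp [hψdef, scaleMap, scaleReIm_apply]
  have hψinj : ∀ γ, Function.Injective (ψ γ) := fun γ =>
    scaleMap_injective (fun i : I => ha γ i i.2) (fun i : I => ha γ i i.2) _
  have hψφ : ∀ γ : Γ, ∀ z τ, vflow j τ (ψ γ z) = ψ γ (vflow j τ z) := by
    intro γ z τ
    ext i
    by_cases hi : i = j
    · subst hi
      apply Complex.ext <;> simp [hψdef, scaleMap, scaleReIm_apply, vflow, mul_left_comm]
    · simp [hψdef, scaleMap, scaleReIm_apply, vflow, hi]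
  have hm : ∀ γ : Γ, ∀ B, MeasurableSet B → hypMeasure I (ψ γ '' B) = hypMeasure I B := by
    intro γ B hB
    rw [hψdef, hypMeasure_image_scaleMap (fun i : I => ha γ i i.2) (fun i : I => ha γ i i.2) (by simp) hB]
    rw [Finset.prod_congr rfl fun (i : I) _ => div_self (ha γ i i.2).ne']
    simp
  obtain ⟨ε, hε, hnull⟩ := h.exists_null hD j hlift' hΓG hC hCD hcov hψ hψinj hψφ
    hypMeasure_absolutelyContinuous hm
  refine false_of_expanding_flow (Γ := Γ) hres (continuous_vflow j) (vflow_zero j) (vflow_add j) hD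
    h.sub h.closed
    (fun p hp => vflow_injective j (hDim p (h.sub hp) j j.2).ne') hlift' hε.le hΓG hfree hdisc hC
    hCD hcov hψ hψinj (fun γ z _ τ => hψφ γ _ τ) hm (c := ENNReal.ofReal (Real.exp ε)) ?_ ?_ hnull ?_
    fun p hp => h.exists_finite_fibre_nhds hD hDim hp
  · rw [← ENNReal.ofReal_one]
    exact (ENNReal.ofReal_lt_ofReal_iff (Real.exp_pos _)).2 (by simpa using hε)
  · intro B hB
    rw [vflow_eq_scaleMap, hypMeasure_image_scaleMap (by simp) (fun i => ?_) (by simp) hB]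
    · congr 2
      rw [Finset.prod_eq_single j (fun i _ hi => by simp [hi]) (by simp)]
      simp [Real.exp_neg]
    · by_cases hi : i = j
      · subst hi; simp [Real.exp_pos]
      · simp [hi]
  · intro h0
    refine hypMeasure_pos hO hOne (fun ζ hζ i => ?_) (measure_mono_null hOG h0)
    obtain ⟨x, hx, rfl⟩ := hOG hζ
    exact hDim x (h.sub hx) i i.2

end Contradiction

end

section

open Set Filter Topology Metric MeasureTheory

section Minimality

variable {ι : Type*} [Fintype ι] [DecidableEq ι] {D : Set (ι → ℂ)} {I : Finset ι}
  {X : Set (ι → ℂ)}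

theorem smul_mem_nonIso {Γ : Type*} [Group Γ] [MulAction Γ (ι → ℂ)]
    [ContinuousConstSMul Γ (ι → ℂ)] {a b : Γ → ι → ℝ}
    (hact : ∀ (γ : Γ) (z : ι → ℂ), ∀ i ∈ I, (γ • z : ι → ℂ) i = a γ i * z i + b γ i)
    (hX : ∀ γ : Γ, ∀ z ∈ X, γ • z ∈ X) {j : ι} (γ : Γ) {z : ι → ℂ} (hz : z ∈ nonIso I j X) :
    γ • z ∈ nonIso I j X := by
  refine ⟨hX γ z hz.1, fun O hO => ?_⟩
  obtain ⟨q, hqX, hqO, hqz, hq⟩ := hz.2 ((fun x => γ • x) ⁻¹' O)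
    ((continuous_const_smul γ).continuousAt hO)
  refine ⟨γ • q, hX γ q hqX, hqO, fun h => hqz (smul_left_cancel γ h), fun i hi hij => ?_⟩
  rw [hact γ q i hi, hact γ z i hi, hq i hi hij]

/-- `X` contains a nonisolated point of `X`. -/
def HasAccPt (X : Set (ι → ℂ)) : Prop :=
  ∃ p ∈ X, ∀ O ∈ 𝓝 p, ∃ q ∈ X, q ∈ O ∧ q ≠ p

theorem Good.hasAccPt_nonIso (hD : IsOpen D) (h : Good D I X) {j : ι} (hj : j ∈ I)
    (hne : (nonIso I j X).Nonempty) : HasAccPt (nonIso I j X) := by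
  obtain ⟨p, hp⟩ := hne
  refine ⟨p, hp, fun O hO => ?_⟩
  obtain ⟨ε, hε, hq⟩ := h.nonIso_lift hD hj hp hO
  have h2 : p j + (ε / 2 : ℝ) ∈ ball (p j) ε := by
    rw [mem_ball, dist_self_add_left, Complex.norm_real, Real.norm_of_nonneg (half_pos hε).le]
    linarith
  obtain ⟨q, hqX, hqO, hqI⟩ := hq _ h2
  refine ⟨q, hqX, hqO, fun hqp => ?_⟩
  have h3 := hqI j hj
  rw [hqp, Function.update_self, left_eq_add, Complex.ofReal_eq_zero] at h3
  linarith

/-- Repeated lifting along coordinates: a family closed under `nonIso` contains sets surjecting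
onto a polydisc. -/
theorem exists_saturated (hD : IsOpen D) {𝒦 : Set (Set (ι → ℂ))}
    (hgood : ∀ X ∈ 𝒦, Good D I X ∧ X.Nonempty)
    (hstep : ∀ X ∈ 𝒦, ∀ j ∈ I, nonIso I j X ∈ 𝒦) (J : Finset ι) (hJ : J ⊆ I) :
    ∀ X ∈ 𝒦, ∃ p ∈ X, ∀ r ρ : ℝ, 0 < r → 0 < ρ → closedBall p r ⊆ D →
      (∀ q ∈ X, q ∈ closedBall p r → (∀ i ∈ I, dist (q i) (p i) < ρ) → q ∈ ball p r) →
      ∀ z : ι → ℂ, (∀ i ∈ I, i ∉ J → z i = p i) → (∀ i ∈ I, dist (z i) (p i) < ρ) →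
        ∃ q ∈ X, q ∈ ball p r ∧ ∀ i ∈ I, q i = z i := by
  induction J using Finset.induction_on with
  | empty =>
    intro X hX
    obtain ⟨p, hp⟩ := (hgood X hX).2
    exact ⟨p, hp, fun r ρ hr _ _ _ z hz _ =>
      ⟨p, hp, mem_ball_self hr, fun i hi => (hz i hi (by simp)).symm⟩⟩
  | insert j J hjJ ih =>
    intro X hX
    have hj : j ∈ I := hJ (Finset.mem_insert_self _ _)
    have h := (hgood X hX).1
    set B := nonIso I j X with hB
    have hBX : B ⊆ X := fun x hx => hx.1
    have hBgood := (hgood B (hstep X hX j hj)).1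
    obtain ⟨p, hp, hsat⟩ := ih ((Finset.subset_insert _ _).trans hJ) B (hstep X hX j hj)
    refine ⟨p, hBX hp, fun r ρ hr hρ hrD hnice z hz hzρ => ?_⟩
    have hnice' : ∀ q ∈ B, q ∈ closedBall p r → (∀ i ∈ I, dist (q i) (p i) < ρ) → q ∈ ball p r :=
      fun q hq => hnice q (hBX hq)
    set T : Set ℂ := {t | t ∈ ball (p j) ρ ∧
      ∃ q ∈ B, q ∈ ball p r ∧ ∀ i ∈ I, q i = Function.update z j t i} with hT
    have hTo : IsOpen T := by
      rw [isOpen_iff_mem_nhds]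
      rintro t ⟨ht, q, hqB, hqr, hq⟩
      obtain ⟨ε, hε, hlift⟩ := h.nonIso_lift hD hj hqB (isOpen_ball.mem_nhds hqr)
      have hqj : q j = t := by rw [hq j hj, Function.update_self]
      rw [hqj] at hlift
      filter_upwards [ball_mem_nhds t hε, isOpen_ball.mem_nhds ht] with t' ht' ht'ρ
      obtain ⟨q', hq'B, hq'r, hq'⟩ := hlift t' ht'
      refine ⟨ht'ρ, q', hq'B, hq'r, fun i hi => ?_⟩
      rw [hq' i hi]
      by_cases hij : i = j
      · subst hij; simp
      · simp [hij, hq i hi]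
    have hK : IsCompact ((fun q : ι → ℂ => q j) ''
        ((B ∩ closedBall p r) ∩ {q | ∀ i ∈ I, i ≠ j → q i = z i})) := by
      refine IsCompact.image (IsCompact.inter_right
        (hBgood.isCompact_inter (isCompact_closedBall p r) hrD) ?_) (continuous_apply j)
      simp only [Set.ofPred_forall]
      exact isClosed_iInter fun i => isClosed_iInter fun _ => isClosed_iInter fun _ =>
        isClosed_eq (continuous_apply i) continuous_const
    have hsub : ball (p j) ρ ⊆ T := by
      refine (convex_ball (p j) ρ).isPreconnected.subset_of_closure_inter_subset hTo
        ⟨p j, mem_ball_self hρ, mem_ball_self hρ, ?_⟩ ?_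
      · refine hsat r ρ hr hρ hrD hnice' _ (fun i hi hiJ => ?_) fun i hi => ?_
        · by_cases hij : i = j
          · subst hij; simp
          · rw [Function.update_of_ne hij]
            exact hz i hi (by simp [hij, hiJ])
        · by_cases hij : i = j
          · subst hij; simpa using hρ
          · rw [Function.update_of_ne hij]
            exact hzρ i hi
      · rintro t ⟨ht, htρ⟩
        have hTK : T ⊆ (fun q : ι → ℂ => q j) ''
            ((B ∩ closedBall p r) ∩ {q | ∀ i ∈ I, i ≠ j → q i = z i}) := by
          rintro t ⟨ht, q, hqB, hqr, hq⟩
          refine ⟨q, ⟨⟨hqB, ball_subset_closedBall hqr⟩, fun i hi hij => ?_⟩, ?_⟩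
          · rw [hq i hi, Function.update_of_ne hij]
          · simp [hq j hj]
        obtain ⟨q, ⟨⟨hqB, hqr⟩, hq⟩, rfl⟩ := closure_minimal hTK hK.isClosed ht
        refine ⟨htρ, q, hqB, hnice' q hqB hqr fun i hi => ?_, fun i hi => ?_⟩
        · by_cases hij : i = j
          · subst hij; exact htρ
          · rw [hq i hi hij]; exact hzρ i hi
        · by_cases hij : i = j
          · subst hij; simp
          · rw [hq i hi hij, Function.update_of_ne hij]
    obtain ⟨-, q, hqB, hqr, hq⟩ := hsub (hzρ j hj)
    exact ⟨q, hBX hqB, hqr, fun i hi => by rw [hq i hi, Function.update_eq_self]⟩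

/-- An invariant relatively closed set with finite local projections is discrete. -/
theorem Good.not_hasAccPt {Γ : Type*} [Group Γ] [Countable Γ] [MulAction Γ (ι → ℂ)]
    [ContinuousConstSMul Γ (ι → ℂ)] (hD : IsOpen D)
    (hfree : ∀ γ : Γ, ∀ z ∈ D, γ • z = z → γ = 1)
    (hdisc : ∀ C ⊆ D, IsCompact C → {γ : Γ | ∃ z ∈ C, γ • z ∈ C}.Finite)
    {C : Set (ι → ℂ)} (hC : IsCompact C) (hCD : C ⊆ D) (hcov : ∀ z ∈ D, ∃ γ : Γ, γ • z ∈ C)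
    {a b : Γ → ι → ℝ} (hDim : ∀ z ∈ D, ∀ i ∈ I, 0 < (z i).im) (ha : ∀ γ, ∀ i ∈ I, 0 < a γ i)
    (hact : ∀ (γ : Γ) (z : ι → ℂ), ∀ i ∈ I, (γ • z : ι → ℂ) i = a γ i * z i + b γ i)
    (h : Good D I X) (hX : ∀ γ : Γ, ∀ z ∈ X, γ • z ∈ X) : ¬ HasAccPt X := by
  induction hn : I.card using Nat.strong_induction_on generalizing I X with
  | _ n ih =>
    intro hacc
    set 𝒦 : Set (Set (ι → ℂ)) := {X | Good D I X ∧ (∀ γ : Γ, ∀ z ∈ X, γ • z ∈ X) ∧ HasAccPt X}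
      with h𝒦
    have hstep : ∀ X ∈ 𝒦, ∀ j ∈ I, nonIso I j X ∈ 𝒦 := by
      rintro X ⟨h, hX, hacc⟩ j hj
      refine ⟨h.nonIso_good hD hj, fun γ z hz => smul_mem_nonIso hact hX γ hz,
        h.hasAccPt_nonIso hD hj ?_⟩
      by_contra hempty
      rw [Set.not_nonempty_iff_eq_empty] at hempty
      have hsub : I.erase j ⊆ I := Finset.erase_subset _ _
      exact ih _ (hn ▸ Finset.card_erase_lt_of_mem hj) (I := I.erase j)
        (fun z hz i hi => hDim z hz i (hsub hi)) (fun γ i hi => ha γ i (hsub hi))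
        (fun γ z i hi => hact γ z i (hsub hi)) (h.drop hj hempty) hX rfl hacc
    have hI : I.Nonempty := by
      by_contra hI
      rw [Finset.not_nonempty_iff_eq_empty] at hI
      subst hI
      obtain ⟨p, hp, hacc⟩ := hacc
      obtain ⟨q, hqX, hq, hqp⟩ := hacc _ (h.isolated hp)
      exact hqp (hq hqX (by simp))
    obtain ⟨j, hj⟩ := hI
    obtain ⟨hG, hGinv, hGacc⟩ := hstep X ⟨h, hX, hacc⟩ j hj
    obtain ⟨p, hp, hsat⟩ := exists_saturated hD (𝒦 := 𝒦)
      (fun X hX => ⟨hX.1, hX.2.2.choose, hX.2.2.choose_spec.1⟩) hstep I le_rfl _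
      (hstep X ⟨h, hX, hacc⟩ j hj)
    obtain ⟨r, hr, hrD, ρ, hρ, -, -, hprop, -⟩ := hG.exists_model hD hp Filter.univ_mem
    refine hG.false_of_lift hD hDim ⟨j, hj⟩ (fun p hp O hO => h.nonIso_lift hD hj hp hO) hGinv hfree
      hdisc hC hCD hcov ha hact (O := ball (I.restrict p) ρ) isOpen_ball ⟨_, mem_ball_self hρ⟩
      fun ζ hζ => ?_
    have hζi : ∀ i (hi : i ∈ I), extendBy I p ζ i = ζ ⟨i, hi⟩ := fun i hi => by simp [extendBy, hi]
    obtain ⟨q, hqG, -, hq⟩ := hsat r ρ hr hρ (fun x hx => (hrD hx).2)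
      (fun q hq hqr hqi => ball_subset_ball (half_le_self hr.le) (hprop q hq hqr hqi))
      (extendBy I p ζ) (fun i hi hi' => absurd hi hi') fun i hi => by
        rw [hζi i hi]
        exact (dist_le_pi_dist ζ (I.restrict p) ⟨i, hi⟩).trans_lt hζ
    refine ⟨q, hqG, ?_⟩
    ext i
    rw [Finset.restrict, hq i i.2, hζi i i.2]

end Minimality

end

section

open Set Filter Topology Metric MeasureTheory

section VerticalLines

variable {ι : Type*} [Fintype ι] [DecidableEq ι] {D : Set (ι → ℂ)} {A : Set (ι → ℂ)} {j : ι}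

theorem Good.update_mem_nonIso (hD : IsOpen D) (hDj : ∀ z ∈ D, ∀ t, Function.update z j t ∈ D)
    (h : Good D Finset.univ A) {p : ι → ℂ} (hp : p ∈ nonIso Finset.univ j A) (t : ℂ) :
    Function.update p j t ∈ nonIso Finset.univ j A := by
  have hj : j ∈ (Finset.univ : Finset ι) := Finset.mem_univ j
  have hpD : p ∈ D := h.sub hp.1
  set u : Set ℂ := {t | Function.update p j t ∈ nonIso Finset.univ j A} with hu
  have hcont : Continuous fun t : ℂ => Function.update p j t := by fun_prop
  have hopen : IsOpen u := by
    rw [Metric.isOpen_iff]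
    intro t ht
    obtain ⟨ε, hε, H⟩ := h.nonIso_lift hD hj ht (O := univ) univ_mem
    refine ⟨ε, hε, fun t' ht' => ?_⟩
    obtain ⟨q, hq, -, hqe⟩ := H t' (by simpa using ht')
    have : q = Function.update p j t' := by
      ext i
      rw [hqe i (Finset.mem_univ i)]
      simp
    rw [hu, mem_ofPred_eq, ← this]
    exact hq
  have hsub : univ ⊆ u := by
    refine isPreconnected_univ.subset_of_closure_inter_subset hopen
      ⟨p j, mem_univ _, by simpa [hu] using hp⟩ ?_
    rintro t ⟨ht, -⟩
    refine (h.nonIso_good hD hj).closed _ (hDj p hpD t) ?_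
    exact map_mem_closure hcont ht fun _ h => h
  exact hsub (mem_univ t)

theorem Good.eq_of_nonIso_nonempty (hD : IsOpen D) (hDc : Convex ℝ D)
    (hDj : ∀ z ∈ D, ∀ t, Function.update z j t ∈ D)
    (hDre : ∀ z ∈ D, ∀ x : ι → ℝ, (fun i => z i + x i) ∈ D)
    (h : Good D Finset.univ A) {Λ : Set (ι → ℂ)} (hΛ : ∀ v ∈ Λ, ∀ z ∈ A, z + v ∈ A)
    (hdense : ∀ x : ι → ℝ, ∀ ε > 0, ∃ v ∈ Λ, ∀ i ≠ j, ‖v i - x i‖ < ε)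
    (hne : (nonIso Finset.univ j A).Nonempty) : A = D := by
  set B : Set (ι → ℂ) := {p | p ∈ D ∧ ∀ t, Function.update p j t ∈ A} with hB
  have hBA : B ⊆ A := fun p hp => by simpa using hp.2 (p j)
  have hnB : nonIso Finset.univ j A ⊆ B := fun p hp =>
    ⟨h.sub hp.1, fun t => (h.update_mem_nonIso hD hDj hp t).1⟩
  have hBcl : closure B ∩ D ⊆ B := by
    rintro z ⟨hz, hzD⟩
    refine ⟨hzD, fun t => h.closed _ (hDj z hzD t) ?_⟩
    have hcont : Continuous fun w : ι → ℂ => Function.update w j t := by fun_prop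
    exact map_mem_closure (f := fun w : ι → ℂ => Function.update w j t) hcont hz fun w hw => hw.2 t
  have hBre : ∀ z ∈ B, ∀ x : ι → ℝ, (fun i => z i + x i) ∈ B := by
    intro z hz x
    refine hBcl ⟨?_, hDre z hz.1 x⟩
    rw [Metric.mem_closure_iff]
    intro ε hε
    obtain ⟨v, hv, hvx⟩ := hdense x (ε / 2) (by linarith)
    have hmem : ∀ t, Function.update (z + v) j t ∈ A := by
      intro t
      have := hΛ v hv _ (hz.2 (t - v j))
      convert this using 1
      ext i
      by_cases hi : i = j
      · subst hi; simp
      · simp [hi]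
    refine ⟨Function.update (z + v) j (z j + x j), ⟨h.sub (hmem _), fun t => ?_⟩, ?_⟩
    · simpa using hmem t
    · refine lt_of_le_of_lt ((dist_pi_le_iff (by linarith : (0 : ℝ) ≤ ε / 2)).2 fun i => ?_)
        (by linarith)
      by_cases hi : i = j
      · subst hi; simp; linarith
      · have := (hvx i hi).le
        rw [norm_sub_rev] at this
        simpa [hi, dist_eq_norm] using this
  have hBopen : IsOpen B := by
    rw [isOpen_iff_mem_nhds]
    intro p hp
    obtain ⟨O', hO', hpO', -, V, hV, hpV, S, hS, hiff⟩ := h.an p (hBA hp) univ univ_mem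
    obtain ⟨ρ, hρ, hball⟩ := Metric.isOpen_iff.1 (hV.inter hO') p ⟨hpV, hpO'⟩
    have key : ball p (ρ / 4) ⊆ A := by
      intro q hq
      have hqρ : q ∈ ball p ρ := ball_subset_ball (by linarith) hq
      have hq0 : ∀ f ∈ S, f q = 0 := by
        intro f hf
        set a : ι → ℂ := fun i => p i + ((q i - p i).re : ℝ) with ha
        set w : ι → ℂ := fun i => ((q i - p i).im : ℝ) with hw
        have hqi : ∀ i, ‖q i - p i‖ < ρ / 4 := fun i => by
          rw [← dist_eq_norm]
          exact (dist_le_pi_dist q p i).trans_lt hq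
        have hin : ∀ τ : ℂ, τ ∈ ball (0 : ℂ) 2 → a + τ • w ∈ ball p ρ := by
          intro τ hτ
          rw [mem_ball_zero_iff] at hτ
          rw [mem_ball, dist_pi_lt_iff hρ]
          intro i
          have e : (a + τ • w) i - p i = ((q i - p i).re : ℝ) + τ * ((q i - p i).im : ℝ) := by
            simp only [ha, hw, Pi.add_apply, Pi.smul_apply, smul_eq_mul]
            ring
          rw [dist_eq_norm, e]
          have h1 := Complex.abs_re_le_norm (q i - p i)
          have h2 := Complex.abs_im_le_norm (q i - p i)
          have h3 := hqi i
          calc _ ≤ ‖(((q i - p i).re : ℝ) : ℂ)‖ + ‖τ * ((q i - p i).im : ℝ)‖ := norm_add_le _ _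
            _ = |(q i - p i).re| + ‖τ‖ * |(q i - p i).im| := by
              rw [norm_mul, Complex.norm_real, Complex.norm_real, Real.norm_eq_abs,
                Real.norm_eq_abs]
            _ < ρ := by nlinarith [norm_nonneg τ, abs_nonneg (q i - p i).im]
        have hd : DifferentiableOn ℂ (fun τ : ℂ => f (a + τ • w)) (ball 0 2) :=
          ((hS f hf).1.differentiableOn_line a w).mono fun τ hτ => (hball (hin τ hτ)).1
        have hz : ∀ τ : ℝ, (τ : ℂ) ∈ ball (0 : ℂ) 2 → f (a + (τ : ℂ) • w) = 0 := by
          intro τ hτ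
          have hmemA : a + (τ : ℂ) • w ∈ A := by
            have := hBA (hBre p hp fun i => (q i - p i).re + τ * (q i - p i).im)
            convert this using 1
            ext i
            simp only [ha, hw, Pi.add_apply, Pi.smul_apply, smul_eq_mul]
            push_cast
            ring
          exact (hiff _ (hball (hin _ hτ)).1).1
            ⟨_, hmemA, (hball (hin _ hτ)).2, fun _ _ => rfl⟩ f hf
        have hfreq : ∃ᶠ τ in 𝓝[≠] (0 : ℂ), f (a + τ • w) = 0 := by
          have ht : Tendsto (fun n : ℕ => (((1 : ℝ) / ((n : ℝ) + 1) : ℝ) : ℂ)) atTop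
              (𝓝[≠] 0) := by
            rw [tendsto_nhdsWithin_iff]
            refine ⟨?_, Eventually.of_forall fun n => ?_⟩
            · have := (Complex.continuous_ofReal.tendsto 0).comp
                (tendsto_one_div_add_atTop_nhds_zero_nat (𝕜 := ℝ))
              simpa only [Function.comp_def, Complex.ofReal_zero] using this
            · have : (0 : ℝ) < 1 / ((n : ℝ) + 1) := by positivity
              exact Complex.ofReal_ne_zero.2 this.ne'
          refine ht.frequently (Frequently.of_forall fun n => hz _ ?_)
          rw [mem_ball_zero_iff, Complex.norm_real, Real.norm_of_nonneg (by positivity)]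
          have : (1 : ℝ) / ((n : ℝ) + 1) ≤ 1 :=
            div_le_one_of_le₀ (by linarith [n.cast_nonneg (α := ℝ)]) (by positivity)
          linarith
        have hI := (hd.analyticOnNhd isOpen_ball).eqOn_zero_of_preconnected_of_frequently_eq_zero
          (convex_ball _ _).isPreconnected (mem_ball_self (by norm_num)) hfreq
          (show Complex.I ∈ ball (0 : ℂ) 2 by simp)
        have e : a + Complex.I • w = q := by
          ext i
          simp only [ha, hw, Pi.add_apply, Pi.smul_apply, smul_eq_mul]
          conv_rhs => rw [← sub_add_cancel (q i) (p i), ← Complex.re_add_im (q i - p i)]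
          ring
        simpa [e] using hI
      obtain ⟨q', hq', -, he⟩ := (hiff q (hball hqρ).1).2 hq0
      have : q' = q := funext fun i => he i (Finset.mem_univ i)
      exact this ▸ hq'
    refine mem_of_superset (ball_mem_nhds p (by linarith : 0 < ρ / 4)) fun q hq => hnB ⟨key hq, ?_⟩
    intro O hO
    have hcont : Continuous fun t : ℂ => Function.update q j t := by fun_prop
    have hev : ∀ᶠ t in 𝓝[≠] (q j), Function.update q j t ∈ O ∩ ball p (ρ / 4) := by
      refine (hcont.tendsto (q j)).eventually ?_ |>.filter_mono nhdsWithin_le_nhds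
      rw [Function.update_eq_self]
      exact inter_mem hO (isOpen_ball.mem_nhds hq)
    obtain ⟨t, ht, htne⟩ := (hev.and self_mem_nhdsWithin).exists
    refine ⟨_, key ht.2, ht.1, fun e => htne ?_, fun i _ hi => by simp [hi]⟩
    simpa using congrFun e j
  have hDB : D ⊆ B := by
    refine hDc.isPreconnected.subset_of_closure_inter_subset hBopen ?_ hBcl
    obtain ⟨p, hp⟩ := hne
    exact ⟨p, h.sub hp.1, hnB hp⟩
  exact h.sub.antisymm (hDB.trans hBA)

end VerticalLines

end

section

open Set Filter Topology Metric MeasureTheory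

section Density

variable {K : Type*} [Field K] [NumberField K] {s : ℕ}

/-- The additive map `𝓞 K → ℝ^s` given by a family of real embeddings. -/
def realEmb (σ : Fin s → (K →+* ℝ)) : 𝓞 K →+ (Fin s → ℝ) where
  toFun a i := σ i (algebraMap (𝓞 K) K a)
  map_zero' := by ext; simp
  map_add' a b := by ext; simp

theorem realEmb_apply (σ : Fin s → (K →+* ℝ)) (a : 𝓞 K) (i : Fin s) :
    realEmb σ a i = σ i (algebraMap (𝓞 K) K a) := rfl

theorem realEmb_mul (σ : Fin s → (K →+* ℝ)) (a b : 𝓞 K) :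
    realEmb σ (a * b) = realEmb σ a * realEmb σ b := by
  ext; simp [realEmb_apply]

theorem span_range_realEmb {σ : Fin s → (K →+* ℝ)} (hσ : Function.Injective σ) :
    Submodule.span ℝ (range (realEmb σ)) = ⊤ := by
  by_contra hne
  obtain ⟨f, hf0, hf⟩ := Submodule.exists_le_ker_of_lt_top _ (lt_top_iff_ne_top.2 hne)
  have hfa : ∀ x : Fin s → ℝ, f x = ∑ i, f (Pi.single i 1) * x i := by
    intro x
    conv_lhs => rw [← Finset.univ_sum_single x]
    rw [map_sum]
    refine Finset.sum_congr rfl fun i _ => ?_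
    have : (Pi.single i (x i) : Fin s → ℝ) = x i • Pi.single i 1 := by
      rw [← Pi.single_smul, smul_eq_mul, mul_one]
    rw [this, map_smul, smul_eq_mul, mul_comm]
  have hO : ∀ a : 𝓞 K, ∑ i, f (Pi.single i 1) * σ i (algebraMap (𝓞 K) K a) = 0 := by
    intro a
    have : f (realEmb σ a) = 0 := hf (Submodule.subset_span (mem_range_self a))
    rwa [hfa] at this
  have hli : LinearIndependent ℝ
      fun i : Fin s => (((σ i).comp (algebraMap (𝓞 K) K) : 𝓞 K →* ℝ) : 𝓞 K → ℝ) :=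
    (linearIndependent_monoidHom (𝓞 K) ℝ).comp
      (fun i : Fin s => ((σ i).comp (algebraMap (𝓞 K) K) : 𝓞 K →* ℝ)) fun i k hik =>
      hσ (IsLocalization.ringHom_ext (nonZeroDivisors (𝓞 K))
        (RingHom.ext fun x => DFunLike.congr_fun hik x))
  have h0 := Fintype.linearIndependent_iff.1 hli (fun i => f (Pi.single i 1)) (by
    ext x
    simpa using hO x)
  refine hf0 (LinearMap.ext fun x => ?_)
  rw [hfa]
  simp [h0]

theorem exists_realEmb_lt {σ : Fin s → (K →+* ℝ)} (hσ : Function.Injective σ)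
    (hdeg : s < Module.finrank ℚ K) {ε : ℝ} (hε : 0 < ε) :
    ∃ a : 𝓞 K, a ≠ 0 ∧ ‖realEmb σ a‖ < ε := by
  by_contra! hcon
  set φ : 𝓞 K →ₗ[ℤ] (Fin s → ℝ) := (realEmb σ).toIntLinearMap with hφ
  have hinj : Function.Injective φ := by
    rw [injective_iff_map_eq_zero]
    intro a ha
    by_contra h
    have := hcon a h
    have e : realEmb σ a = 0 := ha
    rw [e, norm_zero] at this
    linarith
  have hdisc : DiscreteTopology (LinearMap.range φ) := by
    rw [discreteTopology_iff_isOpen_singleton_zero, Metric.isOpen_singleton_iff]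
    refine ⟨ε, hε, ?_⟩
    rintro ⟨_, a, rfl⟩ ha
    by_cases h : a = 0
    · subst h; simp
    · have := hcon a h
      rw [dist_eq_norm, sub_zero] at ha
      exact absurd ha (not_lt.2 this)
  have hlat : IsZLattice ℝ (LinearMap.range φ) := ⟨by
    have : ((LinearMap.range φ : Submodule ℤ (Fin s → ℝ)) : Set (Fin s → ℝ))
      = range (realEmb σ) := by rw [LinearMap.coe_range]; rfl
    rw [this, span_range_realEmb hσ]⟩
  have h1 := ZLattice.rank ℝ (LinearMap.range φ)
  rw [LinearMap.finrank_range_of_inj hinj, RingOfIntegers.rank, Module.finrank_fin_fun] at h1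
  omega

theorem dense_realEmb {σ : Fin s → (K →+* ℝ)} (hσ : Function.Injective σ)
    (hdeg : s < Module.finrank ℚ K) (x : Fin s → ℝ) {ε : ℝ} (hε : 0 < ε) :
    ∃ a : 𝓞 K, ‖realEmb σ a - x‖ < ε := by
  set b := RingOfIntegers.basis K
  set M : ℝ := ∑ k, ‖realEmb σ (b k)‖ with hM
  have hM0 : 0 ≤ M := Finset.sum_nonneg fun _ _ => norm_nonneg _
  obtain ⟨a, ha0, ha⟩ := exists_realEmb_lt hσ hdeg (div_pos hε (by linarith : 0 < M + 1))
  have hane : ∀ i, realEmb σ a i ≠ 0 := by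
    intro i h
    rw [realEmb_apply, map_eq_zero] at h
    exact ha0 (RingOfIntegers.coe_injective (by simpa using h))
  have hspan : Submodule.span ℝ (range fun k => realEmb σ (b k)) = ⊤ := by
    rw [eq_top_iff, ← span_range_realEmb hσ, Submodule.span_le]
    rintro _ ⟨c, rfl⟩
    rw [← b.sum_repr c, map_sum]
    refine Submodule.sum_mem _ fun k _ => ?_
    rw [map_zsmul]
    exact zsmul_mem (Submodule.subset_span (mem_range_self k)) _
  have hx : (fun i => x i / realEmb σ a i) ∈ Submodule.span ℝ (range fun k => realEmb σ (b k)) := by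
    rw [hspan]; trivial
  obtain ⟨c, hc⟩ := (Submodule.mem_span_range_iff_exists_fun ℝ).1 hx
  refine ⟨a * ∑ k, ⌊c k⌋ • b k, ?_⟩
  have hx' : x = realEmb σ a * ∑ k, c k • realEmb σ (b k) := by
    rw [hc]
    ext i
    simp only [Pi.mul_apply]
    field_simp [hane i]
  have e : realEmb σ (a * ∑ k, ⌊c k⌋ • b k) - x
      = - (realEmb σ a * ∑ k, Int.fract (c k) • realEmb σ (b k)) := by
    conv_lhs => rw [hx']
    rw [realEmb_mul, ← mul_sub, map_sum, ← Finset.sum_sub_distrib, ← mul_neg, ← Finset.sum_neg_distrib]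
    congr 1
    refine Finset.sum_congr rfl fun k _ => ?_
    rw [map_zsmul, ← Int.self_sub_floor, sub_smul, neg_sub, Int.cast_smul_eq_zsmul]
  rw [e, norm_neg]
  calc _ ≤ ‖realEmb σ a‖ * ‖∑ k, Int.fract (c k) • realEmb σ (b k)‖ := norm_mul_le _ _
    _ ≤ ‖realEmb σ a‖ * M := by
      refine mul_le_mul_of_nonneg_left ((norm_sum_le _ _).trans ?_) (norm_nonneg _)
      refine Finset.sum_le_sum fun k _ => ?_
      rw [norm_smul, Real.norm_of_nonneg (Int.fract_nonneg _)]
      exact mul_le_of_le_one_left (norm_nonneg _) (Int.fract_lt_one _).le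
    _ ≤ ε / (M + 1) * M := mul_le_mul_of_nonneg_right ha.le hM0
    _ < ε := by
      rw [div_mul_eq_mul_div, div_lt_iff₀ (by linarith)]
      nlinarith

end Density

end

section

open Set Filter Topology Metric MeasureTheory

section Assembly

theorem Set.Finite.of_not_hasAccPt {ι : Type*} [Fintype ι] {A C : Set (ι → ℂ)}
    (hA : ¬HasAccPt A) (hAC : IsCompact (A ∩ C)) : (A ∩ C).Finite := by
  by_contra hinf
  obtain ⟨x, hx, hacc⟩ := Set.Infinite.exists_accPt_of_subset_isCompact hinf hAC Subset.rfl
  refine hA ⟨x, hx.1, fun O hO => ?_⟩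
  obtain ⟨y, hy, hne⟩ := accPt_iff_nhds.1 hacc O hO
  exact ⟨y, hy.2.1, hy.1, hne⟩

theorem Good.univ_of_analytic {ι : Type*} [Fintype ι] [DecidableEq ι] {D A : Set (ι → ℂ)}
    (hsub : A ⊆ D) (hcl : ∀ z ∈ D, z ∈ closure A → z ∈ A)
    (han : ∀ z ∈ D, ∃ V : Set (ι → ℂ), IsOpen V ∧ z ∈ V ∧ V ⊆ D ∧
      ∃ S : Set ((ι → ℂ) → ℂ), (∀ f ∈ S, DifferentiableOn ℂ f V) ∧
        A ∩ V = {w ∈ V | ∀ f ∈ S, f w = 0}) : Good D Finset.univ A where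
  sub := hsub
  closed := hcl
  int p _ l hl := absurd (Finset.mem_univ l) hl
  an p hp O hO := by
    obtain ⟨V, hV, hpV, -, S, hS, hAV⟩ := han p (hsub hp)
    have hopen : IsOpen (V ∩ interior O) := hV.inter isOpen_interior
    have hpm : p ∈ V ∩ interior O := ⟨hpV, mem_interior_iff_mem_nhds.2 hO⟩
    refine ⟨V ∩ interior O, hopen, hpm, fun q hq => interior_subset hq.2, V ∩ interior O, hopen,
      hpm, S, fun f hf => ⟨LineHol.of_differentiableOn hopen ((hS f hf).mono inter_subset_left),
        fun x y hxy => congrArg f (funext fun i => hxy i (by simp))⟩, fun z hz => ⟨?_, ?_⟩⟩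
    · rintro ⟨q, hq, hqO, hqz⟩
      obtain rfl : q = z := funext fun i => hqz i (Finset.mem_univ i)
      have : q ∈ A ∩ V := ⟨hq, hqO.1⟩
      rw [hAV] at this
      exact this.2
    · intro h0
      have : z ∈ A ∩ V := by
        rw [hAV]
        exact ⟨hz.1, h0⟩
      exact ⟨z, this.1, hz, fun _ _ => rfl⟩

variable {K : Type*} [Field K] [NumberField K]

/-- The embeddings of `K` used by the action, as ring homomorphisms on `𝓞 K`. -/
def otHom {s t : ℕ} (σr : Fin s → (K →+* ℝ)) (σc : Fin t → (K →+* ℂ)) (i : Fin (s + t)) :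
    𝓞 K →+* ℂ :=
  (Fin.addCases (motive := fun _ => K →+* ℂ) (fun k => Complex.ofRealHom.comp (σr k))
    (fun k => σc k) i).comp (algebraMap (𝓞 K) K)

theorem otHom_apply {s t : ℕ} (σr : Fin s → (K →+* ℝ)) (σc : Fin t → (K →+* ℂ)) (i : Fin (s + t))
    (a : 𝓞 K) : otEmb σr σc i (algebraMap (𝓞 K) K a) = otHom σr σc i a := by
  refine Fin.addCases (fun k => ?_) (fun k => ?_) i <;> simp [otEmb, otHom]

theorem otHom_castAdd {s t : ℕ} (σr : Fin s → (K →+* ℝ)) (σc : Fin t → (K →+* ℂ)) (k : Fin s)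
    (a : 𝓞 K) : otHom σr σc (Fin.castAdd t k) a = (σr k (algebraMap (𝓞 K) K a) : ℂ) := by
  simp [otHom]

theorem otT_otR_apply {s t : ℕ} (σr : Fin s → (K →+* ℝ)) (σc : Fin t → (K →+* ℂ)) (a : 𝓞 K)
    (u : (𝓞 K)ˣ) (z : Fin (s + t) → ℂ) (i : Fin (s + t)) :
    otT σr σc a (otR σr σc u z) i = otHom σr σc i u * z i + otHom σr σc i a := by
  rw [otT, otR, otHom_apply, otHom_apply]

/-- The affine permutation `T_a ∘ R_u`. -/
def otPerm {s t : ℕ} (σr : Fin s → (K →+* ℝ)) (σc : Fin t → (K →+* ℂ)) (a : 𝓞 K)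
    (u : (𝓞 K)ˣ) : Equiv.Perm (Fin (s + t) → ℂ) where
  toFun z := otT σr σc a (otR σr σc u z)
  invFun z := otT σr σc (-(↑u⁻¹ * a)) (otR σr σc u⁻¹ z)
  left_inv z := by
    ext i
    have h : otHom σr σc i (↑u⁻¹ : 𝓞 K) * otHom σr σc i u = 1 := by rw [← map_mul]; simp
    simp only [otT_otR_apply, map_neg, map_mul]
    linear_combination z i * h
  right_inv z := by
    ext i
    have h : otHom σr σc i u * otHom σr σc i (↑u⁻¹ : 𝓞 K) = 1 := by rw [← map_mul]; simp
    simp only [otT_otR_apply, map_neg, map_mul]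
    linear_combination (z i - otHom σr σc i a) * h

/-- The group `𝓞 K ⋊ U` of affine permutations. -/
def otGroup {s t : ℕ} (σr : Fin s → (K →+* ℝ)) (σc : Fin t → (K →+* ℂ)) (U : Subgroup (𝓞 K)ˣ) :
    Subgroup (Equiv.Perm (Fin (s + t) → ℂ)) where
  carrier := {e | ∃ a, ∃ u ∈ U, e = otPerm σr σc a u}
  one_mem' := ⟨0, 1, U.one_mem, by
    ext z i
    simp [otPerm, otT_otR_apply]⟩
  mul_mem' := by
    rintro _ _ ⟨a, u, hu, rfl⟩ ⟨b, v, hv, rfl⟩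
    refine ⟨a + u * b, u * v, U.mul_mem hu hv, ?_⟩
    ext z i
    simp only [otPerm, Equiv.Perm.coe_mul, Function.comp_apply, Equiv.coe_fn_mk, otT_otR_apply,
      Units.val_mul, map_mul, map_add]
    ring
  inv_mem' := by
    rintro _ ⟨a, u, hu, rfl⟩
    refine ⟨-(↑u⁻¹ * a), u⁻¹, U.inv_mem hu, inv_eq_of_mul_eq_one_right (Equiv.ext fun z => ?_)⟩
    exact (otPerm σr σc a u).right_inv z

theorem countable_otGroup {s t : ℕ} (σr : Fin s → (K →+* ℝ)) (σc : Fin t → (K →+* ℂ))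
    (U : Subgroup (𝓞 K)ˣ) : Countable (otGroup σr σc U) := by
  have : Countable (𝓞 K) := (RingOfIntegers.basis K).equivFun.toEquiv.countable_iff.2 inferInstance
  have : Countable (𝓞 K)ˣ := Units.val_injective.countable
  refine Set.Countable.to_subtype ((countable_range
    (fun p : 𝓞 K × (𝓞 K)ˣ => otPerm σr σc p.1 p.2)).mono ?_)
  rintro _ ⟨a, u, -, rfl⟩
  exact ⟨(a, u), rfl⟩

end Assembly

end

/-- **main theorem.**  Let `K` be a number field of degree `s + 2` with `s` real
embeddings and one pair of complex embeddings, and suppose `Γ = 𝓞 K ⋊ U` acts freely and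
properly discontinuously on `ℍ^s × ℂ` with compact quotient — the Oeljeklaus–Toma manifold
`M_K = (ℍ^s × ℂ)/Γ`.  Then `M_K` has no non-trivial closed complex subvarieties: every closed
complex subvariety is a finite set of points or all of `M_K`.  Equivalently, upstairs:  every
`Γ`-invariant subset `A` of `D = ℍ^s × ℂ` which is closed in `D` and locally the common zero
set of holomorphic functions is either the saturation of a finite set (a finite union of
`Γ`-orbits, i.e. a finite set of points of `M_K`) or all of `D`.  (Every element of the
semidirect product `Γ` is of the form `T_a ∘ R_u`.) -/
theorem ot_lck_no_subvarieties
    (K : Type*) [Field K] [NumberField K] (s : ℕ)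
    (hdeg : Module.finrank ℚ K = s + 2)
    (σr : Fin s → (K →+* ℝ)) (hσr : Function.Bijective σr)
    (σc : K →+* ℂ) (hnonreal : ∃ x, (σc x).im ≠ 0)
    (U : Subgroup (𝓞 K)ˣ)
    (hU : ∀ u ∈ U, ∀ i : Fin s, 0 < σr i (algebraMap (𝓞 K) K (u : 𝓞 K)))
    -- the action is free on `D`:
    (hfree : ∀ (a : 𝓞 K) (u : (𝓞 K)ˣ), u ∈ U →
      ∀ z ∈ {z : Fin (s + 1) → ℂ | ∀ i : Fin s, 0 < (z (Fin.castAdd 1 i)).im},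
        otT σr (fun _ : Fin 1 => σc) a (otR σr (fun _ : Fin 1 => σc) u z) = z →
          a = 0 ∧ u = 1)
    -- the action is properly discontinuous:
    (hdisc : ∀ C ⊆ {z : Fin (s + 1) → ℂ | ∀ i : Fin s, 0 < (z (Fin.castAdd 1 i)).im},
      IsCompact C →
        {p : 𝓞 K × (𝓞 K)ˣ | p.2 ∈ U ∧
          ∃ z ∈ C, otT σr (fun _ : Fin 1 => σc) p.1
            (otR σr (fun _ : Fin 1 => σc) p.2 z) ∈ C}.Finite)
    -- the quotient is compact:
    (hcocompact : ∃ C : Set (Fin (s + 1) → ℂ), IsCompact C ∧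
      C ⊆ {z | ∀ i : Fin s, 0 < (z (Fin.castAdd 1 i)).im} ∧
      ∀ z ∈ {z : Fin (s + 1) → ℂ | ∀ i : Fin s, 0 < (z (Fin.castAdd 1 i)).im},
        ∃ (a : 𝓞 K) (u : (𝓞 K)ˣ), u ∈ U ∧
          otT σr (fun _ : Fin 1 => σc) a (otR σr (fun _ : Fin 1 => σc) u z) ∈ C) :
    -- a closed complex subvariety of `M_K`, described upstairs:
    ∀ A ⊆ {z : Fin (s + 1) → ℂ | ∀ i : Fin s, 0 < (z (Fin.castAdd 1 i)).im},
      -- `A` is closed in `D`: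
      (∀ z ∈ {z : Fin (s + 1) → ℂ | ∀ i : Fin s, 0 < (z (Fin.castAdd 1 i)).im},
        z ∈ closure A → z ∈ A) →
      -- `A` is `Γ`-invariant:
      (∀ (a : 𝓞 K) (u : (𝓞 K)ˣ), u ∈ U → ∀ z ∈ A,
        otT σr (fun _ : Fin 1 => σc) a (otR σr (fun _ : Fin 1 => σc) u z) ∈ A) →
      -- `A` is locally the common zero set of holomorphic functions:
      (∀ z ∈ {z : Fin (s + 1) → ℂ | ∀ i : Fin s, 0 < (z (Fin.castAdd 1 i)).im},
        ∃ V : Set (Fin (s + 1) → ℂ), IsOpen V ∧ z ∈ V ∧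
          V ⊆ {z | ∀ i : Fin s, 0 < (z (Fin.castAdd 1 i)).im} ∧
          ∃ S : Set ((Fin (s + 1) → ℂ) → ℂ),
            (∀ f ∈ S, DifferentiableOn ℂ f V) ∧
            A ∩ V = {w ∈ V | ∀ f ∈ S, f w = 0}) →
      -- conclusion: `A` is all of `D`, or a finite union of `Γ`-orbits
      (A = {z : Fin (s + 1) → ℂ | ∀ i : Fin s, 0 < (z (Fin.castAdd 1 i)).im}
        ∨ ∃ F : Set (Fin (s + 1) → ℂ), F.Finite ∧
            A = {z | ∃ w ∈ F, ∃ (a : 𝓞 K) (u : (𝓞 K)ˣ), u ∈ U ∧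
              z = otT σr (fun _ : Fin 1 => σc) a (otR σr (fun _ : Fin 1 => σc) u w)}) := by
  classical
  intro A hAD hAcl hAinv hAan
  set σ : Fin 1 → (K →+* ℂ) := fun _ => σc with hσ
  set D : Set (Fin (s + 1) → ℂ) := {z | ∀ i : Fin s, 0 < (z (Fin.castAdd 1 i)).im} with hDdef
  set j : Fin (s + 1) := Fin.natAdd s 0 with hj
  have hne : ∀ i : Fin s, Fin.castAdd 1 i ≠ j := fun i h => by
    have := congrArg Fin.val h
    simp [hj] at this
    omega
  have hcases : ∀ i, i ≠ j → ∃ k : Fin s, i = Fin.castAdd 1 k := by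
    intro i
    refine Fin.addCases (fun k _ => ⟨k, rfl⟩) (fun k hk => absurd ?_ hk) i
    rw [hj, Subsingleton.elim k 0]
  have hD : IsOpen D := by
    rw [hDdef, Set.ofPred_forall]
    exact isOpen_iInter_of_finite fun i => isOpen_lt continuous_const
      (Complex.continuous_im.comp (continuous_apply _))
  have hDc : Convex ℝ D := by
    intro x hx y hy a b ha hb hab i
    have hxi := hx i
    have hyi := hy i
    have e : ((a • x + b • y) (Fin.castAdd 1 i)).im
        = a * (x (Fin.castAdd 1 i)).im + b * (y (Fin.castAdd 1 i)).im := by simp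
    rw [e]
    rcases ha.eq_or_lt with rfl | ha'
    · have : b = 1 := by linarith
      subst this
      linarith
    · have := mul_pos ha' hxi
      have := mul_nonneg hb hyi.le
      linarith
  have hGood : Good D Finset.univ A := Good.univ_of_analytic hAD hAcl hAan
  by_cases hempty : nonIso Finset.univ j A = ∅
  swap
  · left
    refine hGood.eq_of_nonIso_nonempty (j := j) hD hDc (fun z hz t i => ?_) (fun z hz x i => ?_)
      (Λ := Set.range fun a : 𝓞 K => fun i => otHom σr σ i a) ?_ ?_
      (Set.nonempty_iff_ne_empty.2 hempty)
    · rw [Function.update_of_ne (hne i)]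
      exact hz i
    · simpa using hz i
    · rintro _ ⟨a, rfl⟩ z hz
      have := hAinv a 1 U.one_mem z hz
      convert this using 1
      ext i
      simp [otT_otR_apply]
    · intro x ε hε
      obtain ⟨a, ha⟩ := dense_realEmb hσr.injective (by omega) (fun k => x (Fin.castAdd 1 k)) hε
      refine ⟨_, ⟨a, rfl⟩, fun i hi => ?_⟩
      obtain ⟨k, rfl⟩ := hcases i hi
      have h1 := norm_le_pi_norm (realEmb σr a - fun k => x (Fin.castAdd 1 k)) k
      simp only [otHom_castAdd]
      rw [← Complex.ofReal_sub, Complex.norm_real]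
      exact h1.trans_lt ha
  right
  have hGood' : Good D (Finset.univ.erase j) A := hGood.drop (Finset.mem_univ j) hempty
  obtain ⟨C, hC, hCD, hcov⟩ := hcocompact
  have hmk : ∀ a, ∀ u ∈ U, otPerm σr σ a u ∈ otGroup σr σ U := fun a u hu => ⟨a, u, hu, rfl⟩
  have hcount : Countable (otGroup σr σ U) := countable_otGroup σr σ U
  have hcsmul : ContinuousConstSMul (otGroup σr σ U) (Fin (s + 1) → ℂ) := by
    refine ⟨?_⟩
    rintro ⟨_, a, u, hu, rfl⟩
    refine continuous_pi fun i => ?_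
    have : (fun z : Fin (s + 1) → ℂ => otPerm σr σ a u z i)
        = fun z => otHom σr σ i u * z i + otHom σr σ i a := funext fun z =>
      otT_otR_apply σr σ a u z i
    change Continuous fun z : Fin (s + 1) → ℂ => otPerm σr σ a u z i
    rw [this]
    fun_prop
  have hrep : ∀ γ : otGroup σr σ U, ∃ a, ∃ u ∈ U, γ.1 = otPerm σr σ a u := fun γ => γ.2
  choose ra ru hru hreq using hrep
  have hsmul : ∀ (γ : otGroup σr σ U) (z : Fin (s + 1) → ℂ),
      γ • z = otT σr σ (ra γ) (otR σr σ (ru γ) z) := by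
    intro γ z
    change γ.1 z = _
    rw [hreq]
    rfl
  have hnacc : ¬HasAccPt A := by
    refine hGood'.not_hasAccPt (Γ := otGroup σr σ U) hD ?_ ?_ hC hCD ?_
      (a := fun γ i => (otHom σr σ i (ru γ)).re) (b := fun γ i => (otHom σr σ i (ra γ)).re)
      ?_ ?_ ?_ ?_
    · intro γ z hz hfix
      rw [hsmul] at hfix
      obtain ⟨ha, hu⟩ := hfree _ _ (hru γ) z hz hfix
      refine Subtype.ext ?_
      rw [hreq, ha, hu]
      ext z i
      simp [otPerm, otT_otR_apply]
    · intro C' hC'D hC'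
      refine ((hdisc C' hC'D hC').preimage (f := fun γ => (ra γ, ru γ)) ?_).subset ?_
      · intro γ _ γ' _ h
        have h' := Prod.mk.inj h
        refine Subtype.ext ?_
        rw [hreq γ, hreq γ', h'.1, h'.2]
      · rintro γ ⟨z, hz, hγz⟩
        rw [hsmul] at hγz
        exact ⟨hru γ, z, hz, hγz⟩
    · intro z hz
      obtain ⟨a, u, hu, h⟩ := hcov z hz
      exact ⟨⟨_, hmk a u hu⟩, h⟩
    · intro z hz i hi
      obtain ⟨k, rfl⟩ := hcases i (Finset.ne_of_mem_erase hi)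
      exact hz k
    · intro γ i hi
      obtain ⟨k, rfl⟩ := hcases i (Finset.ne_of_mem_erase hi)
      rw [otHom_castAdd, Complex.ofReal_re]
      exact hU _ (hru γ) k
    · intro γ z i hi
      obtain ⟨k, rfl⟩ := hcases i (Finset.ne_of_mem_erase hi)
      rw [hsmul, otT_otR_apply, otHom_castAdd, otHom_castAdd, Complex.ofReal_re, Complex.ofReal_re]
    · intro γ z hz
      rw [hsmul]
      exact hAinv _ _ (hru γ) z hz
  refine ⟨A ∩ C, Set.Finite.of_not_hasAccPt hnacc (hGood.isCompact_inter hC hCD), ?_⟩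
  ext z
  constructor
  · intro hz
    obtain ⟨a, u, hu, h⟩ := hcov z (hAD hz)
    refine ⟨_, ⟨hAinv a u hu z hz, h⟩, -(↑u⁻¹ * a), u⁻¹, U.inv_mem hu, ?_⟩
    exact ((otPerm σr σ a u).left_inv z).symm
  · rintro ⟨w, hw, a, u, hu, rfl⟩
    exact hAinv a u hu w hw.1

end
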